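/- Let G be a finite group whose character graph Δ(G) is K₄-free with exactly seven vertices, and let M be a normal subgroup of G with R(G) < M such that S := M/R(G) ≅ PSL₂(2^f) for some integer f ≥ 2, the centralizer of M/R(G) in G/R(G) is trivial, the complement of the induced subgraph of Δ(G) on π(S) is not bipartite, and every vertex set of an odd cycle in the complement of Δ(G) is contained in π(S). Then it is impossible that one of |π(2^f − 1)|, |π(2^f + 1)| equals 1 while the other equals 3 (i.e. Δ(S) is not isomorphic to K₃ ∪ K₁ ∪ K₁). -/

import Mathlib

open CategoryTheory

/-- `cd(G)`: the set of character degrees of `G`, i.e. the dimensions of the simple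
finite-dimensional complex representations of `G`. -/
def charDegrees (G : Type) [Group G] : Set ℕ :=
  { n | ∃ V : FDRep ℂ G, Simple V ∧ Module.finrank ℂ V = n }

/-- `ρ(G)`: the set of primes dividing some character degree of `G`. -/
def charPrimes (G : Type) [Group G] : Set ℕ :=
  { p | p.Prime ∧ ∃ n ∈ charDegrees G, p ∣ n }

/-- The character graph `Δ(G)`, on vertex set `ρ(G)`: two distinct primes `p`, `q`
are adjacent iff `p * q` divides some character degree of `G`. -/
def charGraph (G : Type) [Group G] : SimpleGraph (charPrimes G) where
  Adj p q := (p : ℕ) ≠ (q : ℕ) ∧ ∃ n ∈ charDegrees G, (p : ℕ) * (q : ℕ) ∣ n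
  symm := by
    constructor
    rintro p q ⟨h, n, hn, hd⟩
    exact ⟨fun e => h e.symm, n, hn, by rwa [mul_comm]⟩
  loopless := by constructor; rintro p ⟨h, -⟩; exact h rfl

/-- The solvable radical `R(G)` of `G`: the largest solvable normal subgroup of `G`
(realized as the join of all solvable normal subgroups). -/
def solvableRadical (G : Type*) [Group G] : Subgroup G :=
  ⨆ N : { N : Subgroup G // N.Normal ∧ IsSolvable ↥N }, (N : Subgroup G)

instance solvableRadical_normal (G : Type*) [Group G] : (solvableRadical G).Normal := by
  constructor
  intro n hn g
  refine Subgroup.iSup_induction (C := fun x => g * x * g⁻¹ ∈ solvableRadical G)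
    (fun N : { N : Subgroup G // N.Normal ∧ IsSolvable ↥N } => (N : Subgroup G)) hn ?_ ?_ ?_
  · intro N x hx
    exact Subgroup.mem_iSup_of_mem N (N.2.1.conj_mem x hx g)
  · simpa using Subgroup.one_mem _
  · intro x y hx hy
    have h : g * (x * y) * g⁻¹ = (g * x * g⁻¹) * (g * y * g⁻¹) := by group
    rw [h]; exact Subgroup.mul_mem _ hx hy

/-- `PSL₂(F)`: the special linear group `SL₂(F)` modulo its center. -/
abbrev PSL2 (F : Type) [Field F] :=
  Matrix.SpecialLinearGroup (Fin 2) F ⧸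
    Subgroup.center (Matrix.SpecialLinearGroup (Fin 2) F)

/-- The join `Γ ⋆ Δ` of two simple graphs: the disjoint union together with all
edges between the two vertex sets. -/
def graphJoin {α β : Type*} (G : SimpleGraph α) (H : SimpleGraph β) :
    SimpleGraph (α ⊕ β) :=
  (G ⊕g H) ⊔
    { Adj := fun u v => u.isLeft ≠ v.isLeft
      symm := ⟨fun _ _ h => h.symm⟩
      loopless := ⟨fun _ h => h rfl⟩ }

/-- The image of a subgroup `M` of `G` in `G/R(G)`; when `R(G) ≤ M` this is `M/R(G)`. -/
def radicalQuotImage {G : Type*} [Group G] (M : Subgroup G) :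
    Subgroup (G ⧸ solvableRadical G) :=
  M.map (QuotientGroup.mk' (solvableRadical G))

/-- elementary irreducibility -/
def Irr {G V : Type} [Group G] [AddCommGroup V] [Module ℂ V] (ρ : Representation ℂ G V) : Prop :=
  Nontrivial V ∧ ∀ W : Submodule ℂ V, (∀ g, ∀ v ∈ W, ρ g v ∈ W) → W = ⊥ ∨ W = ⊤

theorem Irr.isIrreducible {G V : Type} [Group G] [AddCommGroup V] [Module ℂ V]
    {ρ : Representation ℂ G V} (h : Irr ρ) : ρ.IsIrreducible := by
  have := h.1
  refine { exists_pair_ne := ⟨⊥, ⊤, ?_⟩, eq_bot_or_eq_top := ?_ }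
  · intro e
    have := congrArg Subrepresentation.toSubmodule e
    exact bot_ne_top (α := Submodule ℂ V) this
  · intro W
    rcases h.2 W.toSubmodule (fun g v hv => W.apply_mem_toSubmodule g hv) with e | e
    · left; exact Subrepresentation.toSubmodule_injective e
    · right; exact Subrepresentation.toSubmodule_injective e

theorem mem_charDegrees_of_irr {G V : Type} [Group G] [Finite G] [AddCommGroup V] [Module ℂ V]
    [FiniteDimensional ℂ V] {ρ : Representation ℂ G V} (h : Irr ρ) :
    Module.finrank ℂ V ∈ charDegrees G := by
  have := h.isIrreducible
  have : Fintype G := Fintype.ofFinite G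
  refine ⟨FDRep.of ρ, ?_, rfl⟩
  rw [FDRep.simple_iff_end_is_rank_one]
  rw [← (Representation.linHom.invariantsEquivFDRepHom (FDRep.of ρ) (FDRep.of ρ)).finrank_eq]
  refine Eq.trans ((Representation.invariantsEquivIntertwiningMap ρ ρ).finrank_eq) ?_
  exact Representation.IsIrreducible.finrank_intertwiningMap_self ρ

theorem exists_irr_of_mem_charDegrees {G : Type} [Group G] {n : ℕ} (h : n ∈ charDegrees G) :
    ∃ (V : Type) (_ : AddCommGroup V) (_ : Module ℂ V) (_ : FiniteDimensional ℂ V)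
      (ρ : Representation ℂ G V), Irr ρ ∧ Module.finrank ℂ V = n := by
  obtain ⟨V, hV, hn⟩ := h
  refine ⟨V, inferInstance, inferInstance, inferInstance, V.ρ, ⟨?_, ?_⟩, hn⟩
  · by_contra hs
    rw [not_nontrivial_iff_subsingleton] at hs
    apply Simple.not_isZero V
    rw [Limits.IsZero.iff_id_eq_zero]
    ext x
    exact Subsingleton.elim (α := V) _ _
  · intro W hW
    let σ : Representation ℂ G W :=
      { toFun := fun g => (V.ρ g).restrict (hW g)
        map_one' := by ext; simp
        map_mul' := by intros; ext; simp }
    let f : FDRep.of σ ⟶ V := ⟨FGModuleCat.ofHom W.subtype, fun g => by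
      ext x; rfl⟩
    have hf : ∀ x : W, (f.hom.hom.hom : W → V) x = x := fun x => rfl
    have : Mono f := by
      constructor
      intro Z a b hab
      ext x
      have := congrArg (fun t : Z ⟶ V => t.hom.hom.hom x) hab
      exact this
    by_cases h0 : f = 0
    · left
      rw [eq_bot_iff]
      intro x hx
      have := congrArg (fun t : FDRep.of σ ⟶ V => t.hom.hom.hom (⟨x, hx⟩ : W)) h0
      exact this
    · right
      have hi : IsIso f := (Simple.mono_isIso_iff_nonzero f).2 h0
      rw [eq_top_iff]
      intro x _
      have h1 : inv f ≫ f = 𝟙 V := IsIso.inv_hom_id f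
      have := congrArg (fun t : V ⟶ V => t.hom.hom.hom x) h1
      have h2 : (f.hom.hom.hom : W → V) ((inv f).hom.hom.hom x) = x := this
      rw [← h2]
      exact Subtype.property ((inv f).hom.hom.hom x : W)

theorem Irr.schur {G V : Type} [Group G] [AddCommGroup V] [Module ℂ V] [FiniteDimensional ℂ V]
    {ρ : Representation ℂ G V} (h : Irr ρ) (T : V →ₗ[ℂ] V) (hT : ∀ g v, T (ρ g v) = ρ g (T v)) :
    ∃ c : ℂ, ∀ v, T v = c • v := by
  have := h.1
  obtain ⟨c, hc⟩ := Module.End.exists_eigenvalue T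
  refine ⟨c, fun v => ?_⟩
  rcases h.2 (Module.End.eigenspace T c) (fun g v hv => by
    rw [Module.End.mem_eigenspace_iff] at hv ⊢
    rw [hT, hv, map_smul]) with e | e
  · exact absurd e hc
  · have : v ∈ Module.End.eigenspace T c := by rw [e]; trivial
    exact Module.End.mem_eigenspace_iff.1 this

theorem Irr.schur_bij {G V V' : Type} [Group G] [AddCommGroup V] [Module ℂ V]
    [AddCommGroup V'] [Module ℂ V']
    {ρ : Representation ℂ G V} {ρ' : Representation ℂ G V'} (h : Irr ρ) (h' : Irr ρ')
    (T : V →ₗ[ℂ] V') (hT : ∀ g v, T (ρ g v) = ρ' g (T v)) (h0 : T ≠ 0) :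
    Function.Bijective T := by
  constructor
  · rw [← LinearMap.ker_eq_bot]
    rcases h.2 (LinearMap.ker T) (fun g v hv => by
      rw [LinearMap.mem_ker] at hv ⊢; rw [hT, hv, map_zero]) with e | e
    · exact e
    · exact absurd (LinearMap.ker_eq_top.1 e) h0
  · rw [← LinearMap.range_eq_top]
    rcases h'.2 (LinearMap.range T) (fun g v hv => by
      obtain ⟨w, rfl⟩ := hv
      exact ⟨ρ g w, hT g w⟩) with e | e
    · exact absurd (LinearMap.range_eq_bot.1 e) h0
    · exact e

section Eop
variable {N Θ V V' : Type} [Group N] [Fintype N] [AddCommGroup Θ] [Module ℂ Θ]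
  [AddCommGroup V] [Module ℂ V] [AddCommGroup V'] [Module ℂ V']

noncomputable def Eop (θ : Representation ℂ N Θ) (σ : Representation ℂ N V)
    (l : Θ →ₗ[ℂ] ℂ) (a : Θ) : V →ₗ[ℂ] V := ∑ n : N, l (θ n⁻¹ a) • σ n

theorem Eop_apply (θ : Representation ℂ N Θ) (σ : Representation ℂ N V)
    (l : Θ →ₗ[ℂ] ℂ) (a : Θ) (v : V) : Eop θ σ l a v = ∑ n : N, l (θ n⁻¹ a) • σ n v := by
  simp [Eop]

theorem Eop_intertwine (θ : Representation ℂ N Θ) (σ : Representation ℂ N V)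
    (σ' : Representation ℂ N V') (φ : V →ₗ[ℂ] V') (hφ : ∀ n v, φ (σ n v) = σ' n (φ v))
    (l : Θ →ₗ[ℂ] ℂ) (a : Θ) (v : V) : Eop θ σ' l a (φ v) = φ (Eop θ σ l a v) := by
  simp [Eop_apply, hφ]

theorem Eop_equivariant (θ : Representation ℂ N Θ) (σ : Representation ℂ N V)
    (l : Θ →ₗ[ℂ] ℂ) (a : Θ) (m : N) (v : V) :
    Eop θ σ l (θ m a) v = σ m (Eop θ σ l a v) := by
  simp only [Eop_apply, map_sum, map_smul]
  rw [← Equiv.sum_comp (Equiv.mulLeft m)]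
  refine Finset.sum_congr rfl fun n _ => ?_
  simp only [Equiv.coe_mulLeft, mul_inv_rev, map_mul, Module.End.mul_apply]
  rw [← Module.End.mul_apply (θ m⁻¹) (θ m), ← map_mul]
  simp

/-- `Eop` as a linear map in `a`. -/
noncomputable def EopL (θ : Representation ℂ N Θ) (σ : Representation ℂ N V)
    (l : Θ →ₗ[ℂ] ℂ) (v : V) : Θ →ₗ[ℂ] V :=
  ∑ n : N, (l ∘ₗ θ n⁻¹).smulRight (σ n v)

theorem EopL_apply (θ : Representation ℂ N Θ) (σ : Representation ℂ N V)
    (l : Θ →ₗ[ℂ] ℂ) (v : V) (a : Θ) : EopL θ σ l v a = Eop θ σ l a v := by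
  simp [EopL, Eop_apply]

theorem Eop_ne {θ : Representation ℂ N Θ} {σ : Representation ℂ N V} (hθ : Irr θ) (hσ : Irr σ)
    (hne : ∀ T : Θ →ₗ[ℂ] V, (∀ n a, T (θ n a) = σ n (T a)) → ¬ Function.Bijective T)
    (l : Θ →ₗ[ℂ] ℂ) (a : Θ) (v : V) : Eop θ σ l a v = 0 := by
  rw [← EopL_apply]
  by_contra h
  have h1 : ∀ n a, EopL θ σ l v (θ n a) = σ n (EopL θ σ l v a) := fun n a => by
    rw [EopL_apply, EopL_apply, Eop_equivariant]
  exact hne _ h1 (hθ.schur_bij hσ _ h1 (fun h0 => h (by rw [h0]; rfl)))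

theorem Eop_self [FiniteDimensional ℂ Θ] {θ : Representation ℂ N Θ} (hθ : Irr θ)
    (l : Θ →ₗ[ℂ] ℂ) (a b : Θ) :
    (Module.finrank ℂ Θ : ℂ) • Eop θ θ l a b = ((Fintype.card N : ℂ) * l b) • a := by
  obtain ⟨c, hc⟩ := hθ.schur (EopL θ θ l b) (fun n a => by
    rw [EopL_apply, EopL_apply, Eop_equivariant])
  have h1 : LinearMap.trace ℂ Θ (EopL θ θ l b) = c * Module.finrank ℂ Θ := by
    have : EopL θ θ l b = c • LinearMap.id := by ext v; simpa using hc v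
    rw [this]; simp
  have h2 : LinearMap.trace ℂ Θ (EopL θ θ l b) = Fintype.card N * l b := by
    simp only [EopL, map_sum]
    have : ∀ n : N, LinearMap.trace ℂ Θ ((l ∘ₗ θ n⁻¹).smulRight (θ n b)) = l b := by
      intro n
      rw [LinearMap.trace_smulRight]
      simp
    rw [Finset.sum_congr rfl (fun n _ => this n)]
    simp
  rw [← EopL_apply, hc, smul_smul, ← h2, h1, mul_comm]
end Eop

section Clifford
variable {G Θ V : Type} [Group G] [AddCommGroup Θ] [Module ℂ Θ] [AddCommGroup V] [Module ℂ V]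

def homN (N : Subgroup G) (θ : Representation ℂ N Θ) (ρ : Representation ℂ G V) :
    Submodule ℂ (Θ →ₗ[ℂ] V) where
  carrier := {φ | ∀ (n : N) a, φ (θ n a) = ρ n (φ a)}
  add_mem' := by intro x y hx hy n a; simp [hx n a, hy n a]
  zero_mem' := by intro n a; simp
  smul_mem' := by intro c x hx n a; simp [hx n a]

def Gam (N : Subgroup G) [N.Normal] (θ : Representation ℂ N Θ) :
    Subgroup (G × (Module.End ℂ Θ)ˣ) where
  carrier := {x | ∀ (n : N) a, x.2.1 (θ n a) = θ (MulAut.conjNormal x.1 n) (x.2.1 a)}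
  one_mem' := by intro n a; simp
  mul_mem' := by
    intro x y hx hy n a
    simp only [Prod.snd_mul, Units.val_mul, Module.End.mul_apply, Prod.fst_mul, map_mul,
      MulAut.mul_apply]
    erw [hy n a, hx]
  inv_mem' := by
    intro x hx n a
    have h1 : ∀ b, x.2⁻¹.1 (x.2.1 b) = b := fun b => by
      rw [← Module.End.mul_apply]; simp
    have h2 : ∀ b, x.2.1 (x.2⁻¹.1 b) = b := fun b => by
      rw [← Module.End.mul_apply]; simp
    have := hx (MulAut.conjNormal x.1⁻¹ n) (x.2⁻¹.1 a)
    rw [h2, ← MulAut.mul_apply, ← map_mul] at this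
    simp only [mul_inv_cancel, map_one, MulAut.one_apply] at this
    simp only [Prod.snd_inv, Prod.fst_inv]
    rw [← this, h1]

/-- inertia group -/
def Iner (N : Subgroup G) [N.Normal] (θ : Representation ℂ N Θ) : Subgroup G :=
  (Gam N θ).map (MonoidHom.fst _ _)

theorem mem_Iner {N : Subgroup G} [N.Normal] {θ : Representation ℂ N Θ} {g : G} :
    g ∈ Iner N θ ↔ ∃ A : (Module.End ℂ Θ)ˣ, (g, A) ∈ Gam N θ := by
  constructor
  · rintro ⟨⟨x, A⟩, h, rfl⟩; exact ⟨A, h⟩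
  · rintro ⟨A, h⟩; exact ⟨_, h, rfl⟩

theorem mem_Gam {N : Subgroup G} [N.Normal] {θ : Representation ℂ N Θ}
    {x : G × (Module.End ℂ Θ)ˣ} : x ∈ Gam N θ ↔
    ∀ (n : N) a, x.2.1 (θ n a) = θ (MulAut.conjNormal x.1 n) (x.2.1 a) := Iff.rfl

variable {N : Subgroup G} [N.Normal] {θ : Representation ℂ N Θ} {ρ : Representation ℂ G V}

theorem rho_mul_apply (ρ : Representation ℂ G V) (g h : G) (v : V) :
    ρ (g * h) v = ρ g (ρ h v) := by rw [map_mul]; rfl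

theorem rho_inv_apply (ρ : Representation ℂ G V) (g : G) (v : V) : ρ g⁻¹ (ρ g v) = v := by
  rw [← rho_mul_apply]; simp

theorem rho_apply_inv (ρ : Representation ℂ G V) (g : G) (v : V) : ρ g (ρ g⁻¹ v) = v := by
  rw [← rho_mul_apply]; simp

theorem homN_act {x : G × (Module.End ℂ Θ)ˣ} (hx : x ∈ Gam N θ) {φ : Θ →ₗ[ℂ] V}
    (hφ : φ ∈ homN N θ ρ) : (ρ x.1 ∘ₗ φ ∘ₗ (x.2⁻¹.1 : Θ →ₗ[ℂ] Θ)) ∈ homN N θ ρ := by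
  intro n a
  have h1 := (Gam N θ).inv_mem hx n a
  simp only [Prod.snd_inv, Prod.fst_inv] at h1
  simp only [LinearMap.comp_apply]
  erw [h1]
  rw [hφ, ← rho_mul_apply, ← rho_mul_apply]
  congr 2
  simp [mul_assoc]

/-- the action of `Gam` on `homN` -/
noncomputable def homNRep (N : Subgroup G) [N.Normal] (θ : Representation ℂ N Θ)
    (ρ : Representation ℂ G V) : Representation ℂ (Gam N θ) (homN N θ ρ) where
  toFun x :=
    { toFun := fun φ => ⟨_, homN_act x.2 φ.2⟩
      map_add' := by intro a b; ext; simp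
      map_smul' := by intro a b; ext; simp }
  map_one' := by ext; simp
  map_mul' := by intro x y; ext; simp

theorem homNRep_apply (x : Gam N θ) (φ : homN N θ ρ) (a : Θ) :
    (homNRep N θ ρ x φ : Θ →ₗ[ℂ] V) a = ρ x.1.1 ((φ : Θ →ₗ[ℂ] V) (x.1.2⁻¹.1 a)) := rfl

theorem twist_irr (hθ : Irr θ) (g : G) :
    Irr (θ.comp (MulAut.conjNormal g : MulAut N).toMonoidHom) := by
  refine ⟨hθ.1, fun W hW => hθ.2 W fun n v hv => ?_⟩
  have := hW ((MulAut.conjNormal g : MulAut N).symm n) v hv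
  simpa using this

theorem Eop_rho_of_notMem [Fintype N] [FiniteDimensional ℂ Θ] (hθ : Irr θ) {g : G}
    (hg : g ∉ Iner N θ) {φ : Θ →ₗ[ℂ] V} (hφ : φ ∈ homN N θ ρ) (l : Θ →ₗ[ℂ] ℂ) (a b : Θ) :
    Eop θ (ρ.comp N.subtype) l a (ρ g (φ b)) = 0 := by
  have key := Eop_intertwine θ (θ.comp (MulAut.conjNormal g⁻¹ : MulAut N).toMonoidHom)
    (ρ.comp N.subtype) (ρ g ∘ₗ φ) (fun n v => by
      simp only [MonoidHom.comp_apply, LinearMap.comp_apply]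
      erw [hφ]
      rw [← rho_mul_apply]
      erw [← rho_mul_apply]
      congr 2
      simp [mul_assoc]) l a b
  simp only [LinearMap.comp_apply] at key
  rw [key, Eop_ne hθ (twist_irr hθ g⁻¹)]
  · simp
  · intro T hT hb
    apply hg
    rw [← inv_mem_iff, mem_Iner]
    let e := LinearEquiv.ofBijective T hb
    refine ⟨⟨e.toLinearMap, e.symm.toLinearMap, ?_, ?_⟩, ?_⟩
    · ext; simp
    · ext; simp
    · intro n a
      exact hT n a

theorem Eop_rho_self [Fintype N] [FiniteDimensional ℂ Θ] (hθ : Irr θ)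
    {φ : Θ →ₗ[ℂ] V} (hφ : φ ∈ homN N θ ρ) (l : Θ →ₗ[ℂ] ℂ) (a b : Θ) :
    (Module.finrank ℂ Θ : ℂ) • Eop θ (ρ.comp N.subtype) l a (φ b)
      = ((Fintype.card N : ℂ) * l b) • φ a := by
  rw [Eop_intertwine θ θ (ρ.comp N.subtype) φ hφ, ← map_smul, Eop_self hθ, map_smul]

theorem clifford_linInd [Finite G] [FiniteDimensional ℂ Θ] [FiniteDimensional ℂ V]
    (hθ : Irr θ) {ι κ : Type} [Finite ι] [Finite κ] (φ : ι → (Θ →ₗ[ℂ] V))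
    (hφ : ∀ i, φ i ∈ homN N θ ρ) (hli : LinearIndependent ℂ φ) (b : Module.Basis κ ℂ Θ) :
    LinearIndependent ℂ (fun x : (G ⧸ Iner N θ) × ι × κ => ρ x.1.out (φ x.2.1 (b x.2.2))) := by
  classical
  have : Fintype G := Fintype.ofFinite G
  have : Fintype N := Fintype.ofFinite N
  have : Fintype ι := Fintype.ofFinite ι
  have : Fintype κ := Fintype.ofFinite κ
  have : Fintype (G ⧸ Iner N θ) := Fintype.ofFinite _
  rw [Fintype.linearIndependent_iff] at hli ⊢
  rintro c hc ⟨k0, i0, j0⟩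
  have h1 := congrArg (ρ k0.out⁻¹) hc
  rw [map_zero, Fintype.sum_prod_type, map_sum] at h1
  apply hli (fun i => c (k0, i, j0)) _ i0
  ext a
  have h2 := congrArg (Eop θ (ρ.comp N.subtype) (b.coord j0) a) h1
  rw [map_zero, map_sum, Finset.sum_eq_single k0] at h2
  · rw [map_sum, map_sum, Fintype.sum_prod_type] at h2
    have h3 := congrArg (fun t => (Module.finrank ℂ Θ : ℂ) • t) h2
    simp only [Finset.smul_sum, smul_zero] at h3
    have h4 : ∀ (i : ι) (j : κ), (Module.finrank ℂ Θ : ℂ) •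
        Eop θ (ρ.comp N.subtype) (b.coord j0) a
          (ρ k0.out⁻¹ (c (k0, i, j) • ρ k0.out (φ i (b j)))) =
        if j = j0 then (Fintype.card N : ℂ) • c (k0, i, j0) • φ i a else 0 := by
      intro i j
      rw [map_smul, rho_inv_apply, map_smul, smul_comm, Eop_rho_self hθ (hφ i)]
      by_cases hj : j = j0
      · subst hj
        simp [smul_smul, mul_comm]
      · simp [Finsupp.single_apply, hj]
    simp only [h4, Finset.sum_ite_eq', Finset.mem_univ, if_true, ← Finset.smul_sum] at h3
    have hN : (Fintype.card N : ℂ) ≠ 0 := by simp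
    have := (smul_eq_zero.1 h3).resolve_left hN
    simpa using this
  · intro k _ hk
    rw [map_sum, map_sum]
    refine Finset.sum_eq_zero fun x _ => ?_
    rw [map_smul, map_smul]
    dsimp only
    rw [← rho_mul_apply, Eop_rho_of_notMem hθ _ (hφ x.1), smul_zero]
    intro hmem
    apply hk
    rw [← QuotientGroup.eq, QuotientGroup.out_eq', QuotientGroup.out_eq'] at hmem
    exact hmem.symm
  · simp

theorem clifford_span [Finite G] [FiniteDimensional ℂ Θ] [FiniteDimensional ℂ V]
    (hρ : Irr ρ) (W : Submodule ℂ (Θ →ₗ[ℂ] V)) (h0 : W ≠ ⊥)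
    (hst : ∀ x ∈ Gam N θ, ∀ φ ∈ W, (ρ x.1 ∘ₗ φ ∘ₗ (x.2⁻¹.1 : Θ →ₗ[ℂ] Θ)) ∈ W)
    {ι κ : Type} (φ : Module.Basis ι ℂ W) (b : Module.Basis κ ℂ Θ) :
    ⊤ ≤ Submodule.span ℂ (Set.range
      (fun x : (G ⧸ Iner N θ) × ι × κ => ρ x.1.out ((φ x.2.1 : Θ →ₗ[ℂ] V) (b x.2.2)))) := by
  set S := Submodule.span ℂ (Set.range
      (fun x : (G ⧸ Iner N θ) × ι × κ => ρ x.1.out ((φ x.2.1 : Θ →ₗ[ℂ] V) (b x.2.2)))) with hS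
  have h1 : ∀ (k : G ⧸ Iner N θ) (i : ι) (a : Θ), ρ k.out ((φ i : Θ →ₗ[ℂ] V) a) ∈ S := by
    intro k i a
    have ha : a ∈ Submodule.span ℂ (Set.range b) := by rw [b.span_eq]; trivial
    induction ha using Submodule.span_induction with
    | mem x hx =>
      obtain ⟨j, rfl⟩ := hx
      exact Submodule.subset_span ⟨(k, i, j), rfl⟩
    | zero => simp
    | add x y _ _ hx hy => rw [map_add, map_add]; exact S.add_mem hx hy
    | smul c x _ hx => rw [map_smul, map_smul]; exact S.smul_mem c hx
  have h2 : ∀ (k : G ⧸ Iner N θ) (ψ : W) (a : Θ), ρ k.out ((ψ : Θ →ₗ[ℂ] V) a) ∈ S := by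
    intro k ψ a
    have hψ : ψ ∈ Submodule.span ℂ (Set.range φ) := by rw [φ.span_eq]; trivial
    induction hψ using Submodule.span_induction with
    | mem x hx =>
      obtain ⟨j, rfl⟩ := hx
      exact h1 k j a
    | zero => simp
    | add x y _ _ hx hy =>
      simp only [Submodule.coe_add, LinearMap.add_apply, map_add]; exact S.add_mem hx hy
    | smul c x _ hx =>
      simp only [Submodule.coe_smul, LinearMap.smul_apply, map_smul]; exact S.smul_mem c hx
  have h3 : ∀ (g : G) (ψ : W) (a : Θ), ρ g ((ψ : Θ →ₗ[ℂ] V) a) ∈ S := by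
    intro g ψ a
    have hm : ((g : G ⧸ Iner N θ).out)⁻¹ * g ∈ Iner N θ := by
      rw [← QuotientGroup.eq, QuotientGroup.out_eq']
    obtain ⟨A, hA⟩ := mem_Iner.1 hm
    have := h2 (g : G ⧸ Iner N θ) ⟨_, hst _ hA ψ ψ.2⟩ (A.1 a)
    simp only [LinearMap.comp_apply] at this
    rw [← rho_mul_apply, mul_inv_cancel_left] at this
    have e : (A⁻¹.1 : Θ →ₗ[ℂ] Θ) (A.1 a) = a := by rw [← Module.End.mul_apply]; simp
    rw [e] at this
    exact this
  rcases hρ.2 S (fun g v hv => by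
    induction hv using Submodule.span_induction with
    | mem x hx =>
      obtain ⟨⟨k, i, j⟩, rfl⟩ := hx
      dsimp only
      rw [← rho_mul_apply]
      exact h3 _ _ _
    | zero => simp
    | add x y _ _ hx hy => rw [map_add]; exact S.add_mem hx hy
    | smul c x _ hx => rw [map_smul]; exact S.smul_mem c hx) with e | e
  · exfalso
    obtain ⟨ψ, hψ, hne⟩ := Submodule.exists_mem_ne_zero_of_ne_bot h0
    apply hne
    ext a
    have := h3 1 ⟨ψ, hψ⟩ a
    rw [e] at this
    simpa using this
  · rw [e]

theorem clifford_dim [Finite G] [FiniteDimensional ℂ Θ] [FiniteDimensional ℂ V]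
    (hθ : Irr θ) (hρ : Irr ρ) (W : Submodule ℂ (Θ →ₗ[ℂ] V)) (h0 : W ≠ ⊥) (hW : W ≤ homN N θ ρ)
    (hst : ∀ x ∈ Gam N θ, ∀ φ ∈ W, (ρ x.1 ∘ₗ φ ∘ₗ (x.2⁻¹.1 : Θ →ₗ[ℂ] Θ)) ∈ W) :
    Module.finrank ℂ V = (Iner N θ).index * Module.finrank ℂ Θ * Module.finrank ℂ W := by
  let φ := Module.finBasis ℂ W
  let b := Module.finBasis ℂ Θ
  have hli : LinearIndependent ℂ (fun i => (φ i : Θ →ₗ[ℂ] V)) :=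
    φ.linearIndependent.map' W.subtype W.ker_subtype
  have := Module.finrank_eq_nat_card_basis
    (Module.Basis.mk (clifford_linInd hθ _ (fun i => hW (φ i).2) hli b) (clifford_span hρ W h0 hst φ b))
  rw [this, Nat.card_prod, Nat.card_prod, Nat.card_fin, Nat.card_fin, Subgroup.index]
  ring

theorem clifford_irr [Finite G] [FiniteDimensional ℂ Θ] [FiniteDimensional ℂ V]
    (hθ : Irr θ) (hρ : Irr ρ) (h0 : homN N θ ρ ≠ ⊥) : Irr (homNRep N θ ρ) := by
  have := hρ.1
  refine ⟨Submodule.nontrivial_iff_ne_bot.2 h0, fun W hW => ?_⟩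
  by_cases hW0 : W = ⊥
  · exact Or.inl hW0
  right
  have h1 := clifford_dim hθ hρ (homN N θ ρ) h0 le_rfl (fun x hx φ hφ => homN_act hx hφ)
  have h2 := clifford_dim hθ hρ (W.map (homN N θ ρ).subtype)
    (fun h => hW0 (Submodule.map_injective_of_injective (homN N θ ρ).injective_subtype
      (by rw [h, Submodule.map_bot])))
    (Submodule.map_subtype_le _ _) (by
      rintro x hx _ ⟨φ, hφ, rfl⟩
      exact ⟨_, hW ⟨x, hx⟩ φ hφ, rfl⟩)
  have h3 : Module.finrank ℂ (W.map (homN N θ ρ).subtype) = Module.finrank ℂ W :=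
    (Submodule.equivMapOfInjective _ (homN N θ ρ).injective_subtype W).finrank_eq.symm
  have h4 : 0 < Module.finrank ℂ V := Module.finrank_pos
  rw [h3] at h2
  apply Submodule.eq_top_of_finrank_eq
  rw [h1] at h2 h4
  exact (Nat.eq_of_mul_eq_mul_left (Nat.pos_of_mul_pos_right h4) h2).symm

end Clifford

/-- restriction to a stable submodule -/
def subRep {G V : Type} [Group G] [AddCommGroup V] [Module ℂ V] (ρ : Representation ℂ G V)
    (W : Submodule ℂ V) (hW : ∀ g, ∀ v ∈ W, ρ g v ∈ W) : Representation ℂ G W where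
  toFun g := (ρ g).restrict (hW g)
  map_one' := by ext; simp
  map_mul' := by intros; ext; simp

theorem subRep_apply {G V : Type} [Group G] [AddCommGroup V] [Module ℂ V] (ρ : Representation ℂ G V)
    (W : Submodule ℂ V) (hW : ∀ g, ∀ v ∈ W, ρ g v ∈ W) (g : G) (v : W) :
    (subRep ρ W hW g v : V) = ρ g v := rfl

theorem maschke_proj {G V : Type} [Group G] [Finite G] [AddCommGroup V] [Module ℂ V]
    (ρ : Representation ℂ G V) (W : Submodule ℂ V) (hW : ∀ g, ∀ v ∈ W, ρ g v ∈ W) :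
    ∃ P : V →ₗ[ℂ] W, (∀ g v, P (ρ g v) = subRep ρ W hW g (P v)) ∧ ∀ w : W, P w = w := by
  have : Fintype G := Fintype.ofFinite G
  obtain ⟨p, hp⟩ := W.subtype.exists_leftInverse_of_injective W.ker_subtype
  have hp' : ∀ w : W, p w = w := fun w => by
    have := congrArg (fun f => f w) hp
    simpa using this
  refine ⟨(Fintype.card G : ℂ)⁻¹ • ∑ g : G, (subRep ρ W hW g) ∘ₗ p ∘ₗ ρ g⁻¹, fun h v => ?_, fun w => ?_⟩
  · simp only [LinearMap.smul_apply, LinearMap.sum_apply, LinearMap.comp_apply, map_smul, map_sum]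
    congr 1
    rw [← Equiv.sum_comp (Equiv.mulLeft h)]
    refine Finset.sum_congr rfl fun n _ => ?_
    simp only [Equiv.coe_mulLeft, mul_inv_rev]
    rw [rho_mul_apply (subRep ρ W hW), rho_mul_apply ρ, rho_inv_apply]
  · simp only [LinearMap.smul_apply, LinearMap.sum_apply, LinearMap.comp_apply]
    have : ∀ g : G, subRep ρ W hW g (p (ρ g⁻¹ w)) = w := by
      intro g
      have h1 := hp' (subRep ρ W hW g⁻¹ w)
      rw [subRep_apply] at h1
      rw [h1, rho_apply_inv]
    rw [Finset.sum_congr rfl (fun g _ => this g)]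
    simp [← Nat.cast_smul_eq_nsmul ℂ, smul_smul]

theorem separation {G : Type} [Group G] [Finite G] (n : ℕ) : ∀ {X : Type} [AddCommGroup X]
    [Module ℂ X] [FiniteDimensional ℂ X] (ρ : Representation ℂ G X) (x : X) (_ : x ≠ 0)
    (_ : Module.finrank ℂ X ≤ n),
    ∃ (V : Type) (_ : AddCommGroup V) (_ : Module ℂ V) (_ : FiniteDimensional ℂ V)
      (σ : Representation ℂ G V) (P : X →ₗ[ℂ] V), Irr σ ∧ (∀ g v, P (ρ g v) = σ g (P v)) ∧
      P x ≠ 0 := by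
  induction n with
  | zero =>
    intro X _ _ _ ρ x hx hn
    have : Nontrivial X := ⟨x, 0, hx⟩
    have : 0 < Module.finrank ℂ X := Module.finrank_pos
    omega
  | succ n ih =>
    intro X _ _ _ ρ x hx hn
    by_cases hI : Irr ρ
    · exact ⟨X, _, _, inferInstance, ρ, LinearMap.id, hI, fun _ _ => rfl, hx⟩
    have hnt : Nontrivial X := ⟨x, 0, hx⟩
    have : ∃ W : Submodule ℂ X, (∀ g, ∀ v ∈ W, ρ g v ∈ W) ∧ W ≠ ⊥ ∧ W ≠ ⊤ := by
      by_contra hc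
      push Not at hc
      exact hI ⟨hnt, fun W hW => or_iff_not_imp_left.2 (hc W hW)⟩
    obtain ⟨W, hW, hb, ht⟩ := this
    obtain ⟨P, hP, hPW⟩ := maschke_proj ρ W hW
    have hfin : ∀ W : Submodule ℂ X, W ≠ ⊤ → Module.finrank ℂ W ≤ n := by
      intro W ht
      have := Submodule.finrank_lt ht
      omega
    by_cases hPx : P x = 0
    · let K := LinearMap.ker P
      have hK : ∀ g, ∀ v ∈ K, ρ g v ∈ K := fun g v hv => by
        rw [LinearMap.mem_ker] at hv ⊢; rw [hP, hv, map_zero]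
      have hKt : K ≠ ⊤ := by
        intro h
        apply hb
        rw [eq_bot_iff]
        intro w hw
        have h1 : w ∈ K := by rw [h]; trivial
        have h2 := hPW ⟨w, hw⟩
        rw [LinearMap.mem_ker] at h1
        dsimp at h2
        rw [h1] at h2
        exact (congrArg Subtype.val h2).symm
      let Q : X →ₗ[ℂ] K := LinearMap.codRestrict K (LinearMap.id - W.subtype ∘ₗ P) (fun v => by
        simp [K, hPW])
      have hQ : ∀ v, (Q v : X) = v - P v := fun v => rfl
      obtain ⟨V, i1, i2, i3, σ, R, h1, h2, h3⟩ := ih (subRep ρ K hK) ⟨x, hPx⟩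
        (fun h => hx (congrArg Subtype.val h)) (hfin K hKt)
      refine ⟨V, i1, i2, i3, σ, R ∘ₗ Q, h1, fun g v => ?_, ?_⟩
      · rw [LinearMap.comp_apply, LinearMap.comp_apply, ← h2]
        congr 1
        ext
        rw [subRep_apply, hQ, hQ, hP, subRep_apply, map_sub]
      · rw [LinearMap.comp_apply]
        convert h3 using 2
        ext
        rw [hQ, hPx]; simp
    · obtain ⟨V, i1, i2, i3, σ, R, h1, h2, h3⟩ := ih (subRep ρ W hW) (P x) hPx (hfin W ht)
      exact ⟨V, i1, i2, i3, σ, R ∘ₗ P, h1, fun g v => by simp [hP, h2], h3⟩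

/-- the big induced-type representation -/
def transRep (G Θ : Type) [Group G] [AddCommGroup Θ] [Module ℂ Θ] :
    Representation ℂ G (G → Θ) where
  toFun g := LinearMap.funLeft ℂ Θ (fun x => x * g)
  map_one' := by ext; simp [LinearMap.funLeft_apply]
  map_mul' := by intro g h; ext; simp [LinearMap.funLeft_apply, mul_assoc]

theorem transRep_apply {G Θ : Type} [Group G] [AddCommGroup Θ] [Module ℂ Θ] (g : G) (F : G → Θ)
    (x : G) : transRep G Θ g F x = F (x * g) := rfl

open Classical in
noncomputable def indMap {G Θ : Type} [Group G] [AddCommGroup Θ] [Module ℂ Θ] (N : Subgroup G)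
    (θ : Representation ℂ N Θ) : Θ →ₗ[ℂ] (G → Θ) where
  toFun v x := if h : x ∈ N then θ ⟨x, h⟩ v else 0
  map_add' := by intro a b; ext x; by_cases h : x ∈ N <;> simp [h]
  map_smul' := by intro a b; ext x; by_cases h : x ∈ N <;> simp [h]

theorem indMap_mem {G Θ : Type} [Group G] [AddCommGroup Θ] [Module ℂ Θ] (N : Subgroup G)
    (θ : Representation ℂ N Θ) : indMap N θ ∈ homN N θ (transRep G Θ) := by
  intro n a
  ext x
  rw [transRep_apply]
  simp only [indMap, LinearMap.coe_mk, AddHom.coe_mk]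
  by_cases h : x ∈ N
  · have h' : x * n ∈ N := N.mul_mem h n.2
    rw [dif_pos h, dif_pos h', ← rho_mul_apply]
    rfl
  · have h' : x * n ∉ N := fun h' => h ((N.mul_mem_cancel_right n.2).1 h')
    rw [dif_neg h, dif_neg h']

theorem indMap_one {G Θ : Type} [Group G] [AddCommGroup Θ] [Module ℂ Θ] (N : Subgroup G)
    (θ : Representation ℂ N Θ) (a : Θ) : indMap N θ a 1 = a := by
  simp only [indMap, LinearMap.coe_mk, AddHom.coe_mk]
  rw [dif_pos N.one_mem]
  change θ 1 a = a
  simp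

theorem homN_comp {G Θ V X : Type} [Group G] [AddCommGroup Θ] [Module ℂ Θ] [AddCommGroup V]
    [Module ℂ V] [AddCommGroup X] [Module ℂ X] {N : Subgroup G} {θ : Representation ℂ N Θ}
    {ρ : Representation ℂ G X} {σ : Representation ℂ G V} {P : X →ₗ[ℂ] V}
    (hP : ∀ g v, P (ρ g v) = σ g (P v)) {φ : Θ →ₗ[ℂ] X} (hφ : φ ∈ homN N θ ρ) :
    P ∘ₗ φ ∈ homN N θ σ := by
  intro n a
  simp only [LinearMap.comp_apply]
  rw [hφ, hP]

theorem exists_over {G Θ : Type} [Group G] [Finite G] [AddCommGroup Θ] [Module ℂ Θ]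
    [FiniteDimensional ℂ Θ] (N : Subgroup G) {θ : Representation ℂ N Θ} (hθ : Irr θ) :
    ∃ (V : Type) (_ : AddCommGroup V) (_ : Module ℂ V) (_ : FiniteDimensional ℂ V)
      (σ : Representation ℂ G V), Irr σ ∧ homN N θ σ ≠ ⊥ := by
  have := hθ.1
  obtain ⟨a, ha⟩ := exists_ne (0 : Θ)
  obtain ⟨V, i1, i2, i3, σ, P, h1, h2, h3⟩ := separation _ (transRep G Θ) (indMap N θ a)
    (fun h => ha (by rw [← indMap_one N θ a, h]; rfl)) le_rfl
  refine ⟨V, i1, i2, i3, σ, h1, fun h => h3 ?_⟩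
  have := homN_comp h2 (indMap_mem N θ)
  rw [h, Submodule.mem_bot] at this
  exact congrArg (fun f => f a) this

theorem exists_below {G V : Type} [Group G] [AddCommGroup V] [Module ℂ V]
    [FiniteDimensional ℂ V] [Nontrivial V] (N : Subgroup G) (ρ : Representation ℂ G V) :
    ∃ (Θ : Type) (_ : AddCommGroup Θ) (_ : Module ℂ Θ) (_ : FiniteDimensional ℂ Θ)
      (θ : Representation ℂ N Θ), Irr θ ∧ homN N θ ρ ≠ ⊥ := by
  -- minimal stable nonzero submodule
  have hex : ∃ n, ∃ W : Submodule ℂ V, (∀ g : N, ∀ v ∈ W, ρ g v ∈ W) ∧ W ≠ ⊥ ∧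
      Module.finrank ℂ W = n := ⟨_, ⊤, fun _ _ _ => trivial, top_ne_bot, rfl⟩
  classical
  obtain ⟨W, hW, hb, hn⟩ := Nat.find_spec hex
  have hmin : ∀ m < _, _ := fun m hm => Nat.find_min hex (m := m) hm
  refine ⟨W, inferInstance, inferInstance, inferInstance, subRep (ρ.comp N.subtype) W hW,
    ⟨Submodule.nontrivial_iff_ne_bot.2 hb, fun W' hW' => ?_⟩, fun h => ?_⟩
  · by_contra hc
    push Not at hc
    have h1 : Module.finrank ℂ (W'.map W.subtype) = Module.finrank ℂ W' :=
      (Submodule.equivMapOfInjective _ W.injective_subtype W').finrank_eq.symm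
    have h2 := Submodule.finrank_lt hc.2
    refine hmin (Module.finrank ℂ W') (by omega) ⟨W'.map W.subtype, ?_, ?_, h1⟩
    · rintro g _ ⟨v, hv, rfl⟩
      exact ⟨_, hW' g v hv, rfl⟩
    · exact fun h => hc.1 (Submodule.map_injective_of_injective W.injective_subtype
        (by rw [h, Submodule.map_bot]))
  · obtain ⟨w, hw, hne⟩ := Submodule.exists_mem_ne_zero_of_ne_bot hb
    have h1 : W.subtype ∈ homN N (subRep (ρ.comp N.subtype) W hW) ρ := fun n a => rfl
    rw [h, Submodule.mem_bot] at h1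
    exact hne (congrArg (fun f => f ⟨w, hw⟩) h1)

theorem isIntegral_char {G V : Type} [Group G] [Finite G] [AddCommGroup V] [Module ℂ V]
    [FiniteDimensional ℂ V] (ρ : Representation ℂ G V) (g : G) :
    IsIntegral ℤ (LinearMap.trace ℂ V (ρ g)) := by
  rw [Module.End.trace_eq_sum_roots_charpoly_of_splits (IsAlgClosed.splits _)]
  apply IsIntegral.multiset_sum
  intro μ hμ
  have h1 : Module.End.HasEigenvalue (ρ g) μ := by
    rw [Module.End.hasEigenvalue_iff_isRoot_charpoly]
    exact Polynomial.isRoot_of_mem_roots hμ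
  obtain ⟨v, hv⟩ := h1.exists_hasEigenvector
  have h2 : μ ^ (Nat.card G) = 1 := by
    have := hv.pow_apply (Nat.card G)
    rw [← map_pow, pow_card_eq_one', map_one] at this
    have h3 : (μ ^ Nat.card G - 1) • v = 0 := by rw [sub_smul, ← this]; simp
    exact sub_eq_zero.1 ((smul_eq_zero.1 h3).resolve_right hv.2)
  exact ⟨Polynomial.X ^ (Nat.card G) - 1,
    Polynomial.monic_X_pow_sub_C (1 : ℤ) Nat.card_pos.ne', by simp [h2]⟩

theorem degree_dvd_card {G V : Type} [Group G] [Finite G] [AddCommGroup V] [Module ℂ V]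
    [FiniteDimensional ℂ V] {ρ : Representation ℂ G V} (hρ : Irr ρ) :
    Module.finrank ℂ V ∣ Nat.card G := by
  classical
  have : Fintype G := Fintype.ofFinite G
  have := hρ.1
  set d := Module.finrank ℂ V with hd
  have hd0 : (d : ℂ) ≠ 0 := by
    have : 0 < d := Module.finrank_pos
    exact_mod_cast this.ne'
  let b := Module.finBasis ℂ V
  have h1 : ∀ v : V, ∑ g : G, LinearMap.trace ℂ V (ρ g⁻¹) • ρ g v
      = ((Fintype.card G : ℂ) / d) • v := by
    intro v
    have : ∀ j, Eop ρ ρ (b.coord j) (b j) v = ((Fintype.card G : ℂ) / d * b.coord j v) • b j := by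
      intro j
      have := Eop_self hρ (b.coord j) (b j) v
      apply smul_right_injective _ hd0
      dsimp only
      rw [this, smul_smul]
      congr 1
      field_simp
    have h2 : ∑ j, Eop ρ ρ (b.coord j) (b j) v = ((Fintype.card G : ℂ) / d) • v := by
      simp only [this, mul_smul, ← Finset.smul_sum]
      congr 1
      exact b.sum_repr v
    rw [← h2]
    simp only [Eop_apply]
    rw [Finset.sum_comm]
    refine Finset.sum_congr rfl fun g _ => ?_
    rw [← Finset.sum_smul, LinearMap.trace_eq_matrix_trace ℂ b]
    simp [Matrix.trace, LinearMap.toMatrix_apply]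
  let A := integralClosure ℤ ℂ
  let K : Matrix G G A := fun h k => ⟨LinearMap.trace ℂ V (ρ (h * k⁻¹)), isIntegral_char ρ _⟩
  have hint : IsIntegral ℤ ((Fintype.card G : ℂ) / d) := by
    apply isIntegral_trans (A := A)
    refine ⟨K.charpoly, K.charpoly_monic, ?_⟩
    rw [← Polynomial.eval_map, ← Matrix.charpoly_map, Matrix.eval_charpoly,
      ← Matrix.exists_mulVec_eq_zero_iff]
    obtain ⟨v, hv⟩ := exists_ne (0 : V)
    obtain ⟨j, hj⟩ : ∃ j, b.coord j v ≠ 0 := by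
      by_contra hc
      push Not at hc
      exact hv (b.ext_elem (fun i => by simpa using hc i))
    refine ⟨fun h => b.coord j (ρ h v), fun h => hj ?_, ?_⟩
    · have := congrFun h 1
      simpa using this
    · ext h
      rw [Matrix.sub_mulVec]
      simp only [Pi.sub_apply, Pi.zero_apply, sub_eq_zero, Matrix.scalar_apply,
        Matrix.mulVec_diagonal]
      have h3 := congrArg (b.coord j) (h1 (ρ h v))
      rw [map_smul, map_sum, ← Equiv.sum_comp (Equiv.mulRight h⁻¹)] at h3
      rw [← smul_eq_mul, ← h3]
      simp only [Matrix.mulVec, dotProduct]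
      refine Finset.sum_congr rfl fun k _ => ?_
      simp only [Equiv.coe_mulRight, mul_inv_rev, inv_inv, map_smul, smul_eq_mul]
      rw [← rho_mul_apply]
      rw [inv_mul_cancel_right]
      rfl
  have h5 : ((Fintype.card G : ℂ) / d) = algebraMap ℚ ℂ ((Fintype.card G : ℚ) / d) := by simp
  rw [h5, isIntegral_algebraMap_iff (algebraMap ℚ ℂ).injective,
    IsIntegrallyClosed.isIntegral_iff] at hint
  obtain ⟨y, hy⟩ := hint
  have hdQ : (d : ℚ) ≠ 0 := by exact_mod_cast hd0
  rw [eq_div_iff hdQ, eq_intCast] at hy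
  have h6 : y * (d : ℤ) = Fintype.card G := by exact_mod_cast hy
  rw [Nat.card_eq_fintype_card]
  exact_mod_cast Dvd.intro_left y h6

theorem smul_units_inj {W : Type} [AddCommGroup W] [Module ℂ W] [Nontrivial W] {c d : ℂ} (h : ∀ w : W, c • w = d • w) : c = d := by
  obtain ⟨w, hw⟩ := exists_ne (0 : W)
  exact smul_left_injective ℂ hw (h w)

section CentralExt
variable {E W : Type} [Group E] [AddCommGroup W] [Module ℂ W] [FiniteDimensional ℂ W]

theorem comm_char [Nontrivial W] (σ : Representation ℂ E W) (A : Subgroup E)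
    (hA : ∀ x ∈ A, ∀ y ∈ A, x * y = y * x) :
    ∃ δ : A →* ℂˣ, ∃ w : W, w ≠ 0 ∧ ∀ x : A, σ x w = (δ x : ℂ) • w := by
  obtain ⟨Θ, _, _, _, θ, hθ, hne⟩ := exists_below A σ
  have := hθ.1
  have hsc : ∀ x : A, ∃ c : ℂ, ∀ v, θ x v = c • v := fun x => hθ.schur (θ x) (fun g v => by
    rw [← rho_mul_apply, ← rho_mul_apply]
    congr 2
    exact Subtype.ext (hA x x.2 g g.2))
  choose c hc using hsc
  have hm : ∀ x y, c (x * y) = c x * c y := fun x y => by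
    apply smul_units_inj (W := Θ)
    intro w
    rw [← hc, rho_mul_apply, hc, hc, smul_smul, mul_comm]
  have h1 : c 1 = 1 := by
    apply smul_units_inj (W := Θ)
    intro w
    rw [← hc]; simp
  let c' : A →* ℂ := { toFun := c, map_one' := h1, map_mul' := hm }
  obtain ⟨φ, hφ, hφ0⟩ := Submodule.exists_mem_ne_zero_of_ne_bot hne
  have : ∃ a, φ a ≠ 0 := by
    by_contra hcon
    push Not at hcon
    exact hφ0 (LinearMap.ext hcon)
  obtain ⟨a, ha⟩ := this
  refine ⟨c'.toHomUnits, φ a, ha, fun x => ?_⟩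
  rw [← hφ x a, hc, map_smul]
  rfl

theorem split_of_comm [Nontrivial W] (σ : Representation ℂ E W) (ι : ℂˣ →* E)
    (hι : ∀ z e, ι z * e = e * ι z) (hσ : ∀ z w, σ (ι z) w = ((z⁻¹ : ℂˣ) : ℂ) • w)
    (A : Subgroup E) (hA : ∀ x ∈ A, ∀ y ∈ A, x * y = y * x) (hιA : ι.range ≤ A)
    [A.FiniteIndex] : ∃ δ : E →* ℂˣ, ∀ z, δ (ι z) = z ^ A.index := by
  obtain ⟨δ, w, hw, hδ⟩ := comm_char σ A hA
  refine ⟨(MonoidHom.transfer δ⁻¹), fun z => ?_⟩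
  rw [MonoidHom.transfer_eq_pow]
  · have h1 : ∀ z, ∀ h : ι z ∈ A, δ ⟨ι z, h⟩ = z⁻¹ := by
      intro z h
      have h2 := hδ ⟨ι z, h⟩
      dsimp only at h2
      rw [hσ] at h2
      exact Units.ext (smul_left_injective ℂ hw h2).symm
    have h2 : (⟨ι z ^ A.index, A.pow_mem (hιA ⟨z, rfl⟩) _⟩ : A) =
      ⟨ι (z ^ A.index), hιA ⟨_, rfl⟩⟩ := Subtype.ext (map_pow ι z _).symm
    rw [h2, MonoidHom.inv_apply, h1, inv_inv]
  · intro k g0 _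
    rw [← map_pow, mul_assoc, hι, inv_mul_cancel_left]

theorem split_gcd {ι : ℂˣ →* E} {m n : ℕ}
    (h1 : ∃ δ : E →* ℂˣ, ∀ z, δ (ι z) = z ^ m) (h2 : ∃ δ : E →* ℂˣ, ∀ z, δ (ι z) = z ^ n) :
    ∃ δ : E →* ℂˣ, ∀ z, δ (ι z) = z ^ (Nat.gcd m n) := by
  obtain ⟨δ1, h1⟩ := h1
  obtain ⟨δ2, h2⟩ := h2
  have hb := Nat.gcd_eq_gcd_ab m n
  refine ⟨δ1 ^ (m.gcdA n) * δ2 ^ (m.gcdB n), fun z => ?_⟩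
  simp only [MonoidHom.mul_apply]
  have e : ∀ (δ : E →* ℂˣ) (k : ℤ) x, (δ ^ k) x = (δ x) ^ k := fun δ k x => by
    cases k <;> simp [MonoidHom.pow_apply]
  rw [e, e, h1, h2, ← zpow_natCast, ← zpow_natCast, ← zpow_natCast, ← zpow_mul, ← zpow_mul,
    ← zpow_add, ← hb]

theorem exists_unit_pow (n : ℕ) (hn : n ≠ 0) (w : ℂˣ) : ∃ z : ℂˣ, z ^ n = w := by
  obtain ⟨z, hz⟩ := IsAlgClosed.exists_pow_nat_eq (w : ℂ) (Nat.pos_of_ne_zero hn)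
  have h0 : z ≠ 0 := by
    rintro rfl
    rw [zero_pow hn] at hz
    exact w.ne_zero hz.symm
  exact ⟨Units.mk0 z h0, Units.ext (by simpa using hz)⟩

theorem dim_coprime {σ : Representation ℂ E W} (hI : Irr σ) {ι : ℂˣ →* E}
    (hinj : Function.Injective ι)
    (hι : ∀ z e, ι z * e = e * ι z) (hσ : ∀ z w, σ (ι z) w = ((z⁻¹ : ℂˣ) : ℂ) • w)
    [hfi : ι.range.FiniteIndex] {p : ℕ} (hp : p.Prime) (hpn : ¬ p ∣ ι.range.index) :
    ¬ p ∣ Module.finrank ℂ W := by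
  have := hI.1
  have hnorm : ι.range.Normal := ⟨by
    rintro _ ⟨z, rfl⟩ g
    exact ⟨z, by rw [← hι, mul_inv_cancel_right]⟩⟩
  set n := ι.range.index with hn
  have hn0 : n ≠ 0 := hfi.index_ne_zero
  obtain ⟨δ, hδ⟩ := split_of_comm σ ι hι hσ ι.range (by
    rintro _ ⟨x, rfl⟩ _ ⟨y, rfl⟩; exact hι _ _) le_rfl
  rw [← hn] at hδ
  let K := δ.ker
  have hdec : ∀ e : E, ∃ k ∈ K, ∃ z, e = k * ι z := by
    intro e
    obtain ⟨z, hz⟩ := exists_unit_pow n hn0 (δ e)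
    refine ⟨e * ι z⁻¹, ?_, z, by simp⟩
    rw [MonoidHom.mem_ker, map_mul, hδ, inv_pow, hz, mul_inv_cancel]
  have hIK : Irr (σ.comp K.subtype) := by
    refine ⟨hI.1, fun U hU => hI.2 U fun g v hv => ?_⟩
    obtain ⟨k, hk, z, rfl⟩ := hdec g
    rw [rho_mul_apply, hσ, map_smul]
    exact U.smul_mem _ (hU ⟨k, hk⟩ v hv)
  let q : K →* E ⧸ ι.range := (QuotientGroup.mk' ι.range).comp K.subtype
  have hker : ∀ x : K, x ∈ q.ker → ∃ z : ℂˣ, z ^ n = 1 ∧ (x : E) = ι z := by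
    intro x hx
    have : (x : E) ∈ ι.range := by
      rw [MonoidHom.mem_ker] at hx
      exact (QuotientGroup.eq_one_iff (x : E)).1 hx
    obtain ⟨z, hz⟩ := this
    refine ⟨z, ?_, hz.symm⟩
    rw [← hδ, hz]
    exact x.2
  have : Finite (E ⧸ ι.range) := ι.range.finite_quotient_of_finiteIndex
  have hfin : Finite q.ker := by
    have : NeZero n := ⟨hn0⟩
    choose f hf1 hf2 using hker
    refine Finite.of_injective (fun x : q.ker => (⟨f x.1 x.2, ?_⟩ : rootsOfUnity n ℂ)) ?_
    · rw [mem_rootsOfUnity]; exact hf1 _ _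
    · intro x y hxy
      have := congrArg Subtype.val hxy
      dsimp only at this
      apply Subtype.ext
      apply Subtype.ext
      rw [hf2 x.1 x.2, hf2 y.1 y.2, this]
  have hfinK : Finite K := by
    have h1 : Finite (K ⧸ q.ker) :=
      Finite.of_injective _ (QuotientGroup.kerLift_injective q)
    exact Finite.of_equiv _ (Subgroup.groupEquivQuotientProdSubgroup (s := q.ker)).symm
  intro hpd
  have h2 := hpd.trans (degree_dvd_card hIK)
  have : Fact p.Prime := ⟨hp⟩
  obtain ⟨x, hx⟩ := exists_prime_orderOf_dvd_card' p h2
  have h3 : q x = 1 := by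
    have h4 : orderOf (q x) ∣ p := hx ▸ orderOf_map_dvd q x
    have h5 : orderOf (q x) ∣ n := orderOf_dvd_natCard (q x)
    rcases (Nat.dvd_prime hp).1 h4 with h | h
    · exact orderOf_eq_one_iff.1 h
    · exact absurd (h ▸ h5) hpn
  obtain ⟨z, hz, hxz⟩ := hker x h3
  have h6 : z ^ p = 1 := by
    apply hinj
    rw [map_pow, ← hxz, map_one, ← hx]
    have := pow_orderOf_eq_one x
    exact_mod_cast congrArg Subtype.val this
  have h7 : z = 1 := by
    have := Nat.Coprime.eq_one_of_dvd (((Nat.Prime.coprime_iff_not_dvd hp).2 hpn).coprime_dvd_left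
      (orderOf_dvd_of_pow_eq_one h6)) (orderOf_dvd_of_pow_eq_one hz)
    exact orderOf_eq_one_iff.1 this
  rw [h7, map_one] at hxz
  have : x = 1 := Subtype.ext hxz
  rw [this, orderOf_one] at hx
  exact hp.one_lt.ne hx
end CentralExt

section ExtSec
variable {G Θ V Q : Type} [Group G] [Group Q] [AddCommGroup Θ] [Module ℂ Θ] [AddCommGroup V]
  [Module ℂ V]

/-- embedding of `N` in `Gam` -/
def rhom (N : Subgroup G) [N.Normal] (θ : Representation ℂ N Θ) : N →* Gam N θ where
  toFun n := ⟨((n : G), MonoidHom.toHomUnits θ n), by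
    intro m a
    change θ n (θ m a) = θ _ (θ n a)
    rw [← rho_mul_apply, ← rho_mul_apply]
    congr 2
    ext
    simp⟩
  map_one' := by ext <;> simp
  map_mul' := by intro a b; ext <;> simp

instance rhom_normal (N : Subgroup G) [N.Normal] (θ : Representation ℂ N Θ) :
    (rhom N θ).range.Normal := by
  constructor
  rintro _ ⟨n, rfl⟩ x
  refine ⟨MulAut.conjNormal x.1.1 n, ?_⟩
  apply Subtype.ext
  refine Prod.ext ?_ ?_
  · simp [rhom]
  · rw [Units.ext_iff]
    refine LinearMap.ext fun a => ?_
    have := x.2 n (x.1.2⁻¹.1 a)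
    have h2 : x.1.2.1 (x.1.2⁻¹.1 a) = a := by rw [← Module.End.mul_apply]; simp
    rw [h2] at this
    exact this.symm

abbrev ExtG (N : Subgroup G) [N.Normal] (θ : Representation ℂ N Θ) := Gam N θ ⧸ (rhom N θ).range

def iotaG (N : Subgroup G) [N.Normal] (θ : Representation ℂ N Θ) : ℂˣ →* Gam N θ where
  toFun z := ⟨(1, Units.map (algebraMap ℂ (Module.End ℂ Θ)).toMonoidHom z), by
    intro n a
    simp [Module.algebraMap_end_apply]⟩
  map_one' := by ext <;> simp
  map_mul' := by intro a b; ext <;> simp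

def iotaE (N : Subgroup G) [N.Normal] (θ : Representation ℂ N Θ) : ℂˣ →* ExtG N θ :=
  (QuotientGroup.mk' _).comp (iotaG N θ)

variable {N : Subgroup G} [N.Normal] {θ : Representation ℂ N Θ} {ρ : Representation ℂ G V}

def kap (N : Subgroup G) [N.Normal] (θ : Representation ℂ N Θ) (π : G →* Q) (h : π.ker = N) :
    ExtG N θ →* Q :=
  QuotientGroup.lift _ (π.comp ((MonoidHom.fst _ _).comp (Gam N θ).subtype)) (by
    rintro _ ⟨n, rfl⟩
    have : (n : G) ∈ π.ker := by rw [h]; exact n.2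
    exact this)

theorem kap_mk (π : G →* Q) (h : π.ker = N) (x : Gam N θ) :
    kap N θ π h (QuotientGroup.mk x) = π x.1.1 := rfl

theorem iotaE_central (z : ℂˣ) (e : ExtG N θ) : iotaE N θ z * e = e * iotaE N θ z := by
  induction e using QuotientGroup.induction_on with
  | H x =>
    change (QuotientGroup.mk (iotaG N θ z * x) : ExtG N θ) = QuotientGroup.mk (x * iotaG N θ z)
    congr 1
    apply Subtype.ext
    refine Prod.ext ?_ ?_
    · simp [iotaG]
    · rw [Units.ext_iff]
      ext a
      simp [iotaG, Module.algebraMap_end_apply]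

theorem iotaE_injective [Nontrivial Θ] : Function.Injective (iotaE N θ) := by
  rw [injective_iff_map_eq_one]
  intro z hz
  have h1 : iotaG N θ z ∈ (rhom N θ).range := (QuotientGroup.eq_one_iff _).1 hz
  obtain ⟨n, hn⟩ := h1
  have h2 : (n : G) = 1 := congrArg (fun x => x.1.1) hn
  have h3 : n = 1 := Subtype.ext h2
  rw [h3, map_one] at hn
  apply Units.ext
  apply smul_units_inj (W := Θ)
  intro w
  have := congrArg (fun x : Gam N θ => (x.1.2.1 : Θ →ₗ[ℂ] Θ) w) hn
  simp [iotaG, Module.algebraMap_end_apply] at this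
  simp [← this]

theorem kap_iotaE (π : G →* Q) (h : π.ker = N) (z : ℂˣ) : kap N θ π h (iotaE N θ z) = 1 := by
  change π 1 = 1
  simp

theorem kap_ker [FiniteDimensional ℂ Θ] (hθ : Irr θ) (π : G →* Q) (h : π.ker = N) :
    (kap N θ π h).ker = (iotaE N θ).range := by
  have := hθ.1
  apply le_antisymm
  · intro e he
    induction e using QuotientGroup.induction_on with
    | H x =>
      rw [MonoidHom.mem_ker, kap_mk] at he
      have hn : x.1.1 ∈ N := h.le he
      let n : N := ⟨x.1.1, hn⟩
      obtain ⟨c, hc⟩ := hθ.schur ((θ n⁻¹) ∘ₗ x.1.2.1) (fun m a => by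
        simp only [LinearMap.comp_apply]
        rw [x.2 m a, ← rho_mul_apply, ← rho_mul_apply]
        congr 2
        ext
        simp [n, mul_assoc])
      have hc' : ∀ v, x.1.2.1 v = c • θ n v := fun v => by
        have := congrArg (θ n) (hc v)
        simp only [LinearMap.comp_apply] at this
        rw [rho_apply_inv, map_smul] at this
        exact this
      have hc0 : c ≠ 0 := by
        rintro rfl
        obtain ⟨v, hv⟩ := exists_ne (0 : Θ)
        have h1 := hc' v
        have h2 : x.1.2⁻¹.1 (x.1.2.1 v) = v := by rw [← Module.End.mul_apply]; simp
        rw [h1] at h2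
        simp at h2
        exact hv h2.symm
      refine ⟨Units.mk0 c hc0, ?_⟩
      change (QuotientGroup.mk (iotaG N θ _) : ExtG N θ) = QuotientGroup.mk x
      rw [QuotientGroup.eq]
      refine ⟨n, ?_⟩
      rw [eq_inv_mul_iff_mul_eq]
      apply Subtype.ext
      refine Prod.ext ?_ ?_
      · simp [iotaG, rhom, n]
      · rw [Units.ext_iff]
        refine LinearMap.ext fun a => ?_
        rw [hc']
        rfl
  · rintro _ ⟨z, rfl⟩
    exact kap_iotaE π h z

theorem kap_range (π : G →* Q) (h : π.ker = N) :
    (kap N θ π h).range = (Iner N θ).map π := by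
  ext x
  constructor
  · rintro ⟨e, rfl⟩
    induction e using QuotientGroup.induction_on with
    | H x => exact ⟨x.1.1, ⟨x.1, x.2, rfl⟩, rfl⟩
  · rintro ⟨_, ⟨y, hy, rfl⟩, rfl⟩
    exact ⟨QuotientGroup.mk (⟨y, hy⟩ : Gam N θ), rfl⟩

noncomputable def extRep (N : Subgroup G) [N.Normal] (θ : Representation ℂ N Θ)
    (ρ : Representation ℂ G V) : Representation ℂ (ExtG N θ) (homN N θ ρ) :=
  QuotientGroup.lift _ (homNRep N θ ρ) (by
    rintro _ ⟨n, rfl⟩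
    ext φ a
    rw [homNRep_apply]
    have h1 : ((rhom N θ n).1.2⁻¹.1 : Θ →ₗ[ℂ] Θ) a = θ n⁻¹ a := rfl
    rw [h1, φ.2]
    exact rho_apply_inv ρ n _)

theorem extRep_mk (x : Gam N θ) : extRep N θ ρ (QuotientGroup.mk x) = homNRep N θ ρ x := rfl

theorem extRep_iota (z : ℂˣ) (w : homN N θ ρ) :
    extRep N θ ρ (iotaE N θ z) w = ((z⁻¹ : ℂˣ) : ℂ) • w := by
  change homNRep N θ ρ (iotaG N θ z) w = _
  ext a
  rw [homNRep_apply]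
  have h1 : ((iotaG N θ z).1.2⁻¹.1 : Θ →ₗ[ℂ] Θ) a = ((z⁻¹ : ℂˣ) : ℂ) • a := rfl
  have h2 : (iotaG N θ z).1.1 = 1 := rfl
  rw [h1, h2, map_smul]
  simp

theorem extRep_irr [Finite G] [FiniteDimensional ℂ Θ] [FiniteDimensional ℂ V]
    (hθ : Irr θ) (hρ : Irr ρ) (h0 : homN N θ ρ ≠ ⊥) : Irr (extRep N θ ρ) := by
  have h1 := clifford_irr hθ hρ h0
  exact ⟨h1.1, fun W hW => h1.2 W fun g => hW (QuotientGroup.mk g)⟩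

theorem index_iner (π : G →* Q) (hπ : Function.Surjective π) (h : π.ker = N) :
    ((Iner N θ).map π).index = (Iner N θ).index := by
  have hle : N ≤ Iner N θ := fun n hn => ⟨_, (rhom N θ ⟨n, hn⟩).2, rfl⟩
  rw [Subgroup.index_map_eq _ hπ (h ▸ hle)]

theorem dim_over [Finite G] [FiniteDimensional ℂ Θ] [FiniteDimensional ℂ V]
    (hθ : Irr θ) (hρ : Irr ρ) (h0 : homN N θ ρ ≠ ⊥) : Module.finrank ℂ V =
    (Iner N θ).index * Module.finrank ℂ Θ * Module.finrank ℂ (homN N θ ρ) :=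
  clifford_dim hθ hρ (homN N θ ρ) h0 le_rfl (fun _ hx _ hφ => homN_act hx hφ)

theorem index_iota [Finite Q] [FiniteDimensional ℂ Θ] (hθ : Irr θ) (π : G →* Q) (h : π.ker = N) :
    (iotaE N θ).range.index = Nat.card ((Iner N θ).map π) := by
  rw [← kap_ker hθ π h, Subgroup.index_ker, kap_range]

theorem dvd_below [Finite G] [FiniteDimensional ℂ V] (N : Subgroup G) [N.Normal]
    (hρ : Irr ρ) {p : ℕ} (hp : p.Prime)
    (hpi : ¬ p ∣ N.index) (hd : p ∣ Module.finrank ℂ V) :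
    ∃ (Θ : Type) (_ : AddCommGroup Θ) (_ : Module ℂ Θ) (_ : FiniteDimensional ℂ Θ)
      (θ : Representation ℂ N Θ), Irr θ ∧ p ∣ Module.finrank ℂ Θ := by
  have := hρ.1
  obtain ⟨Θ, i1, i2, i3, θ, hθ, h0⟩ := exists_below N ρ
  refine ⟨Θ, i1, i2, i3, θ, hθ, ?_⟩
  have := hθ.1
  rw [dim_over hθ hρ h0, hp.dvd_mul, hp.dvd_mul] at hd
  have hle : N ≤ Iner N θ := fun n hn => ⟨_, (rhom N θ ⟨n, hn⟩).2, rfl⟩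
  rcases hd with (hd | hd) | hd
  · exact absurd (hd.trans (Subgroup.index_dvd_of_le hle)) hpi
  · exact hd
  · exfalso
    have hk := QuotientGroup.ker_mk' N
    have hidx := index_iota hθ (QuotientGroup.mk' N) hk
    have : (iotaE N θ).range.FiniteIndex := ⟨by rw [hidx]; exact Nat.card_pos.ne'⟩
    refine dim_coprime (extRep_irr hθ hρ h0) iotaE_injective iotaE_central extRep_iota hp ?_ hd
    rw [hidx]
    intro hdvd
    exact hpi (hdvd.trans (Subgroup.card_subgroup_dvd_card _))

theorem dvd_above [Finite G] (N : Subgroup G) [N.Normal] {n : ℕ} (hn : n ∈ charDegrees N) :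
    ∃ m ∈ charDegrees G, n ∣ m := by
  obtain ⟨Θ, _, _, _, θ, hθ, rfl⟩ := exists_irr_of_mem_charDegrees hn
  obtain ⟨V, _, _, _, σ, hσ, h0⟩ := exists_over N hθ
  refine ⟨_, mem_charDegrees_of_irr hσ, ?_⟩
  rw [dim_over hθ hσ h0]
  exact Dvd.dvd.mul_right (Dvd.intro_left _ rfl) _

end ExtSec

open CategoryTheory TensorProduct

section Gallagher
variable {G Θ V Q : Type} [Group G] [Group Q] [AddCommGroup Θ] [Module ℂ Θ] [AddCommGroup V]
  [Module ℂ V] {N : Subgroup G} [N.Normal] {θ : Representation ℂ N Θ}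

theorem lift_surj {A B C : Type*} [Group A] [Group B] [Monoid C] (F : A →* B)
    (hF : Function.Surjective F) (Ψ : A →* C) (h : ∀ x, F x = 1 → Ψ x = 1) :
    ∃ L : B →* C, ∀ x, L (F x) = Ψ x := by
  refine ⟨(QuotientGroup.lift F.ker Ψ (fun x hx => h x hx)).comp
    (QuotientGroup.quotientKerEquivOfSurjective F hF).symm.toMonoidHom, fun x => ?_⟩
  have : (QuotientGroup.quotientKerEquivOfSurjective F hF).symm (F x) = QuotientGroup.mk x := by
    rw [MulEquiv.symm_apply_eq]; rfl
  change QuotientGroup.lift F.ker Ψ (fun x hx => h x hx) ((QuotientGroup.quotientKerEquivOfSurjective F hF).symm (F x)) = _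
  rw [this]; rfl

def PsiH (δ : ExtG N θ →* ℂˣ) : Gam N θ →* (Module.End ℂ Θ) where
  toFun x := ((δ (QuotientGroup.mk x))⁻¹ : ℂˣ).1 • x.1.2.1
  map_one' := by simp
  map_mul' := by
    intro x y
    rw [QuotientGroup.mk_mul, map_mul, mul_inv]
    refine LinearMap.ext fun a => ?_
    simp [smul_smul, mul_comm]

theorem PsiH_apply (δ : ExtG N θ →* ℂˣ) (x : Gam N θ) (a : Θ) :
    PsiH δ x a = ((δ (QuotientGroup.mk x))⁻¹ : ℂˣ).1 • x.1.2.1 a := rfl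

theorem exists_extension [FiniteDimensional ℂ Θ] (hθ : Irr θ) (hT : Iner N θ = ⊤)
    (δ : ExtG N θ →* ℂˣ) (hδ : ∀ z, δ (iotaE N θ z) = z) :
    ∃ θ' : Representation ℂ G Θ, ∀ (x : Gam N θ) (a : Θ),
      x.1.2.1 a = (δ (QuotientGroup.mk x) : ℂ) • θ' x.1.1 a := by
  have := hθ.1
  obtain ⟨θ', h5⟩ := lift_surj ((MonoidHom.fst _ _).comp (Gam N θ).subtype) (by
    intro g
    have : g ∈ Iner N θ := by rw [hT]; trivial
    obtain ⟨A, hA⟩ := mem_Iner.1 this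
    exact ⟨⟨_, hA⟩, rfl⟩) (PsiH δ) (by
    intro x hx
    have hx1 : x.1.1 = 1 := hx
    obtain ⟨c, hc⟩ := hθ.schur x.1.2.1 (fun n a => by
      have := x.2 n a
      rw [this, hx1]; simp)
    have hc0 : c ≠ 0 := by
      rintro rfl
      obtain ⟨v, hv⟩ := exists_ne (0 : Θ)
      have h2 : x.1.2⁻¹.1 (x.1.2.1 v) = v := by rw [← Module.End.mul_apply]; simp
      rw [hc] at h2
      simp at h2
      exact hv h2.symm
    have h3 : x = iotaG N θ (Units.mk0 c hc0) := by
      apply Subtype.ext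
      refine Prod.ext hx1 ?_
      rw [Units.ext_iff]
      exact LinearMap.ext hc
    have h4 : δ (QuotientGroup.mk x) = Units.mk0 c hc0 := by
      rw [← hδ (Units.mk0 c hc0), h3]; rfl
    refine LinearMap.ext fun a => ?_
    rw [PsiH_apply, hc, h4, smul_smul]
    simp [hc0])
  refine ⟨θ', fun x a => ?_⟩
  have h6 : θ' x.1.1 = PsiH δ x := h5 x
  rw [h6, PsiH_apply, smul_smul]
  simp

theorem gallagher [Finite G] [FiniteDimensional ℂ Θ] [FiniteDimensional ℂ V]
    (hθ : Irr θ) (hT : Iner N θ = ⊤)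
    (δ : ExtG N θ →* ℂˣ) (hδ : ∀ z, δ (iotaE N θ z) = z) (π : G →* Q)
    (hπ : Function.Surjective π) (hker : π.ker = N) {τ : Representation ℂ Q V} (hτ : Irr τ) :
    Module.finrank ℂ Θ * Module.finrank ℂ V ∈ charDegrees G := by
  obtain ⟨θ', hθ'⟩ := exists_extension hθ hT δ hδ
  have := hθ.1
  have := hτ.1
  let ρ : Representation ℂ G (Θ ⊗[ℂ] V) := Representation.tprod θ' (τ.comp π)
  have hρ : ∀ g a v, ρ g (a ⊗ₜ v) = θ' g a ⊗ₜ τ (π g) v := fun g a v => by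
    simp [ρ]
  obtain ⟨x, hx⟩ := exists_ne (0 : Θ ⊗[ℂ] V)
  obtain ⟨X, _, _, _, σ, P, hσ, hP, hPx⟩ := separation _ ρ x hx le_rfl
  have hmem : ∀ v, P ∘ₗ (TensorProduct.mk ℂ Θ V).flip v ∈ homN N θ σ := by
    intro v n a
    simp only [LinearMap.comp_apply, LinearMap.flip_apply, TensorProduct.mk_apply]
    rw [← hP, hρ]
    have h1 := hθ' (rhom N θ n) a
    have h2 : (QuotientGroup.mk (rhom N θ n) : ExtG N θ) = 1 :=
      (QuotientGroup.eq_one_iff _).2 ⟨n, rfl⟩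
    rw [h2, map_one] at h1
    have h3 : θ n a = θ' n a := by
      have : θ n a = (1 : ℂ) • θ' n a := h1
      simpa using this
    have h4 : π n = 1 := hker.ge n.2
    rw [h3, h4]
    simp
  let L : V →ₗ[ℂ] homN N θ σ := LinearMap.codRestrict _
    { toFun := fun v => P ∘ₗ (TensorProduct.mk ℂ Θ V).flip v
      map_add' := by intro a b; ext; simp
      map_smul' := by intro a b; ext; simp } hmem
  have hL : ∀ v a, (L v : Θ →ₗ[ℂ] X) a = P (a ⊗ₜ v) := fun v a => rfl
  have hL0 : L ≠ 0 := by
    intro h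
    apply hPx
    have : P = 0 := TensorProduct.ext' fun a v => by
      rw [← hL, h]; rfl
    rw [this]; rfl
  have h0 : homN N θ σ ≠ ⊥ := by
    intro h
    apply hL0
    ext v a
    have : (L v : Θ →ₗ[ℂ] X) ∈ (⊥ : Submodule ℂ (Θ →ₗ[ℂ] X)) := h ▸ (L v).2
    rw [(Submodule.mem_bot ℂ).1 this]
    rfl
  have hact : ∀ (x : Gam N θ) v, homNRep N θ σ x (L v) =
      ((δ (QuotientGroup.mk x))⁻¹ : ℂˣ).1 • L (τ (π x.1.1) v) := by
    intro x v
    ext a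
    rw [homNRep_apply, hL, ← hP, hρ]
    have h1 := hθ' x (x.1.2⁻¹.1 a)
    have h2 : x.1.2.1 (x.1.2⁻¹.1 a) = a := by rw [← Module.End.mul_apply]; simp
    rw [h2] at h1
    change _ = ((δ (QuotientGroup.mk x))⁻¹ : ℂˣ).1 • (L (τ (π x.1.1) v) : Θ →ₗ[ℂ] X) a
    rw [hL]
    conv_rhs => rw [h1]
    rw [← TensorProduct.smul_tmul', map_smul, smul_smul]
    simp
  have hinj : LinearMap.ker L = ⊥ := by
    rcases hτ.2 (LinearMap.ker L) (fun g v hv => by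
      obtain ⟨g, rfl⟩ := hπ g
      have : g ∈ Iner N θ := by rw [hT]; trivial
      obtain ⟨A, hA⟩ := mem_Iner.1 this
      have h1 := hact ⟨_, hA⟩ v
      rw [LinearMap.mem_ker] at hv ⊢
      rw [hv, map_zero] at h1
      exact (smul_eq_zero.1 h1.symm).resolve_left (Units.ne_zero _)) with e | e
    · exact e
    · exact absurd (LinearMap.ker_eq_top.1 e) hL0
  have hsurj : LinearMap.range L = ⊤ := by
    rcases (clifford_irr hθ hσ h0).2 (LinearMap.range L) (by
      rintro x _ ⟨v, rfl⟩
      rw [hact]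
      exact Submodule.smul_mem _ _ ⟨_, rfl⟩) with e | e
    · exact absurd (LinearMap.range_eq_bot.1 e) hL0
    · exact e
  have hdim := (LinearEquiv.ofBijective L
    ⟨LinearMap.ker_eq_bot.1 hinj, LinearMap.range_eq_top.1 hsurj⟩).finrank_eq
  have := mem_charDegrees_of_irr hσ
  rw [dim_over hθ hσ h0, hT, Subgroup.index_top, one_mul, ← hdim] at this
  exact this
end Gallagher

abbrev S2 (F : Type) [Field F] := Matrix.SpecialLinearGroup (Fin 2) F

section SL2
variable {F : Type} [Field F]

def uu (x : F) : S2 F := ⟨!![1, x; 0, 1], by simp⟩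
def ul (x : F) : S2 F := ⟨!![1, 0; x, 1], by simp⟩
def hh (s : Fˣ) : S2 F := ⟨!![(s : F), 0; 0, ((s⁻¹ : Fˣ) : F)], by simp⟩
def ww [CharP F 2] : S2 F := ⟨!![0, 1; 1, 0], by simp [CharTwo.neg_eq]⟩

theorem S2_ext {A B : S2 F} (h00 : A 0 0 = B 0 0) (h01 : A 0 1 = B 0 1) (h10 : A 1 0 = B 1 0)
    (h11 : A 1 1 = B 1 1) : A = B := by
  ext i j
  fin_cases i <;> fin_cases j <;> assumption

theorem S2_det (A : S2 F) : A 0 0 * A 1 1 - A 0 1 * A 1 0 = 1 := by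
  have := A.det_coe
  rwa [Matrix.det_fin_two] at this

theorem S2_mul (A B : S2 F) (i j) : (A * B) i j = A i 0 * B 0 j + A i 1 * B 1 j := by
  change (A.1 * B.1) i j = _
  rw [Matrix.mul_apply, Fin.sum_univ_two]

@[simp] theorem uu00 (x : F) : (uu x) 0 0 = 1 := rfl
@[simp] theorem uu01 (x : F) : (uu x) 0 1 = x := rfl
@[simp] theorem uu10 (x : F) : (uu x) 1 0 = 0 := rfl
@[simp] theorem uu11 (x : F) : (uu x) 1 1 = 1 := rfl
@[simp] theorem ul00 (x : F) : (ul x) 0 0 = 1 := rfl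
@[simp] theorem ul01 (x : F) : (ul x) 0 1 = 0 := rfl
@[simp] theorem ul10 (x : F) : (ul x) 1 0 = x := rfl
@[simp] theorem ul11 (x : F) : (ul x) 1 1 = 1 := rfl
@[simp] theorem hh00 (s : Fˣ) : (hh s) 0 0 = (s : F) := rfl
@[simp] theorem hh01 (s : Fˣ) : (hh s) 0 1 = 0 := rfl
@[simp] theorem hh10 (s : Fˣ) : (hh s) 1 0 = 0 := rfl
@[simp] theorem hh11 (s : Fˣ) : (hh s) 1 1 = ((s⁻¹ : Fˣ) : F) := rfl
@[simp] theorem ww00 [CharP F 2] : (ww : S2 F) 0 0 = 0 := rfl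
@[simp] theorem ww01 [CharP F 2] : (ww : S2 F) 0 1 = 1 := rfl
@[simp] theorem ww10 [CharP F 2] : (ww : S2 F) 1 0 = 1 := rfl
@[simp] theorem ww11 [CharP F 2] : (ww : S2 F) 1 1 = 0 := rfl
@[simp] theorem one00 : (1 : S2 F) 0 0 = 1 := rfl
@[simp] theorem one01 : (1 : S2 F) 0 1 = 0 := rfl
@[simp] theorem one10 : (1 : S2 F) 1 0 = 0 := rfl
@[simp] theorem one11 : (1 : S2 F) 1 1 = 1 := rfl

theorem uu_add (x y : F) : uu (x + y) = uu x * uu y := by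
  apply S2_ext <;> simp [S2_mul, add_comm]
theorem ul_add (x y : F) : ul (x + y) = ul x * ul y := by
  apply S2_ext <;> simp [S2_mul, add_comm]
theorem hh_mul (s t : Fˣ) : hh (s * t) = hh s * hh t := by
  apply S2_ext <;> simp [S2_mul, mul_comm]
theorem uu_zero : uu (0 : F) = 1 := by apply S2_ext <;> simp
theorem ul_zero : ul (0 : F) = 1 := by apply S2_ext <;> simp
theorem hh_one : hh (1 : Fˣ) = 1 := by apply S2_ext <;> simp
theorem ww_mul_ww [CharP F 2] : (ww : S2 F) * ww = 1 := by apply S2_ext <;> simp [S2_mul]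
theorem ww_inv [CharP F 2] : (ww : S2 F)⁻¹ = ww := inv_eq_of_mul_eq_one_left ww_mul_ww
theorem hh_inv (s : Fˣ) : (hh s)⁻¹ = hh s⁻¹ :=
  inv_eq_of_mul_eq_one_left (by rw [← hh_mul, inv_mul_cancel, hh_one])
theorem uu_inv (x : F) : (uu x)⁻¹ = uu (-x) :=
  inv_eq_of_mul_eq_one_left (by rw [← uu_add, neg_add_cancel, uu_zero])
theorem ul_inv (x : F) : (ul x)⁻¹ = ul (-x) :=
  inv_eq_of_mul_eq_one_left (by rw [← ul_add, neg_add_cancel, ul_zero])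
theorem uu_inj {x y : F} (h : uu x = uu y) : x = y := by
  have := congrArg (fun A : S2 F => A 0 1) h
  simpa using this
theorem ul_inj {x y : F} (h : ul x = ul y) : x = y := by
  have := congrArg (fun A : S2 F => A 1 0) h
  simpa using this
theorem hh_inj {x y : Fˣ} (h : hh x = hh y) : x = y := by
  have := congrArg (fun A : S2 F => A 0 0) h
  exact Units.ext (by simpa using this)
theorem hh_uu (s : Fˣ) (x : F) : hh s * uu x = uu ((s : F) ^ 2 * x) * hh s := by
  apply S2_ext <;> simp [S2_mul]
  field_simp
theorem hh_ul (s : Fˣ) (x : F) : hh s * ul x = ul (((s⁻¹ : Fˣ) : F) ^ 2 * x) * hh s := by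
  apply S2_ext <;> simp [S2_mul]
  field_simp
theorem ww_uu [CharP F 2] (x : F) : ww * uu x = ul x * ww := by
  apply S2_ext <;> simp [S2_mul]
theorem ww_ul [CharP F 2] (x : F) : ww * ul x = uu x * ww := by
  apply S2_ext <;> simp [S2_mul]
theorem ww_hh [CharP F 2] (s : Fˣ) : ww * hh s = hh s⁻¹ * ww := by
  apply S2_ext <;> simp [S2_mul]
/-- w u(x) w = u(1/x) h w u(1/x) -/
theorem ww_uu_ww [CharP F 2] (s : Fˣ) : ww * uu (s : F) * ww =
    uu ((s⁻¹ : Fˣ) : F) * (hh s⁻¹ * (ww * uu ((s⁻¹ : Fˣ) : F))) := by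
  apply S2_ext <;> simp [S2_mul]
  exact (CharTwo.add_self_eq_zero _).symm

theorem borel_form {A : S2 F} (h : A 1 0 = 0) : ∃ s x, A = uu x * hh s := by
  have hd := S2_det A
  rw [h] at hd
  have h0 : A 0 0 ≠ 0 := by rintro e; rw [e] at hd; simp at hd
  have h1 : A 1 1 = (A 0 0)⁻¹ := by field_simp; linear_combination hd
  refine ⟨Units.mk0 _ h0, A 0 1 * A 0 0, ?_⟩
  apply S2_ext <;> simp [S2_mul, h, h1, h0]

theorem bruhat_form [CharP F 2] {A : S2 F} (h : A 1 0 ≠ 0) :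
    ∃ s x y, A = uu x * hh s * ww * uu y := by
  have hd := S2_det A
  refine ⟨(Units.mk0 _ h)⁻¹, A 0 0 / A 1 0, A 1 1 / A 1 0, ?_⟩
  apply S2_ext <;> simp [S2_mul, h]
  · field_simp
    have : (1 : F) = -1 := (CharTwo.neg_eq 1).symm
    linear_combination (-1 : F) * hd - this
  · field_simp

theorem gen_top (H : Subgroup (S2 F)) (h1 : ∀ x, uu x ∈ H) (h2 : ∀ x, ul x ∈ H) : H = ⊤ := by
  rw [eq_top_iff]
  intro g _
  by_cases h : g 1 0 = 0
  · by_contra hg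
    have key : ∀ g : S2 F, g 1 0 ≠ 0 → g ∈ H := by
      intro g h
      have hd := S2_det g
      have : g = uu ((g 0 0 - 1) / g 1 0) * ul (g 1 0) * uu ((g 1 1 - 1) / g 1 0) := by
        apply S2_ext <;> simp [S2_mul, h]
        · field_simp
          linear_combination -hd
        · field_simp
          ring
      rw [this]
      exact H.mul_mem (H.mul_mem (h1 _) (h2 _)) (h1 _)
    apply hg
    have h3 : g 0 0 ≠ 0 := by
      intro e
      have := S2_det g
      simp [e, h] at this
    have := key (ul 1 * g) (by simp [S2_mul, h, h3])
    exact (H.mul_mem_cancel_left (h2 1)).1 this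
  · have hd := S2_det g
    have : g = uu ((g 0 0 - 1) / g 1 0) * ul (g 1 0) * uu ((g 1 1 - 1) / g 1 0) := by
      apply S2_ext <;> simp [S2_mul, h]
      · field_simp
        linear_combination -hd
      · field_simp
        ring
    rw [this]
    exact H.mul_mem (H.mul_mem (h1 _) (h2 _)) (h1 _)

theorem gen_top' [CharP F 2] (H : Subgroup (S2 F)) (h1 : ∀ x, uu x ∈ H) {g : S2 F} (hg : g ∈ H)
    (h : g 1 0 ≠ 0) : H = ⊤ := by
  obtain ⟨s, x, y, rfl⟩ := bruhat_form h
  have h2 : hh s * ww ∈ H := by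
    rw [mul_assoc, mul_assoc] at hg
    have := (H.mul_mem_cancel_left (h1 x)).1 hg
    rw [← mul_assoc] at this
    exact (H.mul_mem_cancel_right (h1 y)).1 this
  refine gen_top H h1 fun y => ?_
  have e : ul y = (hh s * ww)⁻¹ * uu ((s : F) ^ 2 * y) * (hh s * ww) := by
    rw [eq_comm, mul_assoc, inv_mul_eq_iff_eq_mul, ← mul_assoc, ← hh_uu, mul_assoc, mul_assoc, ww_ul]
  rw [e]
  exact H.mul_mem (H.mul_mem (H.inv_mem h2) (h1 _)) h2

def uHom (F : Type) [Field F] : Multiplicative F →* S2 F where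
  toFun x := uu x.toAdd
  map_one' := uu_zero
  map_mul' x y := uu_add _ _
def hHom (F : Type) [Field F] : Fˣ →* S2 F where
  toFun x := hh x
  map_one' := hh_one
  map_mul' x y := hh_mul _ _
def Usub (F : Type) [Field F] : Subgroup (S2 F) := (uHom F).range
def Csub (F : Type) [Field F] : Subgroup (S2 F) := (hHom F).range
theorem uu_mem (x : F) : uu x ∈ Usub F := ⟨.ofAdd x, rfl⟩
theorem mem_Usub {g : S2 F} : g ∈ Usub F ↔ ∃ x, uu x = g :=
  ⟨fun ⟨x, h⟩ => ⟨x.toAdd, h⟩, fun ⟨x, h⟩ => ⟨.ofAdd x, h⟩⟩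
theorem hh_mem (x : Fˣ) : hh x ∈ Csub F := ⟨x, rfl⟩
theorem mem_Csub {g : S2 F} : g ∈ Csub F ↔ ∃ x, hh x = g := Iff.rfl

theorem card_Usub : Nat.card (Usub F) = Nat.card F :=
  (Nat.card_congr (MonoidHom.ofInjective (f := uHom F) fun _ _ h => uu_inj (F := F) h).toEquiv).symm
theorem card_Csub [Finite F] : Nat.card (Csub F) = Nat.card F - 1 := by
  rw [← Nat.card_units]
  exact (Nat.card_congr (MonoidHom.ofInjective (f := hHom F) fun _ _ h => hh_inj h).toEquiv).symm

theorem card_S2 [Finite F] : Nat.card (S2 F) = Nat.card F * (Nat.card F ^ 2 - 1) := by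
  classical
  have := Fintype.ofFinite F
  let P := {v : F × F // v ≠ 0}
  have key : Nonempty (S2 F ≃ P × F) := by
    have hg : ∀ v : P, ∃ g : S2 F, g 0 0 = v.1.1 ∧ g 1 0 = v.1.2 := by
      rintro ⟨⟨a, c⟩, h⟩
      by_cases ha : a = 0
      · have hc : c ≠ 0 := by rintro rfl; exact h (by rw [ha]; rfl)
        exact ⟨⟨!![a, -c⁻¹; c, 0], by simp [hc]⟩, rfl, rfl⟩
      · exact ⟨⟨!![a, 0; c, a⁻¹], by simp [ha]⟩, rfl, rfl⟩
    choose f hf1 hf2 using hg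
    refine ⟨(Equiv.ofBijective (fun x : P × F => f x.1 * uu x.2) ⟨?_, ?_⟩).symm⟩
    · rintro ⟨v, x⟩ ⟨v', x'⟩ h
      have h : f v * uu x = f v' * uu x' := h
      have e0 := congrArg (fun A : S2 F => A 0 0) h
      have e1 := congrArg (fun A : S2 F => A 1 0) h
      simp [S2_mul, hf1, hf2] at e0 e1
      have : v = v' := Subtype.ext (Prod.ext e0 e1)
      subst this
      rw [uu_inj (mul_left_cancel h)]
    · intro g
      have hv : ((g 0 0, g 1 0) : F × F) ≠ 0 := by
        intro h
        have h0 : g 0 0 = 0 := congrArg Prod.fst h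
        have h1 : g 1 0 = 0 := congrArg Prod.snd h
        have := S2_det g
        simp [h0, h1] at this
      let v : P := ⟨_, hv⟩
      have h1 : f v 0 0 = g 0 0 := hf1 v
      have h2 : f v 1 0 = g 1 0 := hf2 v
      have hi : ∀ A : S2 F, A⁻¹ 0 0 = A 1 1 ∧ A⁻¹ 0 1 = - A 0 1 ∧ A⁻¹ 1 0 = - A 1 0 ∧ A⁻¹ 1 1 = A 0 0 := by
        intro A
        rw [Matrix.SpecialLinearGroup.SL2_inv_expl]
        exact ⟨rfl, rfl, rfl, rfl⟩
      have hb : ((f v)⁻¹ * g) = uu (((f v)⁻¹ * g) 0 1) := by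
        obtain ⟨i1, i2, i3, i4⟩ := hi (f v)
        have d1 := S2_det (f v)
        have d2 := S2_det g
        rw [h1, h2] at d1
        apply S2_ext <;> simp [S2_mul, i1, i2, i3, i4, h1, h2]
        · linear_combination d1
        · ring
        · linear_combination d2
      refine ⟨⟨v, ((f v)⁻¹ * g) 0 1⟩, ?_⟩
      change f v * uu (((f v)⁻¹ * g) 0 1) = g
      exact (eq_inv_mul_iff_mul_eq.1 hb.symm)
  obtain ⟨e⟩ := key
  rw [Nat.card_congr e, Nat.card_prod, mul_comm]
  congr 1
  have : Nat.card P = Fintype.card P := Nat.card_eq_fintype_card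
  rw [this, Fintype.card_subtype_compl, Fintype.card_prod, Nat.card_eq_fintype_card, sq]
  simp

end SL2

section GrpGen
variable {G : Type} [Group G] [Finite G]

theorem conj_le_of_pgroup {p : ℕ} (hp : p.Prime) (H P : Subgroup G) (hP : IsPGroup p P)
    (h : ¬ p ∣ H.index) : ∃ k : G, ∀ x ∈ P, k⁻¹ * x * k ∈ H := by
  have := Fact.mk hp
  obtain ⟨a, ha⟩ := hP.nonempty_fixed_point_of_prime_not_dvd_card (G ⧸ H) (by
    rwa [← Subgroup.index_eq_card])
  obtain ⟨k, rfl⟩ := QuotientGroup.mk_surjective a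
  refine ⟨k, fun x hx => ?_⟩
  have h1 : (QuotientGroup.mk (x * k) : G ⧸ H) = QuotientGroup.mk k := ha ⟨x, hx⟩
  rw [eq_comm, QuotientGroup.eq] at h1
  rwa [mul_assoc]

theorem sylow_count {t m : ℕ} (ht : t.Prime) (H : Subgroup G) (hG : Nat.card G = t * m)
    (htm : ¬ t ∣ m) (hH : ¬ t ∣ H.index) :
    ∃ n, n ≡ 1 [MOD t] ∧ n ∣ m ∧ n * t ∣ Nat.card H ∧
      (n = 1 → ∃ x ∈ H, orderOf x = t ∧ ∀ g ∈ H, ∃ k : ℕ, g * x * g⁻¹ = x ^ k) := by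
  have := Fact.mk ht
  obtain ⟨P⟩ : Nonempty (Sylow t H) := inferInstance
  have hd : t ∣ Nat.card H := by
    have : t ∣ Nat.card H * H.index := by rw [Subgroup.card_mul_index, hG]; exact Dvd.intro _ rfl
    exact (ht.dvd_mul.1 this).resolve_right hH
  have hdG : Nat.card H ∣ t * m := hG ▸ H.card_subgroup_dvd_card
  have hP : Nat.card P = t := by
    obtain ⟨e, he⟩ := IsPGroup.iff_card.1 P.isPGroup'
    have h1 := P.dvd_card_of_dvd_card hd
    rw [he] at h1 ⊢
    have e0 : e ≠ 0 := by rintro rfl; simp at h1; exact ht.one_lt.ne' h1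
    have e1 : e < 2 := by
      by_contra h2
      have h3 : t ^ 2 ∣ t * m := (pow_dvd_pow t (not_lt.1 h2)).trans
        (he ▸ (Subgroup.card_subgroup_dvd_card _).trans hdG)
      rw [sq] at h3
      exact htm (Nat.dvd_of_mul_dvd_mul_left ht.pos h3)
    have : e = 1 := by omega
    rw [this, pow_one]
  have hnt : Nat.card (Sylow t H) * t ∣ Nat.card H := by
    rw [← Subgroup.index_mul_card (P : Subgroup H)]
    have : Nat.card (P : Subgroup H) = t := hP
    rw [this]
    exact Nat.mul_dvd_mul_right P.card_dvd_index _
  refine ⟨Nat.card (Sylow t H), card_sylow_modEq_one t H, ?_, hnt, ?_⟩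
  · have := hnt.trans hdG
    rw [mul_comm t m] at this
    exact Nat.dvd_of_mul_dvd_mul_right ht.pos this
  · intro h1
    have hs : Subsingleton (Sylow t H) := (Nat.card_eq_one_iff_unique.1 h1).1
    have hn : (P : Subgroup H).Normal := Sylow.normal_of_subsingleton P
    obtain ⟨x, hx⟩ := exists_prime_orderOf_dvd_card' (G := P) t (by rw [hP])
    refine ⟨x.1.1, x.1.2, by rw [Subgroup.orderOf_coe, Subgroup.orderOf_coe, hx], ?_⟩
    intro g hg
    have h2 := hn.conj_mem x.1 x.2 ⟨g, hg⟩
    have h3 : Subgroup.zpowers x = ⊤ := by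
      apply Subgroup.eq_top_of_card_eq
      rw [Nat.card_zpowers, hx, hP]
    have h4 : (⟨_, h2⟩ : P) ∈ Subgroup.zpowers x := by rw [h3]; trivial
    rw [← mem_powers_iff_mem_zpowers] at h4
    obtain ⟨k, hk⟩ := h4
    refine ⟨k, ?_⟩
    have := congrArg (fun y : P => (y.1.1 : G)) hk
    simpa using this.symm

end GrpGen

section SL2b
variable {F : Type} [Field F] [Finite F] [CharP F 2]

theorem card_two_pow (F : Type) [Field F] [Finite F] [CharP F 2] : ∃ f, f ≠ 0 ∧ Nat.card F = 2 ^ f := by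
  have := Fintype.ofFinite F
  obtain ⟨n, -, h⟩ := FiniteField.card F 2
  exact ⟨n, n.ne_zero, by rw [Nat.card_eq_fintype_card, h]⟩

theorem units_pow (s : Fˣ) : s ^ (Nat.card F - 1) = 1 := by
  rw [← Nat.card_units]
  exact pow_card_eq_one'

theorem hh_pow (s : Fˣ) (n : ℕ) : (hh s) ^ n = hh (s ^ n) := ((hHom F).map_pow s n).symm

theorem borel_pow {g : S2 F} (h : g 1 0 = 0) : g ^ (2 * (Nat.card F - 1)) = 1 := by
  obtain ⟨s, x, rfl⟩ := borel_form h
  have key : ∀ n : ℕ, ∃ y, (uu x * hh s) ^ n = uu y * hh (s ^ n) := by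
    intro n
    induction n with
    | zero => exact ⟨0, by simp [uu_zero, hh_one]⟩
    | succ n ih =>
      obtain ⟨y, hy⟩ := ih
      refine ⟨y + (s ^ n : Fˣ) ^ 2 * x, ?_⟩
      rw [pow_succ, hy, mul_assoc, ← mul_assoc (hh _) (uu x), hh_uu, uu_add, pow_succ s n, hh_mul]
      simp only [mul_assoc]
  obtain ⟨y, hy⟩ := key (Nat.card F - 1)
  rw [mul_comm, pow_mul, hy, units_pow, hh_one, mul_one, sq, ← uu_add, CharTwo.add_self_eq_zero,
    uu_zero]

theorem unit_sq (s : Fˣ) : ∃ r : Fˣ, r ^ 2 = s := by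
  have := Fintype.ofFinite F
  obtain ⟨r, hr⟩ := FiniteField.isSquare_of_char_two (CharP.ringChar_of_prime_eq_zero Nat.prime_two (CharP.cast_eq_zero F 2) ) (s : F)
  have h0 : r ≠ 0 := by rintro rfl; simp at hr
  exact ⟨Units.mk0 r h0, Units.ext (by simp [hr, sq])⟩

theorem exists_unit_ne (h : 3 ≤ Nat.card F) : ∃ s : Fˣ, s ≠ 1 := by
  have : Nontrivial Fˣ := by
    rw [← Finite.one_lt_card_iff_nontrivial, Nat.card_units]; omega
  exact exists_ne 1

theorem sq_ne_one {s : Fˣ} (h : s ≠ 1) : (s : F) ^ 2 ≠ 1 := by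
  intro e
  apply h
  have h1 : ((s : F) - 1) ^ 2 = 0 := by
    have : (2 : F) = 0 := CharP.cast_eq_zero F 2
    linear_combination e + (1 - (s : F)) * this
  have := pow_eq_zero_iff (two_ne_zero) |>.1 h1
  exact Units.ext (by simpa using sub_eq_zero.1 this)

theorem index_le_two (hq : 3 ≤ Nat.card F) (H : Subgroup (S2 F)) (h : H.index ≤ 2) : H = ⊤ := by
  have h0 : H.index ≠ 0 := Subgroup.index_ne_zero_of_finite
  have : H.index = 1 ∨ H.index = 2 := by omega
  rcases this with h1 | h2
  · exact Subgroup.index_eq_one.1 h1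
  · have hn := Subgroup.normal_of_index_eq_two h2
    have hhm : ∀ s, hh s ∈ H := by
      intro s
      obtain ⟨r, rfl⟩ := unit_sq s
      rw [← hh_pow]
      exact Subgroup.sq_mem_of_index_two h2 _
    obtain ⟨s, hs⟩ := exists_unit_ne hq
    have key : ∀ (s : Fˣ), s ≠ 1 → ∀ x : F, ∃ y, (s : F) ^ 2 * y + - y = x := by
      intro s hs x
      refine ⟨x / ((s : F) ^ 2 - 1), ?_⟩
      have := sub_ne_zero.2 (sq_ne_one hs)
      field_simp
      ring
    apply gen_top
    · intro x
      obtain ⟨y, hy⟩ := key s hs x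
      have e : uu x = hh s * (uu y * (hh s)⁻¹ * (uu y)⁻¹) := by
        rw [← mul_assoc, ← mul_assoc, hh_uu, mul_inv_cancel_right, uu_inv, ← uu_add, hy]
      rw [e]
      exact H.mul_mem (hhm s) (hn.conj_mem _ (H.inv_mem (hhm s)) _)
    · intro x
      obtain ⟨y, hy⟩ := key s⁻¹ (by simpa using hs) x
      have e : ul x = hh s * (ul y * (hh s)⁻¹ * (ul y)⁻¹) := by
        rw [← mul_assoc, ← mul_assoc, hh_ul, mul_inv_cancel_right, ul_inv, ← ul_add, hy]
      rw [e]
      exact H.mul_mem (hhm s) (hn.conj_mem _ (H.inv_mem (hhm s)) _)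

theorem Usub_pgroup : IsPGroup 2 (Usub F) := by
  obtain ⟨f, -, h⟩ := card_two_pow F
  exact IsPGroup.of_card (by rw [card_Usub, h])

theorem conj_U_le (H : Subgroup (S2 F)) (h : ¬ 2 ∣ H.index) :
    ∃ k : S2 F, ∀ x, k⁻¹ * uu x * k ∈ H := by
  obtain ⟨k, hk⟩ := conj_le_of_pgroup Nat.prime_two H (Usub F) Usub_pgroup h
  exact ⟨k, fun x => hk _ (uu_mem x)⟩

/-- conjugate of `H` -/
def cj {G : Type} [Group G] (k : G) (H : Subgroup G) : Subgroup G := H.map (MulAut.conj k).toMonoidHom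

theorem mem_cj {G : Type} [Group G] {k g : G} {H : Subgroup G} : g ∈ cj k H ↔ k⁻¹ * g * k ∈ H := by
  constructor
  · rintro ⟨x, hx, rfl⟩
    simpa [mul_assoc] using hx
  · intro h
    exact ⟨_, h, by simp [mul_assoc]⟩

theorem cj_top {G : Type} [Group G] {k : G} {H : Subgroup G} (h : cj k H = ⊤) : H = ⊤ := by
  rw [eq_top_iff]
  intro g _
  have : k * g * k⁻¹ ∈ cj k H := by rw [h]; trivial
  rw [mem_cj] at this
  simpa [mul_assoc] using this

theorem top_of_two (H : Subgroup (S2 F)) (h : ¬ 2 ∣ H.index) {r : ℕ} (hr : ¬ r ∣ 2 * (Nat.card F - 1))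
    {g : S2 F} (hg : g ∈ H) (ho : orderOf g = r) : H = ⊤ := by
  obtain ⟨k, hk⟩ := conj_U_le H h
  refine cj_top (k := k) (gen_top' _ (fun x => mem_cj.2 (hk x)) (g := k * g * k⁻¹)
    (mem_cj.2 (by simpa [mul_assoc] using hg)) ?_)
  intro h0
  apply hr
  have h1 := borel_pow h0
  rw [conj_pow, mul_inv_eq_one, mul_eq_left] at h1
  rw [← ho]
  exact orderOf_dvd_of_pow_eq_one h1

theorem diag_of_mem {g : S2 F} (h1 : g 0 1 = 0) (h2 : g 1 0 = 0) : g ^ (Nat.card F - 1) = 1 := by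
  obtain ⟨s, x, rfl⟩ := borel_form h2
  have : x = 0 := by simpa [S2_mul] using h1
  rw [this, uu_zero, one_mul, hh_pow, units_pow, hh_one]

theorem S2_inv (A : S2 F) :
    A⁻¹ 0 0 = A 1 1 ∧ A⁻¹ 0 1 = - A 0 1 ∧ A⁻¹ 1 0 = - A 1 0 ∧ A⁻¹ 1 1 = A 0 0 := by
  rw [Matrix.SpecialLinearGroup.SL2_inv_expl]
  exact ⟨rfl, rfl, rfl, rfl⟩

/-- elements normalizing a nontrivial part of the torus are monomial -/
theorem monomial_of_conj {g : S2 F} {s : Fˣ} (hs : s ≠ 1) {s' : Fˣ} (h : g * hh s = hh s' * g) :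
    g ^ (2 * (Nat.card F - 1)) = 1 := by
  have hss : (s : F) - ((s⁻¹ : Fˣ) : F) ≠ 0 := by
    intro e
    apply sq_ne_one hs
    have := sub_eq_zero.1 e
    rw [sq]
    nth_rw 2 [this]
    simp
  have e00 := congrArg (fun A : S2 F => A 0 0) h
  have e01 := congrArg (fun A : S2 F => A 0 1) h
  have e10 := congrArg (fun A : S2 F => A 1 0) h
  have e11 := congrArg (fun A : S2 F => A 1 1) h
  simp only [S2_mul, hh00, hh01, hh10, hh11, mul_zero, zero_mul, add_zero, zero_add] at e00 e01 e10 e11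
  have h1 : g 0 0 * g 0 1 = 0 := by
    have : ((s : F) - ((s⁻¹ : Fˣ) : F)) * (g 0 0 * g 0 1) = 0 := by
      linear_combination g 0 1 * e00 - g 0 0 * e01
    exact (mul_eq_zero.1 this).resolve_left hss
  have h2 : g 1 0 * g 1 1 = 0 := by
    have : ((s : F) - ((s⁻¹ : Fˣ) : F)) * (g 1 0 * g 1 1) = 0 := by
      linear_combination g 1 1 * e10 - g 1 0 * e11
    exact (mul_eq_zero.1 this).resolve_left hss
  rw [pow_mul]
  have hd := S2_det g
  have h3 : g 0 1 * (g 0 0 + g 1 1) = 0 := by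
    rcases mul_eq_zero.1 h2 with h | h
    · rw [h] at hd
      have : g 0 0 ≠ 0 := by rintro e; simp [e] at hd
      rw [(mul_eq_zero.1 h1).resolve_left this]; simp
    · rw [h]; linear_combination h1
  have h4 : g 1 0 * (g 0 0 + g 1 1) = 0 := by
    rcases mul_eq_zero.1 h1 with h | h
    · rw [h]; linear_combination h2
    · rw [h] at hd
      have : g 1 1 ≠ 0 := by rintro e; simp [e] at hd
      rw [(mul_eq_zero.1 h2).resolve_right this]; simp
  apply diag_of_mem
  · rw [sq, S2_mul]; linear_combination h3
  · rw [sq, S2_mul]; linear_combination h4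

theorem diag_of_comm {g : S2 F} {s : Fˣ} (hs : s ≠ 1) (h : g * hh s = hh s * g) :
    g ^ (Nat.card F - 1) = 1 := by
  have hss : (s : F) - ((s⁻¹ : Fˣ) : F) ≠ 0 := by
    intro e
    apply sq_ne_one hs
    have := sub_eq_zero.1 e
    rw [sq]
    nth_rw 2 [this]
    simp
  have e01 := congrArg (fun A : S2 F => A 0 1) h
  have e10 := congrArg (fun A : S2 F => A 1 0) h
  simp only [S2_mul, hh00, hh01, hh10, hh11, mul_zero, zero_mul, add_zero, zero_add] at e01 e10
  apply diag_of_mem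
  · have : ((s : F) - ((s⁻¹ : Fˣ) : F)) * (g 0 1) = 0 := by linear_combination -e01
    exact (mul_eq_zero.1 this).resolve_left hss
  · have : ((s : F) - ((s⁻¹ : Fˣ) : F)) * (g 1 0) = 0 := by linear_combination e10
    exact (mul_eq_zero.1 this).resolve_left hss
end SL2b

section SL2c
variable {F : Type} [Field F] [Finite F] [CharP F 2]

theorem index_Csub : (Csub F).index = Nat.card F * (Nat.card F + 1) := by
  have h1 := (Csub F).card_mul_index
  rw [card_Csub, card_S2] at h1
  obtain ⟨f, hf, hq⟩ := card_two_pow F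
  have : 2 ^ 1 ≤ 2 ^ f := Nat.pow_le_pow_right (by norm_num) (by omega)
  have h2 : 0 < Nat.card F - 1 := by rw [hq]; omega
  apply Nat.eq_of_mul_eq_mul_left h2
  rw [h1]
  have : Nat.card F ^ 2 - 1 = (Nat.card F + 1) * (Nat.card F - 1) := by
    have := Nat.sq_sub_sq (Nat.card F) 1
    simpa using this
  rw [this]; ring

theorem card_S2' : Nat.card (S2 F) = Nat.card F * (Nat.card F + 1) * (Nat.card F - 1) := by
  rw [card_S2]
  have : Nat.card F ^ 2 - 1 = (Nat.card F + 1) * (Nat.card F - 1) := by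
    have := Nat.sq_sub_sq (Nat.card F) 1
    simpa using this
  rw [this]; ring

theorem exists_order {G : Type} [Group G] [Finite G] (H : Subgroup G) {r : ℕ} (hr : r.Prime)
    (h1 : r ∣ Nat.card G) (h2 : ¬ r ∣ H.index) : ∃ g ∈ H, orderOf g = r := by
  have := Fact.mk hr
  have : r ∣ Nat.card H := by
    rw [← H.card_mul_index] at h1
    exact (hr.dvd_mul.1 h1).resolve_right h2
  obtain ⟨x, hx⟩ := exists_prime_orderOf_dvd_card' r this
  exact ⟨x, x.2, by rwa [Subgroup.orderOf_coe]⟩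

theorem odd_facts {r f q : ℕ} (hr : r.Prime) (hf : f ≠ 0) (hq : q = 2 ^ f) (h : r ∣ q + 1) :
    ¬ r ∣ 2 * (q - 1) ∧ ¬ r ∣ q := by
  have hev : 2 ∣ q := hq ▸ dvd_pow_self 2 hf
  have hq0 : 0 < q := hq ▸ by positivity
  have hr2 : r ≠ 2 := by rintro rfl; omega
  have hr2' : ¬ r ∣ 2 := fun h => hr2 ((Nat.prime_dvd_prime_iff_eq hr Nat.prime_two).1 h)
  refine ⟨fun h2 => ?_, fun h2 => ?_⟩
  · have h3 := (hr.dvd_mul.1 h2).resolve_left hr2'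
    have := Nat.dvd_sub h h3
    have e : q + 1 - (q - 1) = 2 := by omega
    rw [e] at this; exact hr2' this
  · have := Nat.dvd_sub h h2
    have e : q + 1 - q = 1 := by omega
    rw [e] at this; exact hr.one_lt.ne' (Nat.dvd_one.1 this)

theorem subgroup_case1 {t : ℕ} (ht : t.Prime) (hqt : Nat.card F - 1 = t) (ht3 : 3 ≤ t)
    (H : Subgroup (S2 F)) {r : ℕ} (hr : r.Prime) (hrq : r ∣ Nat.card F + 1) (hrH : ¬ r ∣ H.index)
    (h2t : ¬ 2 * t ∣ H.index) : H = ⊤ := by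
  obtain ⟨f, hf, hq⟩ := card_two_pow F
  obtain ⟨hr2, hrq'⟩ := odd_facts hr hf hq hrq
  have hqt' : Nat.card F = t + 1 := by omega
  have hcard := card_S2' (F := F)
  obtain ⟨g, hg, hgo⟩ := exists_order H hr (by rw [hcard]; exact (hrq.mul_left _).mul_right _) hrH
  by_cases h2 : 2 ∣ H.index
  swap
  · exact top_of_two H h2 hr2 hg hgo
  have htH : ¬ t ∣ H.index := by
    intro h
    exact h2t (Nat.Coprime.mul_dvd_of_dvd_of_dvd
      ((Nat.coprime_primes Nat.prime_two ht).2 (by omega)) h2 h)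
  rw [hqt, hqt', mul_comm] at hcard
  have htm : ¬ t ∣ (t + 1) * (t + 1 + 1) := by
    intro h
    rcases ht.dvd_mul.1 h with h | h
    · exact ht.one_lt.ne' (Nat.dvd_one.1 ((Nat.dvd_add_right (dvd_refl t)).1 h))
    · have := Nat.le_of_dvd (by norm_num) ((Nat.dvd_add_right (dvd_refl t)).1 (show t ∣ t + 2 from h))
      omega
  obtain ⟨n, hn1, hn2, hn3, hn4⟩ := sylow_count ht H hcard htm htH
  have hn0 : n ≠ 0 := by
    rintro rfl
    rw [Nat.modEq_iff_dvd'  (by norm_num)] at hn1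
    exact ht.one_lt.ne' (Nat.dvd_one.1 hn1)
  have hle := Nat.le_of_dvd Nat.card_pos hn3
  have hci := H.card_mul_index
  rw [hcard] at hci
  obtain ⟨a, ha⟩ := (Nat.modEq_iff_dvd' (by omega)).1 hn1.symm
  have hna : n = 1 + t * a := by omega
  obtain ⟨n', hn'⟩ := hn2
  have hn'2 : n' ≡ 2 [MOD t] := by
    have h1 : n * n' ≡ n' [MOD t] := by simpa using hn1.mul_right n'
    have h2 : (t + 1) * (t + 1 + 1) ≡ 2 [MOD t] := by
      have : (t + 1) * (t + 1 + 1) = 2 + t * (t + 3) := by ring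
      rw [this]
      simp [Nat.ModEq]
    rw [hn'] at h2
    exact h1.symm.trans h2
  have hn'0 : n' ≠ 0 := by rintro rfl; simp at hn'
  have hn'2' : 2 ≤ n' := by
    by_contra hlt
    have : n' = 1 := by omega
    rw [this] at hn'2
    have := (Nat.modEq_iff_dvd' (by norm_num)).1 hn'2
    exact ht.one_lt.ne' (Nat.dvd_one.1 this)
  obtain ⟨b, hb⟩ := (Nat.modEq_iff_dvd' hn'2').1 hn'2.symm
  have hnb : n' = 2 + t * b := by omega
  have hab : 2 * a + b + t * (a * b) = 3 + t := by
    have : t * (2 * a + b + t * (a * b)) = t * (3 + t) := by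
      rw [hna, hnb] at hn'
      nlinarith
    exact Nat.eq_of_mul_eq_mul_left ht.pos this
  have hcases : a = 0 ∨ b = 0 ∨ (a = 1 ∧ b = 1) := by
    by_contra hc
    push Not at hc
    obtain ⟨c1, c2, c3⟩ := hc
    have hab1 : 2 ≤ a * b := by
      rcases Nat.lt_or_ge a 2 with h | h
      · have : a = 1 := by omega
        have := c3 this
        subst_vars
        omega
      · have : 1 ≤ b := by omega
        nlinarith
    have : t * 2 ≤ t * (a * b) := Nat.mul_le_mul_left _ hab1
    have ha1 : 1 ≤ a := by omega
    have hb1 : 1 ≤ b := by omega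
    have h3 : t = 3 ∧ a = 1 ∧ b = 1 := by
      refine ⟨by omega, by omega, by omega⟩
    exact c3 h3.2.1 h3.2.2
  rcases hcases with h | h | ⟨h, -⟩
  · -- normal Sylow
    exfalso
    obtain ⟨x, hx, hxo, hxn⟩ := hn4 (by rw [hna, h]; simp)
    obtain ⟨k, hk⟩ := conj_le_of_pgroup ht (Csub F) (Subgroup.zpowers x)
      (IsPGroup.of_card (n := 1) (by rw [Nat.card_zpowers, hxo, pow_one])) (by
        rw [index_Csub, hqt']; exact htm)
    obtain ⟨s, hs⟩ := mem_Csub.1 (hk x (Subgroup.mem_zpowers x))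
    have hs1 : s ≠ 1 := by
      rintro rfl
      rw [hh_one, eq_comm, mul_assoc, inv_mul_eq_one, eq_comm, mul_eq_right] at hs
      rw [hs, orderOf_one] at hxo
      omega
    obtain ⟨j, hj⟩ := hxn g hg
    have h1 := monomial_of_conj (g := k⁻¹ * g * k) hs1 (s' := s ^ j) (by
      have e : hh (s ^ j) = k⁻¹ * x ^ j * k := by
        rw [← hh_pow, hs]
        have := conj_pow (i := j) (a := k⁻¹) (b := x)
        rw [inv_inv] at this
        exact this
      rw [e, hs, ← hj]; group)
    apply hr2
    rw [← hgo]
    apply orderOf_dvd_of_pow_eq_one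
    have := conj_pow (i := 2 * (Nat.card F - 1)) (a := k⁻¹) (b := g)
    rw [inv_inv] at this
    rw [this, mul_assoc, inv_mul_eq_one, eq_comm, mul_eq_right] at h1
    exact h1
  · -- index ≤ 2
    apply index_le_two (by omega)
    rw [h] at hnb
    have hn'e : n' = 2 := by simpa using hnb
    rw [hn'e] at hn'
    by_contra hi
    have : n * t * 3 ≤ Nat.card H * H.index := Nat.mul_le_mul hle (by omega)
    rw [hci, hn'] at this
    have : 0 < n * t := Nat.mul_pos (by omega) ht.pos
    nlinarith
  · -- n = q
    have hnq : n = Nat.card F := by rw [hna, h, hqt']; ring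
    refine top_of_two H ?_ hr2 hg hgo
    intro h2
    have h3 : n * 2 ∣ Nat.card H * H.index := Nat.mul_dvd_mul ((Dvd.intro _ rfl).trans hn3) h2
    rw [hci, hnq, hqt', mul_comm t, mul_assoc] at h3
    have h4 := Nat.dvd_of_mul_dvd_mul_left (by omega) h3
    have hqe : 2 ∣ Nat.card F := hq ▸ dvd_pow_self 2 hf
    rcases Nat.prime_two.dvd_mul.1 h4 with h | h <;> omega

theorem subgroup_case2 {t : ℕ} (ht : t.Prime) (hqt : Nat.card F + 1 = t) (ht5 : 5 ≤ t)
    (H : Subgroup (S2 F)) {r : ℕ} (hr : r.Prime) (hrq : r ∣ Nat.card F - 1) (hrH : ¬ r ∣ H.index)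
    (h2t : ¬ 2 * t ∣ H.index) : H = ⊤ ∨ ∃ k : S2 F, (∀ x, uu x ∈ cj k H) ∧ ∀ g ∈ cj k H, g 1 0 = 0 := by
  obtain ⟨f, hf, hq⟩ := card_two_pow F
  have hqt' : Nat.card F = t - 1 := by omega
  have hqe : 2 ∣ Nat.card F := hq ▸ dvd_pow_self 2 hf
  have hr2 : r ≠ 2 := by rintro rfl; omega
  have hrC : ¬ r ∣ Nat.card F * (Nat.card F + 1) := by
    intro h
    rcases hr.dvd_mul.1 h with h | h
    · rw [hq] at h
      exact hr2 ((Nat.prime_dvd_prime_iff_eq hr Nat.prime_two).1 (hr.dvd_of_dvd_pow h))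
    · have := Nat.dvd_sub h hrq
      have e : Nat.card F + 1 - (Nat.card F - 1) = 2 := by omega
      rw [e] at this
      exact hr2 ((Nat.prime_dvd_prime_iff_eq hr Nat.prime_two).1 this)
  have hcard := card_S2' (F := F)
  obtain ⟨c, hc, hco⟩ := exists_order H hr (by rw [hcard]; exact hrq.mul_left _) hrH
  by_cases h2 : 2 ∣ H.index
  swap
  · obtain ⟨k, hk⟩ := conj_U_le H h2
    by_cases hb : ∀ g ∈ cj k H, g 1 0 = 0
    · exact Or.inr ⟨k, fun x => mem_cj.2 (hk x), hb⟩
    · push Not at hb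
      obtain ⟨g, hg, hg0⟩ := hb
      exact Or.inl (cj_top (gen_top' _ (fun x => mem_cj.2 (hk x)) hg hg0))
  left
  have htH : ¬ t ∣ H.index := by
    intro h
    exact h2t (Nat.Coprime.mul_dvd_of_dvd_of_dvd
      ((Nat.coprime_primes Nat.prime_two ht).2 (by omega)) h2 h)
  obtain ⟨m, rfl⟩ : ∃ m, t = m + 2 := ⟨t - 2, by omega⟩
  have hqm : Nat.card F = m + 1 := by omega
  have hcard : Nat.card (S2 F) = (m + 2) * ((m + 1) * m) := by
    rw [hcard, hqm]; simp; ring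
  have htm : ¬ (m + 2) ∣ (m + 1) * m := by
    intro h
    rcases ht.dvd_mul.1 h with h | h
    · have := Nat.le_of_dvd (by omega) h; omega
    · have := Nat.le_of_dvd (by omega) h; omega
  obtain ⟨n, hn1, hn2, hn3, hn4⟩ := sylow_count ht H hcard htm htH
  have hn0 : n ≠ 0 := by
    rintro rfl
    rw [Nat.modEq_iff_dvd'  (by norm_num)] at hn1
    exact ht.one_lt.ne' (Nat.dvd_one.1 hn1)
  have hle := Nat.le_of_dvd Nat.card_pos hn3
  have hci := H.card_mul_index
  rw [hcard] at hci
  obtain ⟨a, ha⟩ := (Nat.modEq_iff_dvd' (by omega)).1 hn1.symm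
  have hna : n = 1 + (m + 2) * a := by omega
  obtain ⟨n', hn'⟩ := hn2
  have hn'2 : n' ≡ 2 [MOD (m + 2)] := by
    have h1 : n * n' ≡ n' [MOD (m + 2)] := by simpa using hn1.mul_right n'
    have h2 : (m + 1) * m ≡ 2 [MOD (m + 2)] := by
      obtain ⟨m', rfl⟩ : ∃ m', m = m' + 1 := ⟨m - 1, by omega⟩
      have : (m' + 1 + 1) * (m' + 1) = 2 + (m' + 1 + 2) * m' := by ring
      rw [this]
      simp [Nat.ModEq]
    rw [hn'] at h2
    exact h1.symm.trans h2
  have hn'0 : n' ≠ 0 := by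
    rintro rfl
    have : 0 < (m + 1) * m := Nat.mul_pos (by omega) (by omega)
    omega
  have hn'2' : 2 ≤ n' := by
    by_contra hlt
    have : n' = 1 := by omega
    rw [this] at hn'2
    have := (Nat.modEq_iff_dvd' (by norm_num)).1 hn'2
    exact ht.one_lt.ne' (Nat.dvd_one.1 this)
  obtain ⟨b, hb⟩ := (Nat.modEq_iff_dvd' hn'2').1 hn'2.symm
  have hnb : n' = 2 + (m + 2) * b := by omega
  have hcases : a = 0 ∨ b = 0 := by
    by_contra hc
    push Not at hc
    have h1 : m + 3 ≤ n := by
      rw [hna]; nlinarith [Nat.pos_of_ne_zero hc.1]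
    have h2 : m + 4 ≤ n' := by
      rw [hnb]; nlinarith [Nat.pos_of_ne_zero hc.2]
    have := Nat.mul_le_mul h1 h2
    rw [← hn'] at this
    nlinarith
  rcases hcases with h | h
  · exfalso
    obtain ⟨x, hx, hxo, hxn⟩ := hn4 (by rw [hna, h]; simp)
    obtain ⟨j, hj⟩ := hxn c hc
    -- c centralizes x
    have hiter : ∀ n : ℕ, c ^ n * x * (c ^ n)⁻¹ = x ^ (j ^ n) := by
      intro n
      induction n with
      | zero => simp
      | succ n ih =>
        rw [pow_succ' c, mul_inv_rev]
        have : c * c ^ n * x * ((c ^ n)⁻¹ * c⁻¹) = c * (c ^ n * x * (c ^ n)⁻¹) * c⁻¹ := by group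
        rw [this, ih, ← conj_pow, hj, ← pow_mul, pow_succ']
    have hF := Fact.mk ht
    have hjr : ((j : ZMod (m + 2))) ^ r = 1 := by
      have := hiter r
      rw [← hco, pow_orderOf_eq_one] at this
      simp only [one_mul, inv_one, mul_one, hco] at this
      have h1 : x ^ 1 = x ^ (j ^ r) := by rw [pow_one]; exact this
      rw [pow_eq_pow_iff_modEq, hxo, ← ZMod.natCast_eq_natCast_iff] at h1
      push_cast at h1
      exact h1.symm
    have hj0 : (j : ZMod (m + 2)) ≠ 0 := by
      intro h0
      rw [h0, zero_pow hr.ne_zero] at hjr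
      exact zero_ne_one hjr
    have hjf := ZMod.pow_card_sub_one_eq_one hj0
    have hj1 : (j : ZMod (m + 2)) = 1 := by
      have h1 := orderOf_dvd_of_pow_eq_one hjr
      have h2 := orderOf_dvd_of_pow_eq_one hjf
      have e : m + 2 - 1 = 2 ^ f := by omega
      rw [e] at h2
      have := Nat.dvd_gcd h1 h2
      rw [Nat.Coprime.gcd_eq_one (Nat.Coprime.pow_right _ ((Nat.coprime_primes hr Nat.prime_two).2 hr2)),
        Nat.dvd_one, orderOf_eq_one_iff] at this
      exact this
    have hcx : c * x = x * c := by
      have : x ^ j = x ^ 1 := by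
        rw [pow_eq_pow_iff_modEq, hxo, ← ZMod.natCast_eq_natCast_iff, hj1]
        simp
      rw [this, pow_one, mul_inv_eq_iff_eq_mul] at hj
      exact hj
    obtain ⟨k, hk⟩ := conj_le_of_pgroup hr (Csub F) (Subgroup.zpowers c)
      (IsPGroup.of_card (n := 1) (by rw [Nat.card_zpowers, hco, pow_one])) (by
        rwa [index_Csub])
    obtain ⟨s, hs⟩ := mem_Csub.1 (hk c (Subgroup.mem_zpowers c))
    have hs1 : s ≠ 1 := by
      rintro rfl
      rw [hh_one, eq_comm, mul_assoc, inv_mul_eq_one, eq_comm, mul_eq_right] at hs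
      rw [hs, orderOf_one] at hco
      exact hr.one_lt.ne hco
    have h1 := diag_of_comm (g := k⁻¹ * x * k) hs1 (by
      rw [hs]
      calc k⁻¹ * x * k * (k⁻¹ * c * k) = k⁻¹ * (x * c) * k := by group
        _ = k⁻¹ * (c * x) * k := by rw [hcx]
        _ = _ := by group)
    have := conj_pow (i := (Nat.card F - 1)) (a := k⁻¹) (b := x)
    rw [inv_inv] at this
    rw [this, mul_assoc, inv_mul_eq_one, eq_comm, mul_eq_right] at h1
    have h2 := Nat.le_of_dvd (by omega) (orderOf_dvd_of_pow_eq_one h1)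
    omega
  · apply index_le_two (by omega)
    rw [h] at hnb
    have hn'e : n' = 2 := by simpa using hnb
    rw [hn'e] at hn'
    by_contra hi
    have : n * (m + 2) * 3 ≤ Nat.card H * H.index := Nat.mul_le_mul hle (by omega)
    rw [hci, hn'] at this
    have : 0 < n * (m + 2) := Nat.mul_pos (by omega) ht.pos
    nlinarith
end SL2c

section Reps

theorem trace_split {G V : Type} [Group G] [Finite G] [AddCommGroup V] [Module ℂ V]
    [FiniteDimensional ℂ V]
    (ρ : Representation ℂ G V) (W : Submodule ℂ V) (hW : ∀ g, ∀ v ∈ W, ρ g v ∈ W) :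
    ∃ (W' : Submodule ℂ V) (hW' : ∀ g, ∀ v ∈ W', ρ g v ∈ W'),
      Module.finrank ℂ W + Module.finrank ℂ W' = Module.finrank ℂ V ∧
      ∀ g, LinearMap.trace ℂ V (ρ g) = LinearMap.trace ℂ W (subRep ρ W hW g) +
        LinearMap.trace ℂ W' (subRep ρ W' hW' g) := by
  obtain ⟨P, hP, hPw⟩ := maschke_proj ρ W hW
  have hc : IsCompl W (LinearMap.ker P) := LinearMap.isCompl_of_proj hPw
  have hW' : ∀ g, ∀ v ∈ LinearMap.ker P, ρ g v ∈ LinearMap.ker P := by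
    intro g v hv
    rw [LinearMap.mem_ker] at hv ⊢
    rw [hP, hv, map_zero]
  refine ⟨LinearMap.ker P, hW', Submodule.finrank_add_eq_of_isCompl hc, fun g => ?_⟩
  let A : Bool → Submodule ℂ V := fun b => if b then W else LinearMap.ker P
  have hA : DirectSum.IsInternal A := by
    rw [DirectSum.isInternal_submodule_iff_isCompl A (i := true) (j := false) (by simp)
      (by ext x; cases x <;> simp)]
    exact hc
  have := LinearMap.trace_eq_sum_trace_restrict hA (f := ρ g) (by
    intro i
    cases i
    · exact fun v hv => hW' g v hv
    · exact fun v hv => hW g v hv)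
  rw [this, Fintype.sum_bool]
  rfl

theorem exists_neg_irr {G : Type} [Group G] [Finite G] (g : G) (n : ℕ) : ∀ {V : Type}
    [AddCommGroup V] [Module ℂ V] [FiniteDimensional ℂ V]
    (ρ : Representation ℂ G V) (_ : (LinearMap.trace ℂ V (ρ g)).re < 0)
    (_ : Module.finrank ℂ V ≤ n),
    ∃ (W : Type) (_ : AddCommGroup W) (_ : Module ℂ W) (_ : FiniteDimensional ℂ W)
      (σ : Representation ℂ G W), Irr σ ∧ (LinearMap.trace ℂ W (σ g)).re < 0 := by
  induction n with
  | zero =>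
    intro V _ _ _ ρ h hn
    have : Subsingleton V := Module.finrank_zero_iff.1 (Nat.le_zero.1 hn)
    have : ρ g = 0 := LinearMap.ext fun v => Subsingleton.elim _ _
    simp [this] at h
  | succ n ih =>
    intro V i1 i2 i3 ρ h hn
    by_cases hI : Irr ρ
    · exact ⟨V, i1, i2, i3, ρ, hI, h⟩
    have hnt : Nontrivial V := by
      by_contra hc
      rw [not_nontrivial_iff_subsingleton] at hc
      have : ρ g = 0 := LinearMap.ext fun v => Subsingleton.elim _ _
      simp [this] at h
    simp only [Irr, hnt, true_and] at hI
    push Not at hI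
    obtain ⟨W, hW, hb, ht⟩ := hI
    obtain ⟨W', hW', hd, htr⟩ := trace_split ρ W hW
    have h1 : Module.finrank ℂ W ≠ 0 := by
      rw [Ne, Submodule.finrank_eq_zero]; exact hb
    have h2 : Module.finrank ℂ W < Module.finrank ℂ V := Submodule.finrank_lt ht
    have h3 := htr g
    rw [h3, Complex.add_re] at h
    by_cases h4 : (LinearMap.trace ℂ W (subRep ρ W hW g)).re < 0
    · exact ih _ h4 (by omega)
    · exact ih (subRep ρ W' hW' g |> fun _ => subRep ρ W' hW') (by linarith) (by omega)

variable {F : Type} [Field F] [Finite F] [CharP F 2] {V : Type} [AddCommGroup V] [Module ℂ V]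
   [FiniteDimensional ℂ V]

def Ufix (ρ : Representation ℂ (S2 F) V) : Submodule ℂ V where
  carrier := {v | ∀ x, ρ (uu x) v = v}
  add_mem' := by intro a b ha hb x; rw [map_add, ha, hb]
  zero_mem' := by intro x; simp
  smul_mem' := by intro c v hv x; rw [map_smul, hv]

theorem trace_invol (T : V →ₗ[ℂ] V) (h : ∀ v, T (T v) = v) : ∃ τ : ℤ, LinearMap.trace ℂ V T = τ := by
  let e : V →ₗ[ℂ] V := (2⁻¹ : ℂ) • (LinearMap.id + T)
  have he : ∀ v, e v = (2⁻¹ : ℂ) • (v + T v) := fun v => rfl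
  have hp : LinearMap.IsProj (LinearMap.range e) e := by
    refine ⟨fun v => ⟨v, rfl⟩, ?_⟩
    rintro _ ⟨v, rfl⟩
    rw [he, he, map_smul, map_add, h, add_comm (T v) v, ← two_smul ℂ (_ • _), smul_smul]
    norm_num
  have h1 := hp.trace
  simp only [e, map_smul, map_add, LinearMap.trace_id, smul_eq_mul] at h1
  refine ⟨2 * Module.finrank ℂ (LinearMap.range e) - Module.finrank ℂ V, ?_⟩
  push_cast
  linear_combination 2 * h1

theorem trace_uu (ρ : Representation ℂ (S2 F) V) {x : F} (hx : x ≠ 0) :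
    LinearMap.trace ℂ V (ρ (uu x)) = LinearMap.trace ℂ V (ρ (uu 1)) := by
  obtain ⟨r, hr⟩ := unit_sq (Units.mk0 x hx)
  have h2 : (r : F) ^ 2 = x := by
    have := congrArg Units.val hr
    simpa using this
  have : uu x = hh r * uu 1 * (hh r)⁻¹ := by
    rw [hh_uu, mul_inv_cancel_right, mul_one, h2]
  rw [this]
  exact Representation.char_conj ρ (uu 1) (hh r)

theorem trace_lemma (ρ : Representation ℂ (S2 F) V) : ∃ τ : ℤ,
    LinearMap.trace ℂ V (ρ (uu 1)) = τ ∧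
    (Module.finrank ℂ V : ℤ) + ((Nat.card F : ℤ) - 1) * τ = Nat.card F * Module.finrank ℂ (Ufix ρ) := by
  classical
  have := Fintype.ofFinite F
  obtain ⟨τ, hτ⟩ := trace_invol (ρ (uu 1)) (fun v => by
    rw [← rho_mul_apply, ← uu_add, CharTwo.add_self_eq_zero, uu_zero]; simp)
  refine ⟨τ, hτ, ?_⟩
  have hq : (Fintype.card F : ℂ) ≠ 0 := by simp
  let e : V →ₗ[ℂ] V := (Fintype.card F : ℂ)⁻¹ • ∑ x : F, ρ (uu x)
  have he : ∀ v, e v = (Fintype.card F : ℂ)⁻¹ • ∑ x : F, ρ (uu x) v := fun v => by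
    simp [e]
  have hp : LinearMap.IsProj (Ufix ρ) e := by
    refine ⟨fun v y => ?_, fun v hv => ?_⟩
    · rw [he, map_smul, map_sum]
      congr 1
      simp_rw [← rho_mul_apply, ← uu_add]
      exact Equiv.sum_comp (Equiv.addLeft y) (fun x => ρ (uu x) v)
    · rw [he, Finset.sum_congr rfl (fun x _ => hv x)]
      rw [Finset.sum_const, Finset.card_univ, ← Nat.cast_smul_eq_nsmul ℂ, smul_smul,
        inv_mul_cancel₀ hq, one_smul]
  have h1 := hp.trace
  simp only [e, map_smul, map_sum, smul_eq_mul] at h1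
  have h2 : ∑ x : F, LinearMap.trace ℂ V (ρ (uu x)) = Module.finrank ℂ V + (Fintype.card F - 1) * τ := by
    rw [← Finset.add_sum_erase _ _ (Finset.mem_univ (0 : F)), uu_zero]
    rw [Finset.sum_congr rfl (fun x hx => (trace_uu ρ (Finset.ne_of_mem_erase hx)).trans hτ)]
    simp
    left; rw [Nat.cast_sub Fintype.card_pos]; simp
  rw [h2, inv_mul_eq_iff_eq_mul₀ hq] at h1
  rw [Nat.card_eq_fintype_card]
  exact_mod_cast h1

theorem span_bound {ρ : Representation ℂ (S2 F) V} (hI : Irr ρ) {v : V} (hv : v ≠ 0)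
    (hu : ∀ x, ρ (uu x) v = v) {c : Fˣ → ℂ} (hc : ∀ s, ρ (hh s) v = c s • v) :
    Module.finrank ℂ V ≤ Nat.card F + 1 := by
  have := Fintype.ofFinite F
  let b : Option F → V := fun o => o.elim v (fun x => ρ (uu x * ww) v)
  let T := Submodule.span ℂ (Set.range b)
  have key : ∀ g, ρ g v ∈ T := by
    intro g
    by_cases h : g 1 0 = 0
    · obtain ⟨s, x, rfl⟩ := borel_form h
      rw [rho_mul_apply, hc, map_smul, hu]
      exact T.smul_mem _ (Submodule.subset_span ⟨none, rfl⟩)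
    · obtain ⟨s, x, y, rfl⟩ := bruhat_form h
      rw [rho_mul_apply, hu, mul_assoc]
      have : hh s * ww = ww * hh s⁻¹ := by rw [ww_hh, inv_inv]
      rw [this, ← mul_assoc, rho_mul_apply, hc, map_smul]
      exact T.smul_mem _ (Submodule.subset_span ⟨some x, rfl⟩)
  have hT : T = ⊤ := by
    refine (hI.2 T (fun g w hw => ?_)).resolve_left (fun h => ?_)
    · induction hw using Submodule.span_induction with
      | mem x hx =>
        obtain ⟨o, rfl⟩ := hx
        cases o with
        | none => exact key g
        | some x =>
          change ρ g (ρ (uu x * ww) v) ∈ T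
          rw [← rho_mul_apply]; exact key _
      | zero => simp
      | add x y _ _ hx hy => rw [map_add]; exact T.add_mem hx hy
      | smul a x _ hx => rw [map_smul]; exact T.smul_mem _ hx
    · have h1 : v ∈ T := Submodule.subset_span ⟨none, rfl⟩
      rw [h] at h1
      exact hv ((Submodule.mem_bot ℂ).1 h1)
  have h1 := finrank_range_le_card (R := ℂ) b
  rw [Set.finrank, show Submodule.span ℂ (Set.range b) = ⊤ from hT, finrank_top] at h1
  rw [Nat.card_eq_fintype_card]
  simpa using h1

theorem Ufix_hh {ρ : Representation ℂ (S2 F) V} (s : Fˣ) {v : V} (hv : v ∈ Ufix ρ) :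
    ρ (hh s) v ∈ Ufix ρ := by
  intro x
  have : uu x * hh s = hh s * uu (((s⁻¹ : Fˣ) : F) ^ 2 * x) := by
    rw [hh_uu, ← mul_assoc, ← mul_pow, Units.mul_inv, one_pow, one_mul]
  rw [← rho_mul_apply, this, rho_mul_apply, hv]

theorem fix_bound {ρ : Representation ℂ (S2 F) V} (hI : Irr ρ) (h : Module.finrank ℂ (Ufix ρ) ≠ 0) :
    Module.finrank ℂ V ≤ Nat.card F + 1 := by
  have hnt : Nontrivial (Ufix ρ) := Module.nontrivial_of_finrank_pos (Nat.pos_of_ne_zero h)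
  let σ : Representation ℂ Fˣ (Ufix ρ) := subRep (ρ.comp (hHom F)) (Ufix ρ) (fun s v hv => Ufix_hh s hv)
  obtain ⟨δ, w, hw, hδ⟩ := comm_char σ ⊤ (fun x _ y _ => mul_comm x y)
  refine span_bound hI (v := w) (fun h => hw (Subtype.ext h)) w.2 (c := fun s => δ ⟨s, trivial⟩)
    (fun s => congrArg Subtype.val (hδ ⟨s, trivial⟩))

/-- cuspidal -/
theorem exists_cuspidal (hq : 3 ≤ Nat.card F) :
    ∃ (W : Type) (_ : AddCommGroup W) (_ : Module ℂ W) (_ : FiniteDimensional ℂ W)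
      (σ : Representation ℂ (S2 F) W), Irr σ ∧ (Nat.card F - 1) ∣ Module.finrank ℂ W := by
  classical
  have := Fintype.ofFinite F
  have := Fintype.ofFinite (S2 F)
  let ρ := transRep (S2 F) ℂ
  let c : S2 F → ℂ := fun _ => 1
  have hc0 : c ≠ 0 := fun h => one_ne_zero (congrFun h 1)
  have hinv : ∀ g, ∀ v ∈ Submodule.span ℂ {c}, ρ g v ∈ Submodule.span ℂ {c} := by
    intro g v hv
    rw [Submodule.mem_span_singleton] at hv ⊢
    obtain ⟨a, rfl⟩ := hv
    exact ⟨a, rfl⟩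
  obtain ⟨W', hW', -, htr⟩ := trace_split ρ _ hinv
  have h1 : LinearMap.trace ℂ _ (ρ (uu 1)) = 0 := by
    rw [LinearMap.trace_eq_matrix_trace ℂ (Pi.basisFun ℂ (S2 F)), Matrix.trace]
    apply Finset.sum_eq_zero
    intro x _
    rw [Matrix.diag_apply, LinearMap.toMatrix_apply]
    simp only [Pi.basisFun_apply, Pi.basisFun_repr, ρ, transRep_apply]
    rw [Pi.single_apply, if_neg]
    intro h
    rw [mul_eq_left] at h
    exact one_ne_zero (uu_inj (h.trans uu_zero.symm))
  have h2 : LinearMap.trace ℂ _ (subRep ρ _ hinv (uu 1)) = 1 := by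
    have : subRep ρ _ hinv (uu 1) = LinearMap.id := by
      ext ⟨v, hv⟩ : 2
      rw [Submodule.mem_span_singleton] at hv
      obtain ⟨a, rfl⟩ := hv
      rfl
    rw [this, LinearMap.trace_id, finrank_span_singleton hc0]; simp
  have h3 := htr (uu 1)
  rw [h1, h2] at h3
  obtain ⟨W, i1, i2, i3, σ, hσ, hneg⟩ := exists_neg_irr (uu 1) _ (subRep ρ W' hW') (by
    rw [show LinearMap.trace ℂ _ (subRep ρ W' hW' (uu 1)) = -1 by linear_combination -h3]
    simp) le_rfl
  refine ⟨W, i1, i2, i3, σ, hσ, ?_⟩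
  obtain ⟨τ, ht1, ht2⟩ := trace_lemma σ
  rw [ht1] at hneg
  have hτ : τ ≤ -1 := by
    have : (τ : ℝ) < 0 := by simpa using hneg
    have : τ < 0 := by exact_mod_cast this
    omega
  have hl : Module.finrank ℂ (Ufix σ) = 0 := by
    by_contra hl
    have h5 : (Module.finrank ℂ W : ℤ) ≤ Nat.card F + 1 := by exact_mod_cast fix_bound hσ hl
    have h6 : (1 : ℤ) ≤ Module.finrank ℂ (Ufix σ) := by exact_mod_cast Nat.pos_of_ne_zero hl
    have h7 : (3 : ℤ) ≤ Nat.card F := by exact_mod_cast hq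
    nlinarith
  rw [hl] at ht2
  have : ((Nat.card F - 1 : ℕ) : ℤ) ∣ Module.finrank ℂ W := by
    rw [Nat.cast_sub (by omega)]
    exact ⟨-τ, by push_cast at ht2 ⊢; linear_combination ht2⟩
  exact_mod_cast this

theorem ker_top {ρ : Representation ℂ (S2 F) V} (h : ∀ x v, ρ (uu x) v = v) (g : S2 F) (v : V) :
    ρ g v = v := by
  have h1 : ∀ x, ρ (uu x) = 1 := fun x => LinearMap.ext (h x)
  have : ρ.ker = ⊤ := by
    apply gen_top
    · exact h1
    · intro x
      have e : ul x = ww * uu x * ww := by rw [ww_uu, mul_assoc, ww_mul_ww, mul_one]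
      rw [MonoidHom.mem_ker, e, map_mul, map_mul, h1, mul_one, ← map_mul, ww_mul_ww, map_one]
  have h2 : g ∈ ρ.ker := by rw [this]; trivial
  rw [MonoidHom.mem_ker.1 h2]; rfl

theorem exists_principal (hq : 3 ≤ Nat.card F) :
    ∃ (W : Type) (_ : AddCommGroup W) (_ : Module ℂ W) (_ : FiniteDimensional ℂ W)
      (σ : Representation ℂ (S2 F) W), Irr σ ∧ Module.finrank ℂ W = Nat.card F + 1 := by
  classical
  have := Fintype.ofFinite F
  obtain ⟨s, hs⟩ := exists_unit_ne hq
  obtain ⟨χ, hχ⟩ := MulChar.exists_apply_ne_one_of_hasEnoughRootsOfUnity F ℂ (a := (s : F))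
    (fun h => hs (Units.ext h))
  let v0 : S2 F → ℂ := fun A => if A 1 0 = 0 then χ (A 0 0) else 0
  obtain ⟨W, i1, i2, i3, σ, P, hσ, hP, hPv⟩ := separation _ (transRep (S2 F) ℂ) v0
    (fun h => by have := congrFun h 1; simp [v0] at this) le_rfl
  refine ⟨W, i1, i2, i3, σ, hσ, ?_⟩
  set v := P v0 with hv
  have hu : ∀ x, σ (uu x) v = v := by
    intro x
    rw [hv, ← hP]
    congr 1
    ext A
    simp [transRep_apply, v0, S2_mul]
  have hh' : ∀ s : Fˣ, σ (hh s) v = χ s • v := by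
    intro s
    rw [hv, ← hP, ← map_smul]
    congr 1
    ext A
    by_cases h : A 1 0 = 0
    · simp [transRep_apply, v0, S2_mul, h, mul_comm]
    · simp [transRep_apply, v0, S2_mul, h]
  have hle := span_bound hσ hPv hu hh'
  set N : W →ₗ[ℂ] W := ∑ x : F, σ (uu x) with hN
  have hNa : ∀ w, N w = ∑ x : F, σ (uu x) w := fun w => by simp [hN]
  have hNu : ∀ y w, N (σ (uu y) w) = N w := by
    intro y w
    rw [hNa, hNa]
    simp_rw [← rho_mul_apply, ← uu_add]
    exact Equiv.sum_comp (Equiv.addRight y) (fun x => σ (uu x) w)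
  have huN : ∀ y w, σ (uu y) (N w) = N w := by
    intro y w
    rw [hNa, map_sum]
    simp_rw [← rho_mul_apply, ← uu_add]
    exact Equiv.sum_comp (Equiv.addLeft y) (fun x => σ (uu x) w)
  set v' := N (σ ww v) with hv'
  have hww : ∀ w, σ ww (σ ww w) = w := fun w => by rw [← rho_mul_apply, ww_mul_ww]; simp
  have hv0 : v' ≠ 0 := by
    intro h0
    have e1 : ∀ x : F, x ≠ 0 → N (σ ww (σ (uu x) (σ ww v))) = 0 := by
      intro x hx
      rw [← rho_mul_apply, ← rho_mul_apply, ← Units.val_mk0 hx, ww_uu_ww, rho_mul_apply, hNu,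
        ← mul_assoc, rho_mul_apply, hu,
        show hh (Units.mk0 x hx)⁻¹ * ww = ww * hh (Units.mk0 x hx) from (ww_hh _).symm,
        rho_mul_apply, hh', map_smul, map_smul, ← hv', h0, smul_zero]
    have e2 : N (σ ww v') = (Fintype.card F : ℂ) • v := by
      rw [hv', hNa (σ ww v), map_sum, map_sum, ← Finset.add_sum_erase _ _ (Finset.mem_univ (0 : F)),
        Finset.sum_eq_zero (fun x hx => e1 x (Finset.ne_of_mem_erase hx)), uu_zero, add_zero]
      rw [map_one, Module.End.one_apply, hww, hNa v, Finset.sum_congr rfl (fun x _ => hu x),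
        Finset.sum_const, Finset.card_univ, ← Nat.cast_smul_eq_nsmul ℂ]
    rw [h0, map_zero, map_zero] at e2
    rcases smul_eq_zero.1 e2.symm with h | h
    · simp at h
    · exact hPv h
  have hh'' : ∀ s : Fˣ, σ (hh s) v' = χ ((s⁻¹ : Fˣ) : F) • v' := by
    intro s
    have : σ (hh s) (N (σ ww v)) = N (σ (hh s) (σ ww v)) := by
      rw [hNa, hNa, map_sum]
      have ex : ∀ x w, σ (hh s) (σ (uu x) w) = σ (uu ((s:F)^2*x)) (σ (hh s) w) := by
        intro x w
        rw [← rho_mul_apply, hh_uu, rho_mul_apply]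
      rw [← Equiv.sum_comp (Units.mulLeft (s ^ 2)) (fun x => σ (uu x) (σ (hh s) (σ ww v)))]
      refine Finset.sum_congr rfl fun x _ => ?_
      rw [ex]; simp
    have e : hh s * ww = ww * hh s⁻¹ := by rw [ww_hh, inv_inv]
    rw [hv', this, ← rho_mul_apply, e, rho_mul_apply, hh', map_smul, map_smul]
  obtain ⟨f, hf, hqf⟩ := card_two_pow F
  have hne : χ s ≠ χ ((s⁻¹ : Fˣ) : F) := by
    intro e
    have h1 : χ s ^ 2 = 1 := by
      rw [sq]; nth_rw 2 [e]
      rw [← map_mul, Units.mul_inv, map_one]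
    have h2 : χ s ^ (Nat.card F - 1) = 1 := by
      rw [← map_pow]
      have := congrArg Units.val (units_pow s)
      rw [Units.val_pow_eq_pow_val] at this
      rw [this]; simp
    have hodd : Nat.card F - 1 = 2 * (2 ^ (f - 1) - 1) + 1 := by
      have : 2 ^ f = 2 * 2 ^ (f - 1) := by rw [← pow_succ']; congr 1; omega
      have : 0 < 2 ^ (f - 1) := by positivity
      omega
    rw [hodd, pow_succ, pow_mul, h1, one_pow, one_mul] at h2
    exact hχ h2
  have hli : LinearIndependent ℂ ![(⟨v, hu⟩ : Ufix σ), ⟨v', fun y => huN y _⟩] := by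
    rw [LinearIndependent.pair_iff]
    intro a b hab
    have hab : a • v + b • v' = 0 := congrArg Subtype.val hab
    have h2 := congrArg (σ (hh s)) hab
    rw [map_add, map_smul, map_smul, hh', hh'', map_zero] at h2
    have h3 : (b * (χ s - χ ((s⁻¹ : Fˣ) : F))) • v' = 0 := by
      have : (b * (χ s - χ ((s⁻¹ : Fˣ) : F))) • v' =
        χ s • (a • v + b • v') - (a • χ s • v + b • χ ((s⁻¹ : Fˣ) : F) • v') := by module
      rw [this, hab, h2]; simp
    have hb : b = 0 := by
      rcases mul_eq_zero.1 ((smul_eq_zero.1 h3).resolve_right hv0) with h | h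
      · exact h
      · exact absurd (sub_eq_zero.1 h) hne
    rw [hb, zero_smul, add_zero] at hab
    exact ⟨(smul_eq_zero.1 hab).resolve_right hPv, hb⟩
  have hl2 := hli.fintype_card_le_finrank
  simp only [Fintype.card_fin] at hl2
  obtain ⟨τ, ht1, ht2⟩ := trace_lemma σ
  have hlt : Module.finrank ℂ (Ufix σ) ≠ Module.finrank ℂ W := by
    intro h
    have h1 := Submodule.eq_top_of_finrank_eq h
    have h2 : ∀ x w, σ (uu x) w = w := fun x w => by
      have : w ∈ Ufix σ := by rw [h1]; trivial
      exact this x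
    have h3 := ker_top h2 (hh s) v
    rw [hh'] at h3
    have : (χ s - 1) • v = 0 := by rw [sub_smul, h3, one_smul, sub_self]
    exact hχ (sub_eq_zero.1 ((smul_eq_zero.1 this).resolve_right hPv))
  have hle2 := Submodule.finrank_le (Ufix σ)
  have hlt' : Module.finrank ℂ (Ufix σ) < Module.finrank ℂ W := lt_of_le_of_ne hle2 hlt
  generalize Module.finrank ℂ (Ufix σ) = l at *
  generalize Module.finrank ℂ W = d at *
  generalize Nat.card F = q at *
  -- d - l = (q-1)(l - τ)
  have e : (d : ℤ) - l = (q - 1) * (l - τ) := by linear_combination ht2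
  have hpos : 0 < (l - τ : ℤ) := by
    by_contra hc
    have : ((q : ℤ) - 1) * (l - τ) ≤ 0 := mul_nonpos_of_nonneg_of_nonpos (by omega) (by omega)
    omega
  have : ((q : ℤ) - 1) * 1 ≤ (q - 1) * (l - τ) := mul_le_mul_of_nonneg_left (by omega) (by omega)
  omega
end Reps

section Ext
variable {E Q W : Type} [Group E] [Group Q] {ι : ℂˣ →* E} {κ : E →* Q}

theorem cyc_comm (hι : ∀ z e, ι z * e = e * ι z) (hk : κ.ker = ι.range) {c : Q} (hc : c ∈ κ.range) :
    ∀ x ∈ (Subgroup.zpowers c).comap κ, ∀ y ∈ (Subgroup.zpowers c).comap κ, x * y = y * x := by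
  obtain ⟨c', hc'⟩ := hc
  have key : ∀ x ∈ (Subgroup.zpowers c).comap κ, ∃ (i : ℤ) (z : ℂˣ), x = ι z * c' ^ i := by
    rintro x ⟨i, hi⟩
    have : x * (c' ^ i)⁻¹ ∈ κ.ker := by
      rw [MonoidHom.mem_ker, map_mul, map_inv, map_zpow, hc']
      dsimp only at hi
      rw [hi, mul_inv_cancel]
    rw [hk] at this
    obtain ⟨z, hz⟩ := this
    exact ⟨i, z, by rw [hz, inv_mul_cancel_right]⟩
  intro x hx y hy
  obtain ⟨i, z, rfl⟩ := key x hx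
  obtain ⟨j, w, rfl⟩ := key y hy
  calc ι z * c' ^ i * (ι w * c' ^ j) = ι z * (c' ^ i * ι w) * c' ^ j := by group
    _ = ι z * ι w * (c' ^ i * c' ^ j) := by rw [← hι]; group
    _ = ι w * ι z * (c' ^ j * c' ^ i) := by rw [hι z (ι w), ← zpow_add, ← zpow_add, add_comm]
    _ = ι w * (ι z * c' ^ j) * c' ^ i := by group
    _ = _ := by rw [hι z]; group

variable {F : Type} [Field F] [Finite F] [CharP F 2] {κ : E →* S2 F}

theorem exists_omega (hι : ∀ z e, ι z * e = e * ι z) (hk : κ.ker = ι.range)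
    (hU : ∀ x, uu x ∈ κ.range) :
    ∃ ω : F → F → ℂˣ, ∀ x y e e', κ e = uu x → κ e' = uu y →
      e * e' = ι (ω x y) * (e' * e) := by
  choose L hL using hU
  have key : ∀ e e', κ e = κ e' → ∃ z, e = ι z * e' := by
    intro e e' h
    have : e * e'⁻¹ ∈ κ.ker := by
      rw [MonoidHom.mem_ker, map_mul, map_inv, h, mul_inv_cancel]
    rw [hk] at this
    obtain ⟨z, hz⟩ := this
    exact ⟨z, by rw [hz, inv_mul_cancel_right]⟩
  have h1 : ∀ x y, ∃ z, L x * L y = ι z * (L y * L x) := by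
    intro x y
    apply key
    rw [map_mul, map_mul, hL, hL, ← uu_add, ← uu_add, add_comm]
  choose ω hω using h1
  refine ⟨ω, fun x y e e' h h' => ?_⟩
  obtain ⟨a, rfl⟩ := key e (L x) (by rw [h, hL])
  obtain ⟨b, rfl⟩ := key e' (L y) (by rw [h', hL])
  calc ι a * L x * (ι b * L y) = ι a * (L x * ι b) * L y := by group
    _ = ι a * ι b * (L x * L y) := by rw [← hι]; group
    _ = ι a * ι b * ι (ω x y) * (L y * L x) := by rw [hω]; group
    _ = ι (ω x y) * ι b * (ι a * L y) * L x := by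
      rw [← map_mul, ← map_mul, ← map_mul, mul_comm a b, mul_comm (b * a)]
      rw [← mul_assoc, map_mul, map_mul]; simp only [map_mul, mul_assoc]
    _ = _ := by rw [hι a]; group

theorem omega_props (hinj : Function.Injective ι) (hι : ∀ z e, ι z * e = e * ι z)
    (hU : ∀ x, uu x ∈ κ.range) {ω : F → F → ℂˣ} (hω : ∀ x y e e', κ e = uu x → κ e' = uu y →
      e * e' = ι (ω x y) * (e' * e)) : (∀ x y y', ω x (y + y') = ω x y * ω x y') ∧
      (∀ x y, ω x y * ω y x = 1) ∧ (∀ s : Fˣ, hh s ∈ κ.range → ∀ x y, ω ((s:F)^2*x) ((s:F)^2*y) = ω x y) := by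
  choose L hL using hU
  refine ⟨fun x y y' => ?_, fun x y => ?_, ?_⟩
  · have h1 := hω x (y + y') (L x) (L y * L y') (hL x) (by rw [map_mul, hL, hL, uu_add])
    apply hinj
    have h2 : L x * (L y * L y') = ι (ω x y * ω x y') * (L y * L y' * L x) := by
      rw [← mul_assoc, hω x y _ _ (hL x) (hL y), mul_assoc, mul_assoc, hω x y' _ _ (hL x) (hL y'),
        ← mul_assoc (L y), ← hι, map_mul]
      simp only [mul_assoc]
    exact mul_right_cancel (h1.symm.trans h2)
  · have h1 := hω x y _ _ (hL x) (hL y)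
    rw [hω y x _ _ (hL y) (hL x), ← mul_assoc, ← map_mul] at h1
    apply hinj
    rw [map_one]
    exact (right_eq_mul.1 h1)
  · rintro s ⟨c, hc⟩ x y
    have e : ∀ x, κ (c * L x * c⁻¹) = uu ((s:F)^2*x) := by
      intro x
      rw [map_mul, map_mul, map_inv, hc, hL, hh_uu, mul_inv_cancel_right]
    have h1 := hω _ _ _ _ (e x) (e y)
    have h2 := hω x y _ _ (hL x) (hL y)
    have h3 : c * L x * c⁻¹ * (c * L y * c⁻¹) = ι (ω x y) * (c * L y * c⁻¹ * (c * L x * c⁻¹)) := by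
      calc _ = c * (L x * L y) * c⁻¹ := by group
        _ = c * ι (ω x y) * (L y * L x) * c⁻¹ := by rw [h2]; group
        _ = _ := by rw [← hι]; group
    apply hinj
    exact mul_right_cancel (h1.symm.trans h3)

theorem omega_trivial (hq : 4 < Nat.card F) {ω : F → F → ℂˣ}
    (h1 : ∀ x y y', ω x (y + y') = ω x y * ω x y') (h2 : ∀ x y, ω x y * ω y x = 1)
    (h3 : ∀ s : Fˣ, ∀ x y, ω ((s:F)^2*x) ((s:F)^2*y) = ω x y) (x y : F) : ω x y = 1 := by
  classical
  have := Fintype.ofFinite F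
  have h0 : ∀ x, ω x 0 = 1 := fun x => by
    have := h1 x 0 0
    rw [add_zero] at this
    exact right_eq_mul.1 this
  have hsq : ∀ x y, ω x y * ω x y = 1 := fun x y => by
    rw [← h1, CharTwo.add_self_eq_zero, h0]
  have hsymm : ∀ x y, ω x y = ω y x := fun x y => by
    exact mul_right_cancel ((h2 x y).trans (hsq y x).symm)
  have hs : ∀ s : F, s ≠ 0 → ∀ x y, ω (s * x) (s * y) = ω x y := by
    intro s hs x y
    obtain ⟨r, hr⟩ := unit_sq (Units.mk0 s hs)
    have e : (r : F) ^ 2 = s := by simpa using congrArg Units.val hr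
    rw [← e]; exact h3 r x y
  have hg : ∀ x y, x ≠ 0 → ω x y = ω 1 (y / x) := by
    intro x y hx
    have := hs x hx 1 (y / x)
    rw [mul_one, mul_div_cancel₀ _ hx] at this
    exact this
  obtain ⟨a, ha⟩ : ∃ a : F, a ≠ 0 ∧ a + 1 ≠ 0 ∧ a ^ 2 + a + 1 ≠ 0 := by
    by_contra hc
    push Not at hc
    let P : Polynomial F := Polynomial.X * (Polynomial.X + 1) * (Polynomial.X ^ 2 + Polynomial.X + 1)
    have hd : P.natDegree = 4 := by simp only [P]; compute_degree!
    have hP : P ≠ 0 := by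
      rintro h; rw [h] at hd; simp at hd
    have h5 : Finset.univ ⊆ P.roots.toFinset := by
      intro b _
      simp only [Multiset.mem_toFinset, Polynomial.mem_roots hP, Polynomial.IsRoot, P]
      simp only [Polynomial.eval_mul, Polynomial.eval_add, Polynomial.eval_pow, Polynomial.eval_X, Polynomial.eval_one]
      by_cases hb : b = 0
      · simp [hb]
      by_cases hb1 : b + 1 = 0
      · simp [hb1]
      · rw [hc b hb hb1, mul_zero]
    have h6 := Finset.card_le_card h5
    have h7 := (Multiset.toFinset_card_le P.roots).trans (Polynomial.card_roots' P)
    rw [Finset.card_univ, ← Nat.card_eq_fintype_card] at h6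
    omega
  obtain ⟨ha0, ha1, ha2⟩ := ha
  have htriv : ∀ y, ω 1 y = 1 := by
    intro y
    let k := (a ^ 2 + a + 1) / (a * (a + 1))
    have hk : k ≠ 0 := div_ne_zero ha2 (mul_ne_zero ha0 ha1)
    have e1 : ω (a + 1) (y / k) = ω a (y / k) * ω 1 (y / k) := by
      rw [hsymm, h1, hsymm _ a, hsymm _ 1]
    rw [hg _ _ ha1, hg _ _ ha0] at e1
    have e2 : y = y / k / (a + 1) + (y / k / a + y / k) := by
      have h22 : (2:F) = 0 := CharTwo.two_eq_zero
      have : y / k / (a + 1) + (y / k / a + y / k) = (y / k) * k + (2 * a) * (y / k) / (a * (a+1)) := by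
        simp only [k]; field_simp; ring
      rw [this, h22, div_mul_cancel₀ _ hk]; simp
    rw [e2, h1, h1, e1, ← h1, ← h1, CharTwo.add_self_eq_zero, h0]
  by_cases hx : x = 0
  · rw [hx, hsymm, h0]
  · rw [hg _ _ hx, htriv]

theorem U_comm_of (hω1 : ∀ x y e e', κ e = uu x → κ e' = uu y → e * e' = e' * e) :
    ∀ x ∈ (Usub F).comap κ, ∀ y ∈ (Usub F).comap κ, x * y = y * x := by
  intro x hx y hy
  obtain ⟨a, ha⟩ := mem_Usub.1 hx
  obtain ⟨b, hb⟩ := mem_Usub.1 hy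
  exact hω1 a b x y ha.symm hb.symm

theorem U_comm_full (hinj : Function.Injective ι) (hι : ∀ z e, ι z * e = e * ι z)
    (hk : κ.ker = ι.range) (hs : κ.range = ⊤) (hq : 4 < Nat.card F) :
    ∀ x ∈ (Usub F).comap κ, ∀ y ∈ (Usub F).comap κ, x * y = y * x := by
  have hU : ∀ x : F, uu x ∈ κ.range := fun x => by rw [hs]; trivial
  obtain ⟨ω, hω⟩ := exists_omega hι hk hU
  obtain ⟨h1, h2, h3⟩ := omega_props hinj hι hU hω
  apply U_comm_of
  intro x y e e' he he'
  rw [hω x y e e' he he', omega_trivial hq h1 h2 (fun s => h3 s (by rw [hs]; trivial)), map_one, one_mul]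

variable [AddCommGroup W] [Module ℂ W] [FiniteDimensional ℂ W]
theorem U_comm_or_even (hinj : Function.Injective ι) (hι : ∀ z e, ι z * e = e * ι z)
    (hk : κ.ker = ι.range) (hU : ∀ x : F, uu x ∈ κ.range) (σ : Representation ℂ E W)
    (hσ : ∀ z w, σ (ι z) w = ((z⁻¹ : ℂˣ) : ℂ) • w) :
    (∀ x ∈ (Usub F).comap κ, ∀ y ∈ (Usub F).comap κ, x * y = y * x) ∨ 2 ∣ Module.finrank ℂ W := by
  by_cases hev : 2 ∣ Module.finrank ℂ W
  · exact Or.inr hev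
  left
  obtain ⟨ω, hω⟩ := exists_omega hι hk hU
  obtain ⟨h1, h2, h3⟩ := omega_props hinj hι hU hω
  have h0 : ∀ x, ω x 0 = 1 := fun x => by
    have := h1 x 0 0
    rw [add_zero] at this
    exact right_eq_mul.1 this
  apply U_comm_of
  intro x y e e' he he'
  have h4 := hω x y e e' he he'
  have hsq : ω x y * ω x y = 1 := by
    rw [← h1, CharTwo.add_self_eq_zero, h0]
  have hd := congrArg (fun g => LinearMap.det (σ g)) h4
  have hd1 : σ (ι (ω x y)) = (((ω x y)⁻¹ : ℂˣ) : ℂ) • LinearMap.id := LinearMap.ext fun w => hσ _ w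
  simp only [map_mul] at hd
  rw [hd1, LinearMap.det_smul, LinearMap.det_id, mul_one, mul_comm (LinearMap.det (σ e))] at hd
  have hu : ∀ g, LinearMap.det (σ g) ≠ 0 := by
    intro g h
    have : LinearMap.det (σ g) * LinearMap.det (σ g⁻¹) = 1 := by
      rw [← map_mul, ← map_mul, mul_inv_cancel, map_one, map_one]
    rw [h, zero_mul] at this
    exact zero_ne_one this
  have hd2 : (((ω x y)⁻¹ : ℂˣ) : ℂ) ^ Module.finrank ℂ W = 1 :=
    (right_eq_mul₀ (mul_ne_zero (hu _) (hu _))).1 hd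
  have hd3 : (ω x y)⁻¹ ^ Module.finrank ℂ W = 1 := by
    apply Units.ext; rw [Units.val_pow_eq_pow_val, hd2]; rfl
  have hd4 : (ω x y) = 1 := by
    obtain ⟨k, hk⟩ := Nat.odd_iff.2 (Nat.two_dvd_ne_zero.1 hev)
    rw [hk, pow_succ, pow_mul, inv_pow, sq, hsq] at hd3
    simpa using hd3
  rw [h4, hd4, map_one, one_mul]
end Ext

section Nonsplit
variable {F : Type} [Field F] [Finite F] [CharP F 2]

theorem frob_range {K : Type} [Field K] [Algebra F K] {x : K} (hx : x ^ Nat.card F = x) :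
    ∃ a : F, algebraMap F K a = x := by
  classical
  have := Fintype.ofFinite F
  have h1 : 1 < Nat.card F := Finite.one_lt_card
  let P : Polynomial K := Polynomial.X ^ Nat.card F - Polynomial.X
  have hP : P ≠ 0 := FiniteField.X_pow_card_sub_X_ne_zero K h1
  have hd : P.natDegree = Nat.card F := FiniteField.X_pow_card_sub_X_natDegree_eq K h1
  have hsub : Finset.univ.image (algebraMap F K) ⊆ P.roots.toFinset := by
    intro y hy
    obtain ⟨a, -, rfl⟩ := Finset.mem_image.1 hy
    simp only [Multiset.mem_toFinset, Polynomial.mem_roots hP, Polynomial.IsRoot, P]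
    simp [← map_pow, Nat.card_eq_fintype_card, FiniteField.pow_card]
  have hcard : P.roots.toFinset.card ≤ (Finset.univ.image (algebraMap F K)).card := by
    rw [Finset.card_image_of_injective _ (algebraMap F K).injective, Finset.card_univ,
      ← Nat.card_eq_fintype_card, ← hd]
    exact (Multiset.toFinset_card_le _).trans (Polynomial.card_roots' P)
  have he := Finset.eq_of_subset_of_card_le hsub hcard
  have : x ∈ P.roots.toFinset := by
    simp only [Multiset.mem_toFinset, Polynomial.mem_roots hP, Polynomial.IsRoot, P]
    rw [Polynomial.eval_sub, Polynomial.eval_pow, Polynomial.eval_X, hx, sub_self]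
  rw [← he] at this
  obtain ⟨a, -, h⟩ := Finset.mem_image.1 this
  exact ⟨a, h⟩

theorem exists_nonsplit (F : Type) [Field F] [Finite F] [CharP F 2] : ∃ g : S2 F, Nat.card F + 1 ∣ orderOf g := by
  obtain ⟨f, hf, hq⟩ := card_two_pow F
  let K := AlgebraicClosure F
  have hK2 : CharP K 2 := charP_of_injective_algebraMap (algebraMap F K).injective 2
  have hne : NeZero ((Nat.card F + 1 : ℕ) : K) := ⟨by
    rw [hq]; push_cast
    rw [CharTwo.two_eq_zero, zero_pow hf]; simp⟩
  obtain ⟨ζ, hζ⟩ := HasEnoughRootsOfUnity.exists_primitiveRoot K (Nat.card F + 1)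
  have hζ0 : ζ ≠ 0 := hζ.ne_zero (by omega)
  have hζq : ζ ^ Nat.card F = ζ⁻¹ := by
    have := hζ.pow_eq_one
    rw [pow_succ] at this
    exact eq_inv_of_mul_eq_one_left this
  obtain ⟨t, ht⟩ := frob_range (F := F) (x := ζ + ζ⁻¹) (by
    have h2 : ∀ a b : K, (a + b) ^ Nat.card F = a ^ Nat.card F + b ^ Nat.card F := by
      intro a b
      rw [hq]
      exact add_pow_char_pow a b 2 f
    rw [h2, inv_pow, hζq, inv_inv, add_comm])
  have h2 : (1 : F) + 1 = 0 := CharTwo.add_self_eq_zero 1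
  let g : S2 F := ⟨!![0, 1; 1, t], by
    rw [Matrix.det_fin_two_of]
    linear_combination -h2⟩
  refine ⟨g, ?_⟩
  have hpow : ∀ n, algebraMap F K ((g ^ n : S2 F) 0 0) + algebraMap F K ((g ^ n : S2 F) 0 1) * ζ = ζ ^ n ∧
     algebraMap F K ((g ^ n : S2 F) 1 0) + algebraMap F K ((g ^ n : S2 F) 1 1) * ζ = ζ ^ (n + 1) := by
    intro n
    induction n with
    | zero => simp
    | succ n ih =>
      obtain ⟨h1, h2⟩ := ih
      have e00 : g 0 0 = 0 := rfl
      have e01 : g 0 1 = 1 := rfl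
      have e10 : g 1 0 = 1 := rfl
      have e11 : g 1 1 = t := rfl
      have h3 : ζ * ζ⁻¹ = 1 := mul_inv_cancel₀ hζ0
      have h4 : (1 : K) + 1 = 0 := CharTwo.add_self_eq_zero 1
      rw [pow_succ' g]
      simp only [S2_mul, e00, e01, e10, e11, map_add, map_mul, ht, map_zero, map_one]
      constructor
      · linear_combination h2
      · linear_combination h1 + (ζ + ζ⁻¹) * h2 + ζ^n * h3 + ζ^n * h4
  apply hζ.dvd_of_pow_eq_one
  have := (hpow (orderOf g)).1
  rw [← this, pow_orderOf_eq_one]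
  simp
end Nonsplit

section Split
variable {F : Type} [Field F] [Finite F] [CharP F 2]

theorem relIndex_mul_card' {G : Type} [Group G] (A H : Subgroup G) (h : A ≤ H) :
    A.relIndex H * Nat.card A = Nat.card H := by
  have := (A.subgroupOf H).index_mul_card
  rwa [Nat.card_congr (Subgroup.subgroupOfEquivOfLe h).toEquiv] at this

theorem index_Usub : (Usub F).index = (Nat.card F + 1) * (Nat.card F - 1) := by
  have h1 := (Usub F).card_mul_index
  rw [card_Usub, card_S2', mul_assoc] at h1
  exact Nat.eq_of_mul_eq_mul_left Nat.card_pos h1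

theorem Csub_gen (F : Type) [Field F] [Finite F] [CharP F 2] : ∃ s : Fˣ, Csub F = Subgroup.zpowers (hh s) := by
  obtain ⟨s, hs⟩ := IsCyclic.exists_generator (α := Fˣ)
  refine ⟨s, ?_⟩
  have : hh s = hHom F s := rfl
  rw [this, ← MonoidHom.map_zpowers]
  have h2 : Subgroup.zpowers s = ⊤ := by
    rw [eq_top_iff]; intro x _; exact hs x
  rw [h2, ← MonoidHom.range_eq_map]; rfl

variable {E W : Type} [Group E] {ι : ℂˣ →* E} {κ : E →* S2 F} [AddCommGroup W] [Module ℂ W] [FiniteDimensional ℂ W]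

theorem split_sub [Nontrivial W] (σ : Representation ℂ E W) (hι : ∀ z e, ι z * e = e * ι z)
    (hk : κ.ker = ι.range)  (hσ : ∀ z w, σ (ι z) w = ((z⁻¹ : ℂˣ) : ℂ) • w)
    (A : Subgroup (S2 F)) (hA : ∀ x ∈ A.comap κ, ∀ y ∈ A.comap κ, x * y = y * x) :
    ∃ δ : E →* ℂˣ, ∀ z, δ (ι z) = z ^ (A.relIndex κ.range) := by
  have hi : (A.comap κ).index = A.relIndex κ.range := Subgroup.index_comap A κ
  have : (A.comap κ).FiniteIndex := ⟨by rw [hi]; exact Subgroup.index_ne_zero_of_finite⟩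
  rw [← hi]
  refine split_of_comm σ ι hι hσ _ hA ?_
  rintro _ ⟨z, rfl⟩
  have : ι z ∈ κ.ker := by rw [hk]; exact ⟨z, rfl⟩
  rw [MonoidHom.mem_ker] at this
  change κ (ι z) ∈ A
  rw [this]; exact A.one_mem

theorem split_full [Nontrivial W] (σ : Representation ℂ E W) (hinj : Function.Injective ι) (hι : ∀ z e, ι z * e = e * ι z)
    (hk : κ.ker = ι.range)  (hσ : ∀ z w, σ (ι z) w = ((z⁻¹ : ℂˣ) : ℂ) • w)
    (hs : κ.range = ⊤) (hq : 4 < Nat.card F) : ∃ δ : E →* ℂˣ, ∀ z, δ (ι z) = z := by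
  have h1 := split_sub σ hι hk hσ _ (U_comm_full hinj hι hk hs hq)
  obtain ⟨s, hC⟩ := Csub_gen F
  have h2 := split_sub σ hι hk hσ _ (cyc_comm hι hk (c := hh s) (by rw [hs]; trivial))
  obtain ⟨g, hg⟩ := exists_nonsplit F
  have h3 := split_sub σ hι hk hσ _ (cyc_comm hι hk (c := g) (by rw [hs]; trivial))
  rw [hs, Subgroup.relIndex_top_right, index_Usub] at h1
  rw [hs, Subgroup.relIndex_top_right, ← hC, index_Csub] at h2
  rw [hs, Subgroup.relIndex_top_right] at h3
  have h4 := split_gcd h1 (split_gcd h2 h3)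
  have h5 : Nat.gcd ((Nat.card F + 1) * (Nat.card F - 1))
    (Nat.gcd (Nat.card F * (Nat.card F + 1)) (Subgroup.zpowers g).index) = 1 := by
    have hi := (Subgroup.zpowers g).card_mul_index
    rw [Nat.card_zpowers, card_S2'] at hi
    obtain ⟨k, hk⟩ := hg
    rw [hk] at hi
    have hi2 : (Subgroup.zpowers g).index ∣ Nat.card F * (Nat.card F - 1) := by
      refine ⟨k, ?_⟩
      apply Nat.eq_of_mul_eq_mul_left (Nat.succ_pos (Nat.card F))
      rw [Nat.succ_eq_add_one]
      linarith
    obtain ⟨f, hf, hqf⟩ := card_two_pow F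
    generalize (Subgroup.zpowers g).index = n at *
    by_contra hne
    obtain ⟨r, hr, hrd⟩ := Nat.exists_prime_and_dvd hne
    have d1 := hrd.trans (Nat.gcd_dvd_left _ _)
    have d2 := (hrd.trans (Nat.gcd_dvd_right _ _)).trans (Nat.gcd_dvd_left _ _)
    have d3 := ((hrd.trans (Nat.gcd_dvd_right _ _)).trans (Nat.gcd_dvd_right _ _)).trans hi2
    have hnq : r ∣ Nat.card F → False := by
      intro h
      rcases (Nat.Prime.dvd_mul hr).1 d1 with h' | h'
      · have := (Nat.dvd_add_right h).1 h'
        exact hr.one_lt.ne' (Nat.dvd_one.1 this)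
      · have := (Nat.dvd_sub h h')
        rw [Nat.sub_sub_self (by omega)] at this
        exact hr.one_lt.ne' (Nat.dvd_one.1 this)
    have d4 := ((Nat.Prime.dvd_mul hr).1 d2).resolve_left hnq
    have d5 := ((Nat.Prime.dvd_mul hr).1 d3).resolve_left hnq
    exact (odd_facts hr hf hqf d4).1 (Dvd.dvd.mul_left d5 2)
  rw [h5] at h4
  simpa using h4

theorem card_borel {H : Subgroup (S2 F)} (hU : ∀ x, uu x ∈ H) (hB : ∀ g ∈ H, g 1 0 = 0) :
    Nat.card H = Nat.card F * Nat.card (H.comap (hHom F)) := by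
  rw [← Nat.card_prod]
  symm
  refine Nat.card_congr (Equiv.ofBijective (fun p : F × H.comap (hHom F) =>
    (⟨uu p.1 * hh p.2.1, H.mul_mem (hU _) p.2.2⟩ : H)) ⟨?_, ?_⟩)
  · rintro ⟨x, s, hs⟩ ⟨y, r, hr⟩ h
    have h := congrArg Subtype.val h
    dsimp only at h
    have e1 : s = r := by
      have := congrArg (fun A : S2 F => A 1 1) h
      simp [S2_mul] at this
      exact Units.ext this
    subst e1
    have e2 := mul_right_cancel h
    rw [uu_inj e2]
  · rintro ⟨g, hg⟩
    obtain ⟨s, x, rfl⟩ := borel_form (hB g hg)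
    refine ⟨⟨x, s, ?_⟩, rfl⟩
    exact (H.mul_mem_cancel_left (hU x)).1 hg

theorem split_borel [Nontrivial W] (σ : Representation ℂ E W) (hι : ∀ z e, ι z * e = e * ι z)
    (hk : κ.ker = ι.range)  (hσ : ∀ z w, σ (ι z) w = ((z⁻¹ : ℂˣ) : ℂ) • w)
    (hU : ∀ x, uu x ∈ κ.range) (hB : ∀ g ∈ κ.range, g 1 0 = 0) 
    (hc : ∀ x ∈ (Usub F).comap κ, ∀ y ∈ (Usub F).comap κ, x * y = y * x) : 
    ∃ δ : E →* ℂˣ, ∀ z, δ (ι z) = z := by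
  have h1 := split_sub σ hι hk hσ _ hc
  obtain ⟨s, hs⟩ := IsCyclic.exists_generator (α := κ.range.comap (hHom F))
  have hs2 : (s : Fˣ) ∈ κ.range.comap (hHom F) := s.2
  have hcd := card_borel hU hB
  have ho : orderOf (hh (s : Fˣ)) = Nat.card (κ.range.comap (hHom F)) := by
    rw [show hh (s : Fˣ) = hHom F s from rfl, orderOf_injective (hHom F) (fun _ _ h => hh_inj h),
      Subgroup.orderOf_coe, orderOf_eq_card_of_forall_mem_zpowers hs]
  have h2 := split_sub σ hι hk hσ _ (cyc_comm hι hk (c := hh (s : Fˣ)) hs2)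
  have i1 : (Usub F).relIndex κ.range = Nat.card (κ.range.comap (hHom F)) := by
    have := relIndex_mul_card' (Usub F) κ.range (by
      intro g hg; obtain ⟨x, rfl⟩ := mem_Usub.1 hg; exact hU x)
    rw [card_Usub, hcd, mul_comm] at this
    exact Nat.eq_of_mul_eq_mul_left Nat.card_pos this
  have i2 : (Subgroup.zpowers (hh (s : Fˣ))).relIndex κ.range = Nat.card F := by
    have := relIndex_mul_card' (Subgroup.zpowers (hh (s : Fˣ))) κ.range (by
      rw [Subgroup.zpowers_le]; exact hs2)
    rw [Nat.card_zpowers, ho, hcd] at this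
    exact Nat.eq_of_mul_eq_mul_right Nat.card_pos this
  rw [i1] at h1
  rw [i2] at h2
  have h4 := split_gcd h1 h2
  have h5 : Nat.gcd (Nat.card (κ.range.comap (hHom F))) (Nat.card F) = 1 := by
    have d : Nat.card (κ.range.comap (hHom F)) ∣ Nat.card F - 1 := by
      rw [← Nat.card_units]; exact Subgroup.card_subgroup_dvd_card _
    have : Nat.Coprime (Nat.card F - 1) (Nat.card F) := by
      have hq : 0 < Nat.card F := Nat.card_pos
      rw [Nat.coprime_comm]
      exact (Nat.coprime_self_sub_right hq).2 (Nat.coprime_one_right _)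
    exact Nat.Coprime.coprime_dvd_left d this
  rw [h5] at h4
  simpa using h4

theorem borel_dim {H : Subgroup (S2 F)} (hU : ∀ x, uu x ∈ H) (hB : ∀ g ∈ H, g 1 0 = 0)
    {τ : Representation ℂ H W} (hτ : Irr τ) (hne : ∃ x w, τ ⟨uu x, hU x⟩ w ≠ w) :
    Nat.card H ∣ Nat.card F * Module.finrank ℂ W := by
  classical
  have := Fintype.ofFinite F
  let u : F → H := fun x => ⟨uu x, hU x⟩
  have hu : ∀ x y, u x * u y = u (x + y) := fun x y => Subtype.ext (uu_add x y).symm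
  have hnorm : ∀ (g : H) x, ∃ y, u x * g = g * u y := by
    rintro ⟨g, hg⟩ x
    obtain ⟨s, z, rfl⟩ := borel_form (hB g hg)
    refine ⟨((s⁻¹ : Fˣ) : F) ^ 2 * x, ?_⟩
    apply Subtype.ext
    change uu x * (uu z * hh s) = uu z * hh s * uu _
    rw [mul_assoc, hh_uu, ← mul_assoc, ← mul_assoc, ← uu_add, ← uu_add, add_comm x z]
    simp [← mul_assoc, ← mul_pow]
  let X : Submodule ℂ W :=
    { carrier := {v | ∀ x, τ (u x) v = v}
      add_mem' := by intro a b ha hb x; rw [map_add, ha, hb]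
      zero_mem' := by intro x; simp
      smul_mem' := by intro c v hv x; rw [map_smul, hv] }
  have hX : X = ⊥ := by
    refine (hτ.2 X ?_).resolve_right ?_
    · intro g v hv x
      obtain ⟨y, hy⟩ := hnorm g x
      rw [← rho_mul_apply, hy, rho_mul_apply, hv]
    · intro h
      obtain ⟨x, w, hw⟩ := hne
      have : w ∈ X := by rw [h]; trivial
      exact hw (this x)
  have hsum : ∑ x : F, τ (u x) = 0 := by
    refine LinearMap.ext fun v => ?_
    have : (∑ x : F, τ (u x)) v ∈ X := by
      intro y
      simp only [LinearMap.sum_apply, map_sum]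
      simp_rw [← rho_mul_apply, hu]
      exact Equiv.sum_comp (Equiv.addLeft y) (fun x => τ (u x) v)
    rw [hX] at this
    simpa using this
  let K := H.comap (hHom F)
  let c : K →* H := { toFun := fun s => ⟨hh s.1, s.2⟩, map_one' := Subtype.ext hh_one, map_mul' := fun a b => Subtype.ext (hh_mul _ _) }
  have htr : ∀ s : K, s ≠ 1 → LinearMap.trace ℂ W (τ (c s)) = 0 := by
    intro s hs
    have hconj : ∀ x, LinearMap.trace ℂ W (τ (c s * u x)) = LinearMap.trace ℂ W (τ (c s)) := by
      intro x
      have hs2 : ((s : Fˣ) : F) ^ 2 + 1 ≠ 0 := by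
        intro h
        have h3 : (((s : Fˣ) : F) + 1) ^ 2 = 0 := by rw [CharTwo.add_sq, one_pow, h]
        have h4 : ((s : Fˣ) : F) + 1 = 0 := by simpa using h3
        apply hs
        apply Subtype.ext; apply Units.ext
        exact CharTwo.add_eq_zero.1 h4
      have : c s * u x = u (((s : Fˣ) : F) ^ 2 * x / (((s : Fˣ) : F) ^ 2 + 1)) * c s * (u (((s : Fˣ) : F) ^ 2 * x / (((s : Fˣ) : F) ^ 2 + 1)))⁻¹ := by
        rw [eq_mul_inv_iff_mul_eq]
        apply Subtype.ext
        change hh s.1 * uu x * uu _ = uu _ * hh s.1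
        rw [mul_assoc, ← uu_add, hh_uu]
        congr 2
        have h22 : (2:F) = 0 := CharTwo.two_eq_zero
        field_simp
        linear_combination x * (((s : Fˣ) : F) ^ 2) * h22
      rw [this]
      exact Representation.char_conj τ _ _
    have h1 : ∑ x : F, LinearMap.trace ℂ W (τ (c s * u x)) = 0 := by
      simp_rw [map_mul]
      rw [← map_sum, ← Finset.mul_sum, hsum, mul_zero, map_zero]
    rw [Finset.sum_congr rfl (fun x _ => hconj x), Finset.sum_const, Finset.card_univ] at h1
    simpa using h1
  have := Fintype.ofFinite K
  have hK : (Fintype.card K : ℂ) ≠ 0 := by simp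
  let Y : Submodule ℂ W :=
    { carrier := {v | ∀ x, τ (c x) v = v}
      add_mem' := by intro a b ha hb x; rw [map_add, ha, hb]
      zero_mem' := by intro x; simp
      smul_mem' := by intro c v hv x; rw [map_smul, hv] }
  let e : W →ₗ[ℂ] W := (Fintype.card K : ℂ)⁻¹ • ∑ x : K, τ (c x)
  have he : ∀ v, e v = (Fintype.card K : ℂ)⁻¹ • ∑ x : K, τ (c x) v := fun v => by
    simp [e]
  have hp : LinearMap.IsProj Y e := by
    refine ⟨fun v y => ?_, fun v hv => ?_⟩
    · rw [he, map_smul, map_sum]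
      congr 1
      simp_rw [← rho_mul_apply, ← map_mul c]
      exact Equiv.sum_comp (Equiv.mulLeft y) (fun x => τ (c x) v)
    · rw [he, Finset.sum_congr rfl (fun x _ => hv x)]
      rw [Finset.sum_const, Finset.card_univ, ← Nat.cast_smul_eq_nsmul ℂ, smul_smul,
        inv_mul_cancel₀ hK, one_smul]
  have h1 := hp.trace
  simp only [e, map_smul, map_sum, smul_eq_mul] at h1
  rw [← Finset.add_sum_erase _ _ (Finset.mem_univ (1 : K)),
    Finset.sum_eq_zero (fun s hs => htr s (Finset.ne_of_mem_erase hs)), map_one, map_one, add_zero,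
    inv_mul_eq_iff_eq_mul₀ hK, LinearMap.trace_one] at h1
  rw [card_borel hU hB, Nat.card_eq_fintype_card (α := K)]
  refine mul_dvd_mul_left _ ⟨Module.finrank ℂ Y, ?_⟩
  exact_mod_cast h1
end Split

section Main
variable {F : Type} [Field F] [Finite F] [CharP F 2]
  {M Θ : Type} [Group M] [Finite M] [AddCommGroup Θ] [Module ℂ Θ] [FiniteDimensional ℂ Θ]
  {N : Subgroup M} [N.Normal] {θ : Representation ℂ N Θ}

theorem inv_case (hθ : Irr θ) (π : M →* S2 F) (hπ : Function.Surjective π) (hker : π.ker = N)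
    (hT : (Iner N θ).map π = ⊤) (hq : 4 < Nat.card F) {X : Type} [AddCommGroup X] [Module ℂ X]
    [FiniteDimensional ℂ X] {τ : Representation ℂ (S2 F) X} (hτ : Irr τ) :
    Module.finrank ℂ Θ * Module.finrank ℂ X ∈ charDegrees M := by
  have := hθ.1
  obtain ⟨V, _, _, _, ρ, hρ, h0⟩ := exists_over N hθ
  have hI : Iner N θ = ⊤ := by
    have h1 := index_iner (θ := θ) π hπ hker
    rw [hT, Subgroup.index_top] at h1
    exact Subgroup.index_eq_one.1 h1.symm
  have hnt : Nontrivial (homN N θ ρ) := (Submodule.nontrivial_iff_ne_bot).2 h0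
  obtain ⟨δ, hδ⟩ := split_full (extRep N θ ρ) (ι := iotaE N θ) (κ := kap N θ π hker) iotaE_injective
    iotaE_central (kap_ker hθ π hker) extRep_iota (by rw [kap_range, hT]) hq
  exact gallagher hθ hI δ hδ π hπ hker hτ

theorem index_borel {H : Subgroup (S2 F)} (hU : ∀ x, uu x ∈ H) (hB : ∀ g ∈ H, g 1 0 = 0) :
    Nat.card F + 1 ∣ H.index := by
  have h1 := H.card_mul_index
  have hd : Nat.card (H.comap (hHom F)) ∣ Nat.card F - 1 := by
    rw [← Nat.card_units]; exact Subgroup.card_subgroup_dvd_card _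
  obtain ⟨k, hk⟩ := hd
  rw [card_S2', card_borel hU hB, hk] at h1
  refine ⟨k, ?_⟩
  have hp : 0 < Nat.card F * Nat.card (H.comap (hHom F)) := Nat.mul_pos Nat.card_pos Nat.card_pos
  apply Nat.eq_of_mul_eq_mul_left hp
  linarith

theorem borel_case (hθ : Irr θ) (π : M →* S2 F) (hπ : Function.Surjective π) (hker : π.ker = N)
    (hU : ∀ x, uu x ∈ (Iner N θ).map π) (hB : ∀ g ∈ (Iner N θ).map π, g 1 0 = 0) :
    ∃ n ∈ charDegrees M, 2 * (Nat.card F + 1) ∣ n ∨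
      (Module.finrank ℂ Θ * ((Nat.card F + 1) * (Nat.card F - 1))) ∣ n := by
  have := hθ.1
  obtain ⟨V, _, _, _, ρ, hρ, h0⟩ := exists_over N hθ
  have hr : (kap N θ π hker).range = (Iner N θ).map π := kap_range π hker
  have hU' : ∀ x, uu x ∈ (kap N θ π hker).range := by rw [hr]; exact hU
  have hB' : ∀ g ∈ (kap N θ π hker).range, g 1 0 = 0 := by rw [hr]; exact hB
  have hnt : Nontrivial (homN N θ ρ) := (Submodule.nontrivial_iff_ne_bot).2 h0
  rcases U_comm_or_even (iotaE_injective (N := N) (θ := θ)) iotaE_central (kap_ker hθ π hker) hU' (extRep N θ ρ) extRep_iota with hc | hev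
  swap
  · refine ⟨_, mem_charDegrees_of_irr hρ, Or.inl ?_⟩
    rw [dim_over hθ hρ h0, ← index_iner π hπ hker, mul_comm 2]
    exact mul_dvd_mul (Dvd.dvd.mul_right (index_borel hU hB) _) hev
  obtain ⟨δ, hδ⟩ := split_borel (extRep N θ ρ) (ι := iotaE N θ) (κ := kap N θ π hker) 
    iotaE_central (kap_ker hθ π hker) extRep_iota hU' hB' hc
  clear hρ h0 hnt hc 
  -- choose a good V
  obtain ⟨e0, he0⟩ := hU' 1
  obtain ⟨x0, rfl⟩ := QuotientGroup.mk_surjective e0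
  obtain ⟨a, ha⟩ := exists_ne (0 : Θ)
  let φ : homN N θ (transRep M Θ) := ⟨indMap N θ, indMap_mem N θ⟩
  let ψ : homN N θ (transRep M Θ) := (δ (QuotientGroup.mk x0) : ℂ) • extRep N θ (transRep M Θ) (QuotientGroup.mk x0) φ - φ
  have hx0 : x0.1.1 ∉ N := by
    intro h
    rw [kap_mk] at he0
    have : π x0.1.1 = 1 := MonoidHom.mem_ker.1 (hker.symm.le h)
    rw [this] at he0
    have := congrArg (fun A : S2 F => A 0 1) he0
    simp at this
  have hψ : (ψ : Θ →ₗ[ℂ] (M → Θ)) a ≠ 0 := by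
    intro h
    have h1 := congrFun h 1
    have h2 : (ψ : Θ →ₗ[ℂ] (M → Θ)) a 1 = - a := by
      have e1 : (ψ : Θ →ₗ[ℂ] (M → Θ)) a 1 = (δ (QuotientGroup.mk x0) : ℂ) •
        (indMap N θ (x0.1.2⁻¹.1 a) (1 * x0.1.1)) - indMap N θ a 1 := rfl
      rw [e1, indMap_one, one_mul]
      have e2 : ∀ b, indMap N θ b x0.1.1 = 0 := fun b => dif_neg hx0
      rw [e2, smul_zero, zero_sub]
    rw [h2] at h1
    exact ha (neg_eq_zero.1 h1)
  obtain ⟨V, _, _, _, ρ, P, hρ, hP, hPψ⟩ := separation _ (transRep M Θ) _ hψ le_rfl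
  have h0 : homN N θ ρ ≠ ⊥ := by
    intro h
    have := homN_comp hP ψ.2
    rw [h, Submodule.mem_bot] at this
    exact hPψ (LinearMap.congr_fun this a)
  have hnt : Nontrivial (homN N θ ρ) := (Submodule.nontrivial_iff_ne_bot).2 h0
  let Ψ : ExtG N θ →* Module.End ℂ (homN N θ ρ) :=
    { toFun := fun e => (δ e : ℂ) • extRep N θ ρ e
      map_one' := by simp
      map_mul' := by
        intro x y
        refine LinearMap.ext fun w => ?_
        simp [smul_smul, mul_comm] }
  have hΨ : ∀ e w, Ψ e w = (δ e : ℂ) • extRep N θ ρ e w := fun e w => rfl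
  obtain ⟨τ, hτ⟩ := lift_surj (kap N θ π hker).rangeRestrict
    (kap N θ π hker).rangeRestrict_surjective Ψ (by
      intro x hx
      have : x ∈ (kap N θ π hker).ker := congrArg Subtype.val hx
      rw [kap_ker hθ π hker] at this
      obtain ⟨z, rfl⟩ := this
      refine LinearMap.ext fun w => ?_
      rw [hΨ, hδ, extRep_iota, smul_smul]
      simp)
  have hI := extRep_irr hθ hρ h0
  have hτI : Irr τ := by
    refine ⟨hnt, fun X hX => hI.2 X fun g v hv => ?_⟩
    have h2 := hX ((kap N θ π hker).rangeRestrict g) v hv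
    rw [hτ, hΨ] at h2
    have h3 := X.smul_mem (((δ g)⁻¹ : ℂˣ) : ℂ) h2
    rw [smul_smul] at h3
    simpa using h3
  have hdim := borel_dim hU' hB' hτI (by
    refine ⟨1, ⟨P ∘ₗ indMap N θ, homN_comp hP φ.2⟩, ?_⟩
    have e1 : (⟨uu 1, hU' 1⟩ : (kap N θ π hker).range) = (kap N θ π hker).rangeRestrict (QuotientGroup.mk x0) :=
      Subtype.ext he0.symm
    rw [e1, hτ, hΨ]
    intro h
    have h2 := congrArg (fun w : homN N θ ρ => (w : Θ →ₗ[ℂ] V) a) h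
    apply hPψ
    have e2 : (ψ : Θ →ₗ[ℂ] (M → Θ)) a = (δ (QuotientGroup.mk x0) : ℂ) •
        (transRep M Θ x0.1.1 (indMap N θ (x0.1.2⁻¹.1 a))) - indMap N θ a := rfl
    rw [e2, map_sub, map_smul, hP, sub_eq_zero]
    exact h2)
  refine ⟨_, mem_charDegrees_of_irr hρ, Or.inr ?_⟩
  rw [dim_over hθ hρ h0, ← index_iner π hπ hker]
  rw [hr] at hdim
  generalize (Iner N θ).map π = H at *
  have hi := H.card_mul_index
  rw [card_S2'] at hi
  obtain ⟨k, hk⟩ := hdim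
  have : (Nat.card F + 1) * (Nat.card F - 1) ∣ H.index * Module.finrank ℂ (homN N θ ρ) := by
    refine ⟨k, ?_⟩
    have hp : 0 < Nat.card F := Nat.card_pos
    apply Nat.eq_of_mul_eq_mul_left hp
    calc _ = H.index * (Nat.card F * Module.finrank ℂ (homN N θ ρ)) := by ring
      _ = (Nat.card H * H.index) * k := by rw [hk]; ring
      _ = _ := by rw [hi]; ring
  calc _ ∣ Module.finrank ℂ Θ * (H.index * Module.finrank ℂ (homN N θ ρ)) := mul_dvd_mul_left _ this
    _ = _ := by ring

theorem map_conj (π : M →* S2 F) (k : S2 F) (I : Subgroup M) :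
    I.map ((MulAut.conj k).toMonoidHom.comp π) = cj k (I.map π) := by
  rw [cj, Subgroup.map_map]

theorem main_case1 (hθ : Irr θ) (π : M →* S2 F) (hπ : Function.Surjective π) (hker : π.ker = N)
    {t : ℕ} (ht : t.Prime) (hqt : Nat.card F - 1 = t) (h4 : 4 < Nat.card F) :
    ∃ n ∈ charDegrees M, 2 * t ∣ n ∨
      (Module.finrank ℂ Θ ∣ n ∧ ∀ r : ℕ, r.Prime → r ∣ Nat.card F + 1 → r ∣ n) := by
  obtain ⟨V, _, _, _, ρ, hρ, h0⟩ := exists_over N hθ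
  have hd := dim_over hθ hρ h0
  rw [← index_iner π hπ hker] at hd
  by_cases h2t : 2 * t ∣ ((Iner N θ).map π).index
  · refine ⟨_, mem_charDegrees_of_irr hρ, Or.inl ?_⟩
    rw [hd, mul_assoc]
    exact Dvd.dvd.mul_right h2t _
  by_cases hr : ∃ r : ℕ, r.Prime ∧ r ∣ Nat.card F + 1 ∧ ¬ r ∣ ((Iner N θ).map π).index
  · obtain ⟨r, hr, h1, h2⟩ := hr
    have hT := subgroup_case1 ht hqt (by omega) _ hr h1 h2 h2t
    obtain ⟨X, _, _, _, τ, hτ, hX⟩ := exists_principal (F := F) (by omega)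
    refine ⟨_, inv_case hθ π hπ hker hT h4 hτ, Or.inr ⟨Dvd.intro _ rfl, fun r _ h => ?_⟩⟩
    rw [hX]; exact Dvd.dvd.mul_left h _
  · push Not at hr
    refine ⟨_, mem_charDegrees_of_irr hρ, Or.inr ?_⟩
    rw [hd]
    refine ⟨⟨((Iner N θ).map π).index * Module.finrank ℂ (homN N θ ρ), by ring⟩, fun r h1 h2 => ?_⟩
    rw [mul_assoc]; exact Dvd.dvd.mul_right (hr r h1 h2) _

theorem main_case2 (hθ : Irr θ) (π : M →* S2 F) (hπ : Function.Surjective π) (hker : π.ker = N)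
    {t : ℕ} (ht : t.Prime) (hqt : Nat.card F + 1 = t) (h4 : 4 < Nat.card F) :
    ∃ n ∈ charDegrees M, 2 * t ∣ n ∨
      (Module.finrank ℂ Θ ∣ n ∧ ∀ r : ℕ, r.Prime → r ∣ Nat.card F - 1 → r ∣ n) := by
  obtain ⟨V, _, _, _, ρ, hρ, h0⟩ := exists_over N hθ
  have hd := dim_over hθ hρ h0
  rw [← index_iner π hπ hker] at hd
  by_cases h2t : 2 * t ∣ ((Iner N θ).map π).index
  · refine ⟨_, mem_charDegrees_of_irr hρ, Or.inl ?_⟩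
    rw [hd, mul_assoc]
    exact Dvd.dvd.mul_right h2t _
  by_cases hr : ∃ r : ℕ, r.Prime ∧ r ∣ Nat.card F - 1 ∧ ¬ r ∣ ((Iner N θ).map π).index
  · obtain ⟨r, hr, h1, h2⟩ := hr
    rcases subgroup_case2 ht hqt (by omega) _ hr h1 h2 h2t with hT | ⟨k, hk1, hk2⟩
    · obtain ⟨X, _, _, _, τ, hτ, hX⟩ := exists_cuspidal (F := F) (by omega)
      refine ⟨_, inv_case hθ π hπ hker hT h4 hτ, Or.inr ⟨Dvd.intro _ rfl, fun r _ h => ?_⟩⟩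
      exact Dvd.dvd.mul_left (h.trans hX) _
    · rw [← map_conj] at hk1 hk2
      obtain ⟨n, hn, h⟩ := borel_case hθ ((MulAut.conj k).toMonoidHom.comp π)
        ((MulAut.conj k).surjective.comp hπ) (by
          rw [← hker]; ext x
          simp [MonoidHom.mem_ker]) hk1 hk2
      refine ⟨n, hn, ?_⟩
      rw [hqt] at h
      refine h.imp id fun h => ⟨(Dvd.intro _ rfl).trans h, fun r _ hr => ?_⟩
      exact (hr.trans ⟨Module.finrank ℂ Θ * t, by ring⟩).trans h
  · push Not at hr
    refine ⟨_, mem_charDegrees_of_irr hρ, Or.inr ?_⟩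
    rw [hd]
    refine ⟨⟨((Iner N θ).map π).index * Module.finrank ℂ (homN N θ ρ), by ring⟩, fun r h1 h2 => ?_⟩
    rw [mul_assoc]; exact Dvd.dvd.mul_right (hr r h1 h2) _
end Main

section Autom
variable {F : Type} [Field F] [Finite F] [CharP F 2]

theorem perm_fix {X : Type} [Finite X] {p : ℕ} (hp : p.Prime) (e : Equiv.Perm X) (he : e ^ p = 1)
    (A : Set X) (hA : ∀ x, e x ∈ A ↔ x ∈ A) (hc : ¬ p ∣ Nat.card A) : ∃ x ∈ A, e x = x := by
  classical
  have := Fintype.ofFinite A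
  have := Fact.mk hp
  rw [Nat.card_eq_fintype_card] at hc
  obtain ⟨a, ha⟩ := Equiv.Perm.exists_fixed_point_of_prime (n := 1) hc (σ := e.subtypePerm hA) (by
    rw [pow_one, Equiv.Perm.subtypePerm_pow]
    ext x
    simp [he])
  exact ⟨a, a.2, congrArg Subtype.val ha⟩

theorem sq_inj {a b : F} (h : a ^ 2 = b ^ 2) : a = b := by
  have : (a + b) ^ 2 = 0 := by rw [CharTwo.add_sq, h, CharTwo.add_self_eq_zero]
  exact CharTwo.add_eq_zero.1 (by simpa using this)

theorem sq_surj (a : F) : ∃ b, b ^ 2 = a := 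
  (Finite.injective_iff_surjective.1 (fun _ _ h => sq_inj h : Function.Injective (fun b : F => b ^ 2))) a

theorem invol_iff (g : S2 F) : g * g = 1 ↔ g 0 0 = g 1 1 := by
  have hd := S2_det g
  have h2 : (2 : F) = 0 := CharTwo.two_eq_zero
  constructor
  · intro h
    have e0 := congrArg (fun A : S2 F => A 0 0) h
    have e1 := congrArg (fun A : S2 F => A 1 1) h
    simp only [S2_mul] at e0 e1
    have e0 : g 0 0 * g 0 0 + g 0 1 * g 1 0 = 1 := e0
    have e1 : g 1 0 * g 0 1 + g 1 1 * g 1 1 = 1 := e1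
    apply sq_inj
    linear_combination e0 - e1
  · intro h
    rw [h] at hd
    have k1 : g 0 1 * g 1 1 + g 0 1 * g 1 1 = 0 := CharTwo.add_self_eq_zero _
    have k2 : g 1 0 * g 1 1 + g 1 0 * g 1 1 = 0 := CharTwo.add_self_eq_zero _
    apply S2_ext
    · rw [S2_mul, h]; change _ = (1 : F)
      linear_combination hd + g 0 1 * g 1 0 * h2
    · rw [S2_mul, h]; change _ = (0 : F)
      linear_combination k1
    · rw [S2_mul, h]; change _ = (0 : F)
      linear_combination k2
    · rw [S2_mul]; change _ = (1 : F)
      linear_combination hd + g 0 1 * g 1 0 * h2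

theorem card_invol : Nat.card {g : S2 F | g * g = 1 ∧ g ≠ 1} = Nat.card F ^ 2 - 1 := by
  classical
  have h1 : Nat.card {g : S2 F | g * g = 1} = Nat.card F ^ 2 := by
    rw [sq, ← Nat.card_prod]
    refine Nat.card_congr (Equiv.ofBijective (fun g => (g.1 0 1, g.1 1 0)) ⟨?_, ?_⟩)
    · rintro ⟨g, hg⟩ ⟨k, hk⟩ h
      have hg := (invol_iff g).1 hg
      have hk := (invol_iff k).1 hk
      simp only [Prod.mk.injEq] at h
      have d1 := S2_det g
      have d2 := S2_det k
      rw [hg] at d1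
      rw [hk, ← h.1, ← h.2] at d2
      have : g 1 1 = k 1 1 := sq_inj (by linear_combination d1 - d2)
      exact Subtype.ext (S2_ext (by rw [hg, hk, this]) h.1 h.2 this)
    · rintro ⟨b, c⟩
      obtain ⟨a, ha⟩ := sq_surj (1 + b * c)
      let g : S2 F := ⟨!![a, b; c, a], by rw [Matrix.det_fin_two_of]; linear_combination ha⟩
      exact ⟨⟨g, (invol_iff g).2 rfl⟩, rfl⟩
  have h2 : {g : S2 F | g * g = 1 ∧ g ≠ 1} = {g : S2 F | g * g = 1} \ {1} := by
    ext g; simp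
  rw [h2, Nat.card_coe_set_eq, Set.ncard_diff_singleton_of_mem (by simp), ← Nat.card_coe_set_eq, h1]

def Bsub (F : Type) [Field F] [Finite F] [CharP F 2] : Subgroup (S2 F) where
  carrier := {g | g 1 0 = 0}
  mul_mem' := by
    intro a b ha hb
    simp only [Set.mem_setOf_eq] at *
    rw [S2_mul, ha, hb]; ring
  one_mem' := rfl
  inv_mem' := by
    intro a ha
    exact ((S2_inv a).2.2.1).trans (by rw [show a 1 0 = 0 from ha, neg_zero])

theorem mem_Bsub {g : S2 F} : g ∈ Bsub F ↔ g 1 0 = 0 := Iff.rfl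

theorem card_nB : Nat.card {g : S2 F | g 1 0 ≠ 0} = Nat.card F ^ 2 * (Nat.card F - 1) := by
  have h1 := card_borel (F := F) (H := Bsub F) (fun x => rfl) (fun g h => h)
  have h2 : (Bsub F).comap (hHom F) = ⊤ := by
    rw [eq_top_iff]; intro s _; exact (rfl : (hh s) 1 0 = 0)
  rw [h2, Nat.card_congr (Subgroup.topEquiv (G := Fˣ)).toEquiv, Nat.card_units] at h1
  have h3 : {g : S2 F | g 1 0 ≠ 0} = ((Bsub F : Set (S2 F)))ᶜ := rfl
  have h4 := Set.ncard_add_ncard_compl (Bsub F : Set (S2 F))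
  rw [h3, Nat.card_coe_set_eq]
  rw [← Nat.card_coe_set_eq] at h4
  change Nat.card (Bsub F) + _ = _ at h4
  rw [card_S2', h1] at h4
  have hq : 1 < Nat.card F := Finite.one_lt_card
  obtain ⟨m, hm⟩ : ∃ m, Nat.card F = m + 1 := ⟨Nat.card F - 1, by omega⟩
  rw [hm] at h4 ⊢
  simp only [Nat.add_sub_cancel] at h4 ⊢
  nlinarith

theorem cent_uu {x0 : F} (hx : x0 ≠ 0) {g : S2 F} (h : g * uu x0 = uu x0 * g) : ∃ y, g = uu y := by
  have e0 := congrArg (fun A : S2 F => A 0 0) h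
  have e1 := congrArg (fun A : S2 F => A 0 1) h
  simp [S2_mul, hx] at e0 e1
  have e2 : g 0 0 = g 1 1 := by
    apply mul_right_cancel₀ hx
    linear_combination e1
  have hd := S2_det g
  have e3 : g 1 1 = 1 := sq_inj (by rw [e2, e0] at hd; linear_combination hd)
  refine ⟨g 0 1, ?_⟩
  apply S2_ext <;> simp [e0, e2, e3]

theorem field_aut_trivial {f p : ℕ} (hf : Nat.card F = 2 ^ f) (hp : p.Prime) (hpf : ¬ p ∣ f) (σ : F ≃+* F)
    (h : σ ^ p = 1) (x : F) : σ x = x := by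
  let _ : Algebra (ZMod 2) F := ZMod.algebra F 2
  have h2 : Module.finrank (ZMod 2) F = f := by
    have := Module.natCard_eq_pow_finrank (K := ZMod 2) (V := F)
    rw [hf] at this
    simp at this
    exact this.symm
  have h3 : Nat.card (F ≃ₐ[ZMod 2] F) = f := by
    rw [IsGalois.card_aut_eq_finrank, h2]
  let s : F ≃ₐ[ZMod 2] F := AlgEquiv.ofRingEquiv (f := σ) (fun r => by
    have := RingHom.congr_fun (Subsingleton.elim ((σ : F →+* F).comp (algebraMap (ZMod 2) F)) (algebraMap (ZMod 2) F)) r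
    exact this)
  have hs : s ^ p = 1 := by
    ext y
    have h5 : ∀ n, (s ^ n) y = (σ ^ n) y := by
      intro n
      induction n with
      | zero => rfl
      | succ n ih => rw [pow_succ', pow_succ']; change s ((s ^ n) y) = σ ((σ ^ n) y); rw [ih]; rfl
    rw [h5, h]; rfl
  have h6 : s ^ f = 1 := by rw [← h3]; exact pow_card_eq_one'
  have h7 : orderOf s ∣ 1 := by
    have hc : Nat.Coprime p f := (Nat.Prime.coprime_iff_not_dvd hp).2 hpf
    rw [← hc]
    exact Nat.dvd_gcd (orderOf_dvd_of_pow_eq_one hs) (orderOf_dvd_of_pow_eq_one h6)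
  have h8 : s = 1 := orderOf_eq_one_iff.1 (Nat.dvd_one.1 h7)
  exact AlgEquiv.congr_fun h8 x

theorem aut_fix_aux {f p : ℕ} (hf : Nat.card F = 2 ^ f) (hp : p.Prime) (hpf : ¬ p ∣ f)
    (hpS : ¬ p ∣ Nat.card (S2 F)) (α : MulAut (S2 F)) (hα : α ^ p = 1) {x0 : F} (hx0 : x0 ≠ 0)
    (hfix : α (uu x0) = uu x0) : α = 1 := by
  have hσ : ∀ x, ∃ y, α (uu x) = uu y := by
    intro x
    apply cent_uu hx0
    rw [← hfix, ← map_mul, ← map_mul, ← uu_add, ← uu_add, add_comm]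
  choose σ hσ using hσ
  have hσadd : ∀ x y, σ (x + y) = σ x + σ y := fun x y => by
    apply uu_inj
    rw [uu_add, ← hσ, ← hσ, ← hσ, uu_add, map_mul]
  have hσ0 : σ x0 = x0 := uu_inj (by rw [← hσ, hfix])
  have hσinj : Function.Injective σ := fun x y h => by
    apply uu_inj (F := F); apply α.injective; rw [hσ, hσ, h]
  have hBc : ∀ g : S2 F, g 1 0 = 0 → (α g) 1 0 = 0 := by
    intro g hg
    obtain ⟨s, x, rfl⟩ := borel_form hg
    have h1 : α (uu x * hh s) * uu x0 = uu (σ ((s:F)^2 * x0)) * α (uu x * hh s) := by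
      rw [← hfix, ← map_mul, ← hσ, ← map_mul, mul_assoc, hh_uu, ← mul_assoc, ← mul_assoc, ← uu_add, ← uu_add, add_comm x]
    generalize α (uu x * hh s) = k at h1 ⊢
    have e := congrArg (fun A : S2 F => A 1 1) h1
    simp [S2_mul] at e
    exact e.resolve_right hx0
  have hBc' : ∀ g : S2 F, (α g) 1 0 ≠ 0 ↔ g 1 0 ≠ 0 := by
    have hle : (Bsub F).map α.toMonoidHom ≤ Bsub F := by
      rintro _ ⟨g, hg, rfl⟩; exact hBc g hg
    have heq : (Bsub F).map α.toMonoidHom = Bsub F := by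
      apply Subgroup.eq_of_le_of_card_ge hle
      rw [Subgroup.card_map_of_injective]
      exact α.injective
    intro g
    apply not_congr
    refine ⟨fun h => ?_, hBc g⟩
    have : α g ∈ (Bsub F).map α.toMonoidHom := by rw [heq]; exact h
    obtain ⟨k, hk, e⟩ := this
    rw [← α.injective e]; exact hk
  obtain ⟨g, hg, hgf⟩ := perm_fix hp α.toEquiv (by
    ext x
    have h1 : ∀ n, ((α.toEquiv : Equiv.Perm (S2 F)) ^ n) x = (α ^ n) x := by
      intro n
      induction n with
      | zero => rfl
      | succ n ih => rw [pow_succ', pow_succ']; change α (((α.toEquiv : Equiv.Perm (S2 F)) ^ n) x) = α ((α ^ n) x); rw [ih]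
    rw [h1, hα]; rfl) {g : S2 F | g 1 0 ≠ 0} hBc' (by
      rw [card_nB]
      intro h
      apply hpS
      rw [card_S2']
      rcases (Nat.Prime.dvd_mul hp).1 h with h | h
      · rw [mul_assoc]; exact Dvd.dvd.mul_right (hp.dvd_of_dvd_pow h) _
      · exact Dvd.dvd.mul_left h _)
  have hmul : ∀ (s : F) x, s ≠ 0 → σ (s * x) * x0 = σ (s * x0) * σ x := by
    intro s x hs
    obtain ⟨r, hr⟩ := unit_sq (Units.mk0 s hs)
    have hr : (r : F) ^ 2 = s := by simpa using congrArg Units.val hr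
    obtain ⟨r', y, hr'⟩ := borel_form (hBc (hh r) rfl)
    have key : ∀ x, σ (s * x) = (r' : F) ^ 2 * σ x := by
      intro x
      have h1 : α (hh r) * uu (σ x) = uu (σ (s * x)) * α (hh r) := by
        rw [← hσ, ← hσ, ← map_mul, ← map_mul, hh_uu, hr]
      rw [hr', mul_assoc, hh_uu, ← mul_assoc, ← mul_assoc, ← uu_add, ← uu_add, add_comm y] at h1
      have h2 := uu_inj (mul_right_cancel h1)
      exact (add_right_cancel h2).symm
    rw [key, key, hσ0]; ring
  have hz : σ 0 = 0 := by
    have := hσadd 0 0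
    rw [add_zero] at this
    exact left_eq_add.1 this
  -- normalised automorphism
  let τ : F →+* F :=
    { toFun := fun x => σ (x0 * x) / x0
      map_one' := by rw [mul_one, hσ0, div_self hx0]
      map_zero' := by rw [mul_zero, hz, zero_div]
      map_add' := by intro x y; rw [mul_add, hσadd, add_div]
      map_mul' := by
        intro x y
        by_cases hx : x = 0
        · simp [hx, hz]
        have := hmul x (x0 * y) hx
        rw [show x0 * (x * y) = x * (x0 * y) by ring, mul_comm x0 x, div_mul_div_comm, ← this,
          mul_div_mul_right _ _ hx0] }
  have hτ : ∀ x, τ x = σ (x0 * x) / x0 := fun x => rfl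
  let τe : F ≃+* F := RingEquiv.ofBijective τ (Finite.injective_iff_bijective.1 τ.injective)
  have hτp : τe ^ p = 1 := by
    have h1 : ∀ n x, uu (x0 * (τe ^ n) x) = (α ^ n) (uu (x0 * x)) := by
      intro n x
      induction n with
      | zero => rfl
      | succ n ih =>
        rw [pow_succ', pow_succ']
        change uu (x0 * τ ((τe ^ n) x)) = α ((α ^ n) (uu (x0 * x)))
        rw [← ih, hσ, hτ, mul_div_cancel₀ _ hx0]
    ext x
    have h2 := h1 p x
    rw [hα] at h2
    exact mul_left_cancel₀ hx0 (uu_inj h2)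
  have htriv : ∀ x, α (uu x) = uu x := by
    intro x
    have h1 := field_aut_trivial hf hp hpf τe hτp (x / x0)
    change τ (x / x0) = _ at h1
    rw [hτ, mul_div_cancel₀ _ hx0] at h1
    rw [hσ, (div_left_inj' hx0).1 h1]
  let H : Subgroup (S2 F) := MonoidHom.eqLocus α.toMonoidHom (MonoidHom.id _)
  have hH : H = ⊤ := gen_top' H (fun x => htriv x) (g := g) hgf hg
  ext1 k
  have : k ∈ H := by rw [hH]; trivial
  exact this

theorem aut_trivial {f p : ℕ} (hf : Nat.card F = 2 ^ f) (hp : p.Prime) (hpf : ¬ p ∣ f)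
    (hpS : ¬ p ∣ Nat.card (S2 F)) (α : MulAut (S2 F)) (hα : α ^ p = 1) : α = 1 := by
  obtain ⟨t, ⟨ht1, ht2⟩, htf⟩ := perm_fix hp α.toEquiv (by
    ext x
    have h1 : ∀ n, ((α.toEquiv : Equiv.Perm (S2 F)) ^ n) x = (α ^ n) x := by
      intro n
      induction n with
      | zero => rfl
      | succ n ih => rw [pow_succ', pow_succ']; change α (((α.toEquiv : Equiv.Perm (S2 F)) ^ n) x) = α ((α ^ n) x); rw [ih]
    rw [h1, hα]; rfl) {g : S2 F | g * g = 1 ∧ g ≠ 1} (by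
      intro x
      change α x * α x = 1 ∧ α x ≠ 1 ↔ x * x = 1 ∧ x ≠ 1
      rw [← map_mul, map_eq_one_iff α α.injective, Ne, map_eq_one_iff α α.injective]) (by
      rw [card_invol]
      intro h
      apply hpS
      rw [card_S2]; exact Dvd.dvd.mul_left h _)
  obtain ⟨f', hf0, hf'⟩ := card_two_pow F
  obtain ⟨k, hk⟩ := conj_le_of_pgroup Nat.prime_two (Usub F) (Subgroup.zpowers t) (by
    apply IsPGroup.of_card (n := 1)
    rw [Nat.card_zpowers, pow_one]
    exact orderOf_eq_prime (by rw [sq]; exact ht1) ht2) (by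
    rw [index_Usub, hf']
    have : 2 ^ f' = 2 * 2 ^ (f' - 1) := by rw [← pow_succ']; congr 1; omega
    have h0 : 0 < 2 ^ (f' - 1) := by positivity
    intro h
    rcases (Nat.Prime.dvd_mul Nat.prime_two).1 h with h | h <;> omega)
  obtain ⟨x0, hx⟩ := mem_Usub.1 (hk t (Subgroup.mem_zpowers t))
  have hx0 : x0 ≠ 0 := by
    rintro rfl
    rw [uu_zero] at hx
    apply ht2
    calc t = k * (k⁻¹ * t * k) * k⁻¹ := by group
      _ = 1 := by rw [← hx]; group
  let c : MulAut (S2 F) := MulAut.conj k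
  have htf : α t = t := htf
  have h1 : c⁻¹ * α * c = 1 := by
    apply aut_fix_aux hf hp hpf hpS (c⁻¹ * α * c) _ hx0
    · change c⁻¹ (α (c (uu x0))) = uu x0
      have e : c (uu x0) = t := by
        rw [hx]; simp only [c, MulAut.conj_apply]; group
      rw [e, htf, ← e]; simp
    · have := conj_pow (i := p) (a := c⁻¹) (b := α)
      rw [inv_inv] at this
      rw [this, hα]; simp
  calc α = c * (c⁻¹ * α * c) * c⁻¹ := by group
    _ = 1 := by rw [h1]; group
end Autom

theorem odd_geom (x : ℤ) (hx : Odd x) (j : ℕ) :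
    ∃ m : ℤ, Odd m ∧ x ^ (2 * j + 1) - 1 = (x - 1) * m := by
  induction j with
  | zero => exact ⟨1, odd_one, by ring⟩
  | succ j ih =>
    obtain ⟨m, hm, e⟩ := ih
    refine ⟨x ^ 2 * m + x + 1, ?_, ?_⟩
    · exact ((hx.pow.mul hm).add_odd hx).add_one
    · linear_combination x ^ 2 * e

theorem odd_dvd_two_pow {m : ℤ} (hm : Odd m) {f : ℕ} (h : m ∣ 2 ^ f) : m = 1 ∨ m = -1 := by
  have : IsCoprime m (2 ^ f) := by
    apply IsCoprime.pow_right
    obtain ⟨k, rfl⟩ := hm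
    exact ⟨1, -k, by ring⟩
  exact Int.isUnit_iff.1 (this.isUnit_of_dvd' dvd_rfl h)

theorem primePow_of_card {n : ℕ} (h : n.primeFactors.card = 1) : ∃ t k, t.Prime ∧ 0 < k ∧ t ^ k = n := by
  have := isPrimePow_iff_card_primeFactors_eq_one.2 h
  obtain ⟨t, k, ht, hk, e⟩ := this
  exact ⟨t, k, ht.nat_prime, hk, e⟩

theorem nt1 {f : ℕ} (hf : 2 ≤ f) (h1 : (2 ^ f - 1).primeFactors.card = 1)
    (h3 : (2 ^ f + 1).primeFactors.card = 3) :
    (2 ^ f - 1).Prime ∧ 4 < 2 ^ f ∧ ∃ l, ∀ p, p.Prime → p ∣ f → p = l := by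
  have hf2 : f ≠ 2 := by
    rintro rfl
    rw [show 2 ^ 2 + 1 = 5 by norm_num, Nat.Prime.primeFactors (by norm_num)] at h3
    simp at h3
  have h4 : 4 < 2 ^ f := by
    calc 4 < 2 ^ 3 := by norm_num
      _ ≤ 2 ^ f := Nat.pow_le_pow_right (by norm_num) (by omega)
  have hp : (2 ^ f - 1).Prime := by
    obtain ⟨t, k, ht, hk, e⟩ := primePow_of_card h1
    have e' : t ^ k + 1 = 2 ^ f := by omega
    have h4d : 4 ∣ 2 ^ f := by
      rw [show 4 = 2 ^ 2 by norm_num]; exact pow_dvd_pow _ hf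
    have hto : Odd t := by
      rcases ht.eq_two_or_odd' with rfl | h
      · have : 2 ∣ 2 ^ k := dvd_pow_self 2 hk.ne'
        omega
      · exact h
    rcases Nat.even_or_odd' k with ⟨j, rfl | rfl⟩
    · exfalso
      rw [mul_comm, pow_mul] at e'
      obtain ⟨a, ha⟩ : Odd (t ^ j) := hto.pow
      rw [ha] at e'
      have : (2 * a + 1) ^ 2 + 1 = 4 * (a ^ 2 + a) + 2 := by ring
      omega
    · obtain ⟨m, hm, em⟩ := odd_geom (-(t : ℤ)) (by simpa using hto) j
      have em' : (t : ℤ) ^ (2 * j + 1) + 1 = (t + 1) * m := by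
        rw [Odd.neg_pow ⟨j, rfl⟩] at em
        linear_combination -em
      have ez : (t : ℤ) ^ (2 * j + 1) + 1 = 2 ^ f := by exact_mod_cast e'
      rcases odd_dvd_two_pow hm (f := f) ⟨t + 1, by rw [← ez, em']; ring⟩ with rfl | rfl
      · have : t ^ (2 * j + 1) = t := by
          have : (t : ℤ) ^ (2 * j + 1) = t := by linarith
          exact_mod_cast this
        rw [← e, this]; exact ht
      · have : (0 : ℤ) < 2 ^ f := by positivity
        have : (0 : ℤ) ≤ t := by positivity
        linarith
  refine ⟨hp, h4, f, fun p pp hd => ?_⟩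
  exact (Nat.prime_dvd_prime_iff_eq pp (Nat.prime_of_pow_sub_one_prime (by omega) hp).2).1 hd

theorem nt2 {f : ℕ} (hf : 2 ≤ f) (h1 : (2 ^ f + 1).primeFactors.card = 1)
    (h3 : (2 ^ f - 1).primeFactors.card = 3) :
    (2 ^ f + 1).Prime ∧ 4 < 2 ^ f ∧ ∃ l, ∀ p, p.Prime → p ∣ f → p = l := by
  have hf2 : f ≠ 2 := by
    rintro rfl
    rw [show 2 ^ 2 - 1 = 3 by norm_num, Nat.Prime.primeFactors (by norm_num)] at h3
    simp at h3
  have hf3 : f ≠ 3 := by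
    rintro rfl
    rw [show 2 ^ 3 - 1 = 7 by norm_num, Nat.Prime.primeFactors (by norm_num)] at h3
    simp at h3
  have h4 : 4 < 2 ^ f := by
    calc 4 < 2 ^ 3 := by norm_num
      _ ≤ 2 ^ f := Nat.pow_le_pow_right (by norm_num) (by omega)
  have hp : (2 ^ f + 1).Prime := by
    obtain ⟨t, k, ht, hk, e⟩ := primePow_of_card h1
    have h4d : 4 ∣ 2 ^ f := by
      rw [show 4 = 2 ^ 2 by norm_num]; exact pow_dvd_pow _ hf
    have hto : Odd t := by
      rcases ht.eq_two_or_odd' with rfl | h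
      · have : 2 ∣ 2 ^ k := dvd_pow_self 2 hk.ne'
        omega
      · exact h
    rcases Nat.even_or_odd' k with ⟨j, rfl | rfl⟩
    · exfalso
      rw [mul_comm, pow_mul] at e
      obtain ⟨a, ha⟩ : Odd (t ^ j) := hto.pow
      rw [ha] at e
      have e2 : (2 * a) * (2 * a + 2) = 2 ^ f := by
        have : (2 * a + 1) ^ 2 = (2 * a) * (2 * a + 2) + 1 := by ring
        omega
      obtain ⟨b, hb, hb'⟩ := (Nat.dvd_prime_pow Nat.prime_two).1 (Dvd.intro _ e2)
      obtain ⟨c, hc, hc'⟩ := (Nat.dvd_prime_pow Nat.prime_two).1 (Dvd.intro_left _ e2)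
      have ha0 : a ≠ 0 := by
        rintro rfl
        omega
      have hb2 : b < 2 := by
        by_contra hb2
        have d1 : 2 ^ 2 ∣ 2 ^ b := pow_dvd_pow 2 (by omega)
        rcases Nat.lt_or_ge c 2 with h | h
        · interval_cases c <;> omega
        · have d2 : 2 ^ 2 ∣ 2 ^ c := pow_dvd_pow 2 h
          omega
      have : 2 ^ f = 2 ^ 3 := by
        interval_cases b
        · omega
        · have : a = 1 := by omega
          rw [← e2, this]; norm_num
      exact hf3 (Nat.pow_right_injective le_rfl this)
    · obtain ⟨m, hm, em⟩ := odd_geom (t : ℤ) (by simpa using hto) j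
      have ez : (t : ℤ) ^ (2 * j + 1) = 2 ^ f + 1 := by exact_mod_cast e
      have ht1 : (1 : ℤ) < t := by exact_mod_cast ht.one_lt
      rcases odd_dvd_two_pow hm (f := f) ⟨t - 1, by linear_combination em - ez⟩ with rfl | rfl
      · have : t ^ (2 * j + 1) = t := by
          have : (t : ℤ) ^ (2 * j + 1) = t := by linarith
          exact_mod_cast this
        rw [← e, this]; exact ht
      · have : (0 : ℤ) < 2 ^ f := by positivity
        linarith
  refine ⟨hp, h4, 2, fun p pp hd => ?_⟩
  obtain ⟨m, rfl⟩ := Nat.pow_of_pow_add_prime (by norm_num) (by omega) hp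
  exact (Nat.prime_dvd_prime_iff_eq pp Nat.prime_two).1 (pp.dvd_of_dvd_pow hd)

theorem center_triv (F : Type) [Field F] [Finite F] [CharP F 2] : Subgroup.center (S2 F) = ⊥ := by
  rw [eq_bot_iff]
  intro g hg
  obtain ⟨r, hr, e⟩ := Matrix.SpecialLinearGroup.mem_center_iff.1 hg
  have hr1 : r = 1 := sq_inj (by simpa using hr)
  rw [Subgroup.mem_bot]
  apply Subtype.ext
  rw [← e, hr1]
  simp

theorem psl_equiv (F : Type) [Field F] [Finite F] [CharP F 2] : Nonempty (PSL2 F ≃* S2 F) :=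
  ⟨(QuotientGroup.quotientMulEquivOfEq (center_triv F)).trans QuotientGroup.quotientBot⟩

theorem inflate {G H : Type} [Group G] [Group H] [Finite G] (π : G →* H) (hπ : Function.Surjective π)
    {n : ℕ} (hn : n ∈ charDegrees H) : n ∈ charDegrees G := by
  obtain ⟨V, _, _, _, ρ, hρ, rfl⟩ := exists_irr_of_mem_charDegrees hn
  have : Irr (ρ.comp π) := by
    refine ⟨hρ.1, fun W hW => hρ.2 W fun g v hv => ?_⟩
    obtain ⟨g, rfl⟩ := hπ g
    exact hW g v hv
  exact mem_charDegrees_of_irr this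

theorem exists_pi {G F : Type} [Group G] [Finite G] [Field F] [Finite F] [CharP F 2] (M : Subgroup G)
    (e : ↥(radicalQuotImage M) ≃* S2 F) : ∃ π : M →* S2 F, Function.Surjective π := by
  refine ⟨e.toMonoidHom.comp ((QuotientGroup.mk' (solvableRadical G)).subgroupMap M), ?_⟩
  exact e.surjective.comp ((QuotientGroup.mk' (solvableRadical G)).subgroupMap_surjective M)

theorem index_coprime {G F : Type} [Group G] [Finite G] [Field F] [Finite F] [CharP F 2] (M : Subgroup G)
    (hM : M.Normal)
    (e : ↥(radicalQuotImage M) ≃* S2 F)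
    (hcent : Subgroup.centralizer ((radicalQuotImage M) : Set (G ⧸ solvableRadical G)) = ⊥)
    {f p : ℕ} (hf : Nat.card F = 2 ^ f) (hp : p.Prime) (hpf : ¬ p ∣ f)
    (hpS : ¬ p ∣ Nat.card (S2 F)) : ¬ p ∣ (solvableRadical G).index := by
  intro h
  have : Fact p.Prime := ⟨hp⟩
  rw [Subgroup.index_eq_card] at h
  obtain ⟨a, ha⟩ := exists_prime_orderOf_dvd_card' p h
  have hN : (radicalQuotImage M).Normal := hM.map _ (QuotientGroup.mk'_surjective _)
  let β : MulAut (radicalQuotImage M) := MulAut.conjNormal a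
  have hβ : β ^ p = 1 := by
    change (MulAut.conjNormal a) ^ p = 1
    rw [← map_pow, ← ha, pow_orderOf_eq_one, map_one]
  let α : MulAut (S2 F) := MulAut.congr e β
  have hα : α ^ p = 1 := by
    change (MulAut.congr e β) ^ p = 1
    rw [← map_pow, hβ, map_one]
  have h1 := aut_trivial hf hp hpf hpS α hα
  have h2 : β = 1 := by
    apply (MulAut.congr e).injective
    rw [map_one]; exact h1
  have h3 : a ∈ Subgroup.centralizer ((radicalQuotImage M) : Set (G ⧸ solvableRadical G)) := by
    rw [Subgroup.mem_centralizer_iff]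
    intro x hx
    have h4 := congrArg Subtype.val (MulEquiv.congr_fun h2 ⟨x, hx⟩)
    have h5 : a * x * a⁻¹ = x := by
      rw [← MulAut.conjNormal_apply a ⟨x, hx⟩]; exact h4
    rw [mul_inv_eq_iff_eq_mul] at h5
    exact h5.symm
  rw [hcent, Subgroup.mem_bot] at h3
  rw [h3, orderOf_one] at ha
  exact hp.one_lt.ne ha

theorem adj_of {G : Type} [Group G] {n : ℕ} (hn : n ∈ charDegrees G) {x y : charPrimes G}
    (hxy : x ≠ y) (hx : (x : ℕ) ∣ n) (hy : (y : ℕ) ∣ n) : (charGraph G).Adj x y := by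
  have h : (x : ℕ) ≠ y := fun h => hxy (Subtype.ext h)
  exact ⟨h, n, hn, Nat.Coprime.mul_dvd_of_dvd_of_dvd
    ((Nat.coprime_primes x.2.1 y.2.1).2 h) hx hy⟩

theorem assemble (G F : Type) [Group G] [Finite G] [Field F] [Finite F] [CharP F 2]
    (h4 : (charGraph G).CliqueFree 4)
    (h7 : Nat.card ↥(charPrimes G) = 7)
    (M : Subgroup G) (hM : M.Normal) (hRM : solvableRadical G < M)
    (f : ℕ) (hf : Nat.card F = 2 ^ f)
    (e : ↥(radicalQuotImage M) ≃* S2 F)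
    (hcent : Subgroup.centralizer ((radicalQuotImage M) : Set (G ⧸ solvableRadical G)) = ⊥)
    (hbip : ¬ (((charGraph G).induce
      {x : ↥(charPrimes G) | (x : ℕ) ∈ (Nat.card ↥(radicalQuotImage M)).primeFactors})ᶜ).Colorable 2)
    (t : ℕ) (ht : t.Prime) (ht2 : t ≠ 2) (A : Finset ℕ) (hA : A.card = 3)
    (hAS : (Nat.card (S2 F)).primeFactors = insert 2 (insert t A))
    (hl : ∃ l, ∀ p, p.Prime → p ∣ f → p = l)
    (hS : ∃ n ∈ charDegrees (S2 F), ∀ r ∈ A, r ∣ n)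
    (hmain : ∀ (π : M →* S2 F), Function.Surjective π → ∀ (Θ : Type) [AddCommGroup Θ] [Module ℂ Θ]
      [FiniteDimensional ℂ Θ] (θ : Representation ℂ π.ker Θ), Irr θ →
        ∃ n ∈ charDegrees M, 2 * t ∣ n ∨ (Module.finrank ℂ Θ ∣ n ∧ ∀ r ∈ A, r ∣ n)) : False := by
  classical
  obtain ⟨π, hπ⟩ := exists_pi M e
  have hcard : Nat.card (radicalQuotImage M) = Nat.card (S2 F) := Nat.card_congr e.toEquiv
  rw [hcard, hAS] at hbip
  have hAp : ∀ r ∈ A, r.Prime := fun r hr => by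
    have : r ∈ (Nat.card (S2 F)).primeFactors := by rw [hAS]; simp [hr]
    exact Nat.prime_of_mem_primeFactors this
  -- (I)
  have I : ¬ ∃ n ∈ charDegrees G, 2 * t ∣ n := by
    rintro ⟨n, hn, hd⟩
    obtain ⟨m, hm, hmd⟩ := hS
    obtain ⟨m', hm', hmd'⟩ := dvd_above M (inflate π hπ hm)
    apply hbip
    refine ⟨SimpleGraph.Coloring.mk (fun x => if (x.1 : ℕ) ∈ A then (0 : Fin 2) else 1) ?_⟩
    rintro ⟨x, hx⟩ ⟨y, hy⟩ hxy heq
    rw [SimpleGraph.compl_adj] at hxy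
    obtain ⟨hne, hna⟩ := hxy
    apply hna
    have hne' : x ≠ y := fun h => hne (Subtype.ext h)
    change (charGraph G).Adj x y
    by_cases hxA : (x : ℕ) ∈ A <;> by_cases hyA : (y : ℕ) ∈ A
    · exact adj_of hm' hne' ((hmd _ hxA).trans hmd') ((hmd _ hyA).trans hmd')
    · simp [hxA, hyA] at heq
    · simp [hxA, hyA] at heq
    · simp only [Set.mem_setOf_eq, Finset.mem_insert, hxA, hyA, or_false] at hx hy
      refine adj_of hn hne' (Dvd.dvd.trans ?_ hd) (Dvd.dvd.trans ?_ hd)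
      · rcases hx with h | h <;> rw [h]
        exacts [Dvd.intro _ rfl, Dvd.intro_left _ rfl]
      · rcases hy with h | h <;> rw [h]
        exacts [Dvd.intro _ rfl, Dvd.intro_left _ rfl]
  -- (II)
  have II : ∀ p, p.Prime → p ∉ A → ¬ ∃ n ∈ charDegrees G, p ∣ n ∧ ∀ r ∈ A, r ∣ n := by
    rintro p hp hpA ⟨n, hn, hpn, hrn⟩
    have hB : ∀ r ∈ insert p A, r.Prime ∧ r ∣ n := by
      intro r hr
      rcases Finset.mem_insert.1 hr with rfl | h
      exacts [⟨hp, hpn⟩, ⟨hAp r h, hrn r h⟩]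
    have hB' : ∀ r ∈ insert p A, r ∈ charPrimes G := fun r hr => ⟨(hB r hr).1, n, hn, (hB r hr).2⟩
    let s : Finset (charPrimes G) := (insert p A).attach.image (fun r => ⟨r.1, hB' r.1 r.2⟩)
    refine h4 s ⟨?_, ?_⟩
    · intro x hx y hy hxy
      simp only [s, Finset.coe_image, Set.mem_image] at hx hy
      obtain ⟨⟨x', hx'⟩, -, rfl⟩ := hx
      obtain ⟨⟨y', hy'⟩, -, rfl⟩ := hy
      exact adj_of hn hxy (hB _ hx').2 (hB _ hy').2
    · rw [Finset.card_image_of_injective, Finset.card_attach, Finset.card_insert_of_notMem hpA, hA]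
      intro x y hxy
      exact Subtype.ext (congrArg (fun z : charPrimes G => (z : ℕ)) hxy)
  -- (III)
  obtain ⟨l, hl⟩ := hl
  have III : ∃ p ∈ charPrimes G, p ∉ insert l (insert 2 (insert t A)) := by
    by_contra hcon
    push Not at hcon
    have hsub : charPrimes G ⊆ ((insert l (insert 2 (insert t A)) : Finset ℕ) : Set ℕ) := fun p hp => hcon p hp
    have h1 := Set.ncard_le_ncard hsub (Finset.finite_toSet _)
    rw [Set.ncard_coe_finset, ← Nat.card_coe_set_eq, h7] at h1
    have h2 := Finset.card_insert_le l (insert 2 (insert t A))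
    have h3 := Finset.card_insert_le 2 (insert t A)
    have h5 := Finset.card_insert_le t A
    omega
  obtain ⟨p, ⟨hp, n, hn, hpn⟩, hpn'⟩ := III
  simp only [Finset.mem_insert, not_or] at hpn'
  obtain ⟨hpl, hp2, hpt, hpA⟩ := hpn'
  have hpS : ¬ p ∣ Nat.card (S2 F) := by
    intro h
    have : p ∈ (Nat.card (S2 F)).primeFactors := Nat.mem_primeFactors.2 ⟨hp, h, Nat.card_pos.ne'⟩
    rw [hAS] at this
    simp [hp2, hpt, hpA] at this
  have hpR := index_coprime M hM e hcent hf hp (fun h => hpl (hl p hp h)) hpS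
  have hpM : ¬ p ∣ M.index := fun h => hpR (h.trans (Subgroup.index_dvd_of_le hRM.le))
  obtain ⟨V, _, _, _, ρ, hρ, rfl⟩ := exists_irr_of_mem_charDegrees hn
  obtain ⟨Ψ, _, _, _, ψ, hψ, hpψ⟩ := dvd_below M hρ hp hpM hpn
  have hker : ¬ p ∣ π.ker.index := by
    rw [Subgroup.index_ker, MonoidHom.range_eq_top.2 hπ, Nat.card_congr (Subgroup.topEquiv (G := S2 F)).toEquiv]
    exact hpS
  obtain ⟨Θ, _, _, _, θ, hθ, hpθ⟩ := dvd_below π.ker hψ hp hker hpψ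
  obtain ⟨k, hk, hd⟩ := hmain π hπ Θ θ hθ
  obtain ⟨k', hk', hd'⟩ := dvd_above M hk
  rcases hd with hd | ⟨hd1, hd2⟩
  · exact I ⟨k', hk', hd.trans hd'⟩
  · exact II p hp hpA ⟨k', hk', hpθ.trans (hd1.trans hd'), fun r hr => (hd2 r hr).trans hd'⟩

theorem stmt13 (G : Type) [Group G] [Finite G]
    (h4 : (charGraph G).CliqueFree 4)
    (h7 : Nat.card ↥(charPrimes G) = 7)
    (M : Subgroup G) (hM : M.Normal) (hRM : solvableRadical G < M)
    (f : ℕ) (hf : 2 ≤ f)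
    (hS : Nonempty (↥(radicalQuotImage M) ≃* PSL2 (GaloisField 2 f)))
    (hcent : Subgroup.centralizer ((radicalQuotImage M) : Set (G ⧸ solvableRadical G)) = ⊥)
    (hbip : ¬ (((charGraph G).induce
      {x : ↥(charPrimes G) | (x : ℕ) ∈ (Nat.card ↥(radicalQuotImage M)).primeFactors})ᶜ).Colorable 2)
    (hoddcyc : ∀ (v : ↥(charPrimes G)) (w : ((charGraph G)ᶜ).Walk v v),
      w.IsCycle → Odd w.length →
      ∀ x ∈ w.support, (x : ℕ) ∈ (Nat.card ↥(radicalQuotImage M)).primeFactors) :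
    ¬ (((2 ^ f - 1).primeFactors.card = 1 ∧ (2 ^ f + 1).primeFactors.card = 3) ∨
       ((2 ^ f - 1).primeFactors.card = 3 ∧ (2 ^ f + 1).primeFactors.card = 1)) := by
  have hF : Nat.card (GaloisField 2 f) = 2 ^ f := GaloisField.card 2 f (by omega)
  have hfin : Finite (GaloisField 2 f) := Nat.finite_of_card_ne_zero (by rw [hF]; positivity)
  obtain ⟨e0⟩ := hS
  obtain ⟨e1⟩ := psl_equiv (GaloisField 2 f)
  have e := e0.trans e1
  have hcardS := card_S2' (F := GaloisField 2 f)
  have hpf : (Nat.card (S2 (GaloisField 2 f))).primeFactors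
      = {2} ∪ (2 ^ f + 1).primeFactors ∪ (2 ^ f - 1).primeFactors := by
    have h8 : 2 ^ 2 ≤ 2 ^ f := Nat.pow_le_pow_right (by norm_num) hf
    rw [hcardS, hF, Nat.primeFactors_mul (by positivity) (by omega),
      Nat.primeFactors_mul (by positivity) (by omega), Nat.primeFactors_prime_pow (by omega) Nat.prime_two]
  have h2f : 2 ∣ 2 ^ f := dvd_pow_self 2 (by omega)
  rintro (⟨h1, h3⟩ | ⟨h3, h1⟩)
  · obtain ⟨ht, hq, hl⟩ := nt1 hf h1 h3
    refine assemble G (GaloisField 2 f) h4 h7 M hM hRM f hF e hcent hbip (2 ^ f - 1) ht (by omega)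
      (2 ^ f + 1).primeFactors h3 ?_ hl ?_ ?_
    · rw [hpf, ht.primeFactors]
      ext x; simp
    · obtain ⟨W, _, _, _, σ, hσ, hd⟩ := exists_principal (F := GaloisField 2 f) (by omega)
      refine ⟨_, mem_charDegrees_of_irr hσ, fun r hr => ?_⟩
      rw [hd, hF]; exact Nat.dvd_of_mem_primeFactors hr
    · intro π hπ Θ _ _ _ θ hθ
      obtain ⟨n, hn, h⟩ := main_case1 hθ π hπ rfl ht (by rw [hF]) (by omega)
      refine ⟨n, hn, h.imp id (fun h => ⟨h.1, fun r hr => h.2 r (Nat.prime_of_mem_primeFactors hr) ?_⟩)⟩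
      rw [hF]; exact Nat.dvd_of_mem_primeFactors hr
  · obtain ⟨ht, hq, hl⟩ := nt2 hf h1 h3
    refine assemble G (GaloisField 2 f) h4 h7 M hM hRM f hF e hcent hbip (2 ^ f + 1) ht (by omega)
      (2 ^ f - 1).primeFactors h3 ?_ hl ?_ ?_
    · rw [hpf, ht.primeFactors]
      ext x; simp
    · obtain ⟨W, _, _, _, σ, hσ, hd⟩ := exists_cuspidal (F := GaloisField 2 f) (by omega)
      refine ⟨_, mem_charDegrees_of_irr hσ, fun r hr => ?_⟩
      rw [hF] at hd; exact (Nat.dvd_of_mem_primeFactors hr).trans hd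
    · intro π hπ Θ _ _ _ θ hθ
      obtain ⟨n, hn, h⟩ := main_case2 hθ π hπ rfl ht (by rw [hF]) (by omega)
      refine ⟨n, hn, h.imp id (fun h => ⟨h.1, fun r hr => h.2 r (Nat.prime_of_mem_primeFactors hr) ?_⟩)⟩
      rw [hF]; exact Nat.dvd_of_mem_primeFactors hr
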